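/- Let K = GF(q) be a finite field with q ≡ 3 (mod 4) and (V, f) a finite-dimensional nondegenerate symmetric bilinear space over K. Let φ ∈ Ω(V). Then φ is reversible in Ω(V) but not bireflectional in Ω(V) if and only if V has an orthogonal decomposition V = V_O ⊥ V_E into nondegenerate φ-invariant subspaces, with φ_O = φ|V_O and φ_E = φ|V_E, such that: (1) φ_O is bicyclic with exactly two elementary divisors e₁ = e₂ = (x − 1)^{2t+1} or e₁ = e₂ = (x + 1)^{2t+1} for some t ≥ 0; (2) disc V_O = 1 and dim V_E ≡ 4 (mod 8); and (3) φ_E has no elementary divisor p^d with p monic irreducible and d odd. -/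

import Mathlib

open Polynomial Module

namespace Biref

variable {K V : Type*} [Field K] [AddCommGroup V] [Module K V]

/-- The orthogonal group of a bilinear form: all linear automorphisms preserving `f`. -/
def orthGroup (f : LinearMap.BilinForm K V) : Subgroup (V ≃ₗ[K] V) where
  carrier := {φ | ∀ x y : V, f (φ x) (φ y) = f x y}
  one_mem' := fun _ _ => rfl
  mul_mem' := by
    intro a b ha hb x y
    simpa using (ha (b x) (b y)).trans (hb x y)
  inv_mem' := by
    intro a ha x y
    show f (a.symm x) (a.symm y) = f x y
    conv_rhs => rw [← a.apply_symm_apply x, ← a.apply_symm_apply y]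
    exact (ha _ _).symm

/-- The special orthogonal group: isometries of determinant 1. -/
def specialOrthGroup (f : LinearMap.BilinForm K V) : Subgroup (V ≃ₗ[K] V) where
  carrier := {φ | (∀ x y : V, f (φ x) (φ y) = f x y) ∧
      LinearMap.det (φ : V →ₗ[K] V) = 1}
  one_mem' := ⟨fun _ _ => rfl, by simp⟩
  mul_mem' := by
    rintro a b ⟨ha, ha'⟩ ⟨hb, hb'⟩
    refine ⟨fun x y => by simpa using (ha (b x) (b y)).trans (hb x y), ?_⟩
    rw [LinearEquiv.coe_toLinearMap_mul, map_mul, ha', hb', one_mul]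
  inv_mem' := by
    rintro a ⟨ha, ha'⟩
    refine ⟨fun x y => ?_, ?_⟩
    · show f (a.symm x) (a.symm y) = f x y
      conv_rhs => rw [← a.apply_symm_apply x, ← a.apply_symm_apply y]
      exact (ha _ _).symm
    · have h1 : LinearMap.det ((a⁻¹ * a : V ≃ₗ[K] V) : V →ₗ[K] V) = 1 := by
        rw [inv_mul_cancel, LinearEquiv.coe_toLinearMap_one, LinearMap.det_id]
      rw [LinearEquiv.coe_toLinearMap_mul, map_mul, ha', mul_one] at h1
      exact h1

/-- The commutator subgroup `Ω(V)` of the orthogonal group. -/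
def omegaGroup (f : LinearMap.BilinForm K V) : Subgroup (V ≃ₗ[K] V) :=
  ⁅orthGroup f, orthGroup f⁆

/-- `g` is a product of two involutions lying in the subgroup `H`. -/
def IsBireflectionalIn {G : Type*} [Group G] (H : Subgroup G) (g : G) : Prop :=
  ∃ σ τ : G, σ ∈ H ∧ τ ∈ H ∧ σ ^ 2 = 1 ∧ τ ^ 2 = 1 ∧ g = σ * τ

/-- `g` is bireflectional in the group `G`. -/
def IsBireflectional {G : Type*} [Group G] (g : G) : Prop :=
  ∃ σ τ : G, σ ^ 2 = 1 ∧ τ ^ 2 = 1 ∧ g = σ * τ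

/-- `g` is reversed by some element of `H`. -/
def IsReversibleIn {G : Type*} [Group G] (H : Subgroup G) (g : G) : Prop :=
  ∃ α : G, α ∈ H ∧ α * g * α⁻¹ = g⁻¹

/-- A subspace is invariant under an endomorphism. -/
def Invt (ψ : V →ₗ[K] V) (U : Submodule K V) : Prop :=
  ∀ x ∈ U, ψ x ∈ U

/-- The discriminant of a (finite-dimensional, nondegenerate) bilinear space is the class
of `d` in `K*/(K*)²`: some Gram determinant equals `d` times a nonzero square. -/
def HasDisc (f : LinearMap.BilinForm K V) (d : K) : Prop :=
  ∃ (b : Basis (Fin (Module.finrank K V)) K V) (c : Kˣ),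
    (Matrix.of fun i j => f (b i) (b j)).det = d * (c : K) ^ 2

/-- A nondegenerate symmetric bilinear space is hyperbolic iff its Witt index is half its
dimension, i.e. there is a totally isotropic subspace of half the dimension. -/
def IsHyperbolicSpace (f : LinearMap.BilinForm K V) : Prop :=
  ∃ W : Submodule K V, (∀ x ∈ W, ∀ y ∈ W, f x y = 0) ∧
    2 * Module.finrank K W = Module.finrank K V

/-- The multiplicity of `p ^ d` as an elementary divisor of `φ`. -/
noncomputable def edMult (φ : Module.End K V) (p : K[X]) (d : ℕ) : ℕ :=
  (2 * Module.finrank K (LinearMap.ker (Polynomial.aeval φ p ^ d))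
    - Module.finrank K (LinearMap.ker (Polynomial.aeval φ p ^ (d + 1)))
    - Module.finrank K (LinearMap.ker (Polynomial.aeval φ p ^ (d - 1)))) / p.natDegree

/-- `n_j(φ)`: the number of elementary divisors `(x ± 1) ^ d` of `φ` with `d ≡ j mod 8`,
counted with multiplicity. -/
noncomputable def nPM [FiniteDimensional K V] (φ : Module.End K V) (j : ℕ) : ℕ :=
  ∑ d ∈ Finset.range (Module.finrank K V + 1),
    if d % 8 = j % 8 then edMult φ (X - 1) d + edMult φ (X + 1) d else 0

/-- The Fitting one space `Bahn^∞(ψ) = ⋂ⱼ im (ψ - 1)^j`. -/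
noncomputable def bahnInf (ψ : Module.End K V) : Submodule K V :=
  ⨅ j : ℕ, LinearMap.range ((ψ - 1) ^ j)

/-- The `K[x]`-submodule generated by `v` (`x` acting as `ψ`). -/
def cycSub (ψ : Module.End K V) (v : V) : Submodule K V :=
  Submodule.span K (Set.range fun n : ℕ => (ψ ^ n) v)

/-- `V` is a cyclic `K[x]`-module, `x` acting as `ψ`. -/
def IsCyclicEnd (ψ : Module.End K V) : Prop :=
  ∃ v : V, cycSub ψ v = ⊤

/-- `V` is a direct sum of two cyclic `K[x]`-submodules, `x` acting as `ψ`. -/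
def IsBicyclicEnd (ψ : Module.End K V) : Prop :=
  ∃ v w : V, cycSub ψ v ⊓ cycSub ψ w = ⊥ ∧ cycSub ψ v ⊔ cycSub ψ w = ⊤

/-- `V` is an indecomposable `K[x]`-module, `x` acting as `ψ`. -/
def ModIndec (ψ : Module.End K V) : Prop :=
  (⊥ : Submodule K V) ≠ ⊤ ∧
    ¬∃ A B : Submodule K V, Invt ψ A ∧ Invt ψ B ∧ A ≠ ⊥ ∧ B ≠ ⊥ ∧ A ⊓ B = ⊥ ∧ A ⊔ B = ⊤

/-- `ψ` is orthogonally indecomposable w.r.t. `f`: `V ≠ 0` and the only nondegenerate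
invariant subspaces are `0` and `V`. -/
def OrthIndec (f : LinearMap.BilinForm K V) (ψ : Module.End K V) : Prop :=
  (⊥ : Submodule K V) ≠ ⊤ ∧
    ∀ U : Submodule K V, Invt ψ U → (f.restrict U).Nondegenerate → U = ⊥ ∨ U = ⊤

/-- The Witt index: the dimension of a maximal totally isotropic subspace. -/
noncomputable def wittIndex (f : LinearMap.BilinForm K V) : ℕ :=
  sSup {n | ∃ W : Submodule K V, (∀ x ∈ W, ∀ y ∈ W, f x y = 0) ∧ Module.finrank K W = n}


set_option linter.all false
section
open LinearMap (BilinForm ker range det mem_ker ker_eq_bot)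
open Submodule (mem_sup span mem_span_singleton mem_span_singleton_self subset_span)
open Module.End (mul_apply)

section
open Classical in
noncomputable def pw {α : Type*} (S : Set α) (g : α → α) : α → α := fun x => if x ∈ S then g x else x

open Classical in
noncomputable def psgn {α : Type*} (S : Set α) (g : α → α) : ℤˣ :=
  if h : Finite α ∧ Function.Bijective (pw S g) then
    @Equiv.Perm.sign α _ (@Fintype.ofFinite α h.1) (Equiv.ofBijective _ h.2) else 1

theorem psgn_eq {α β : Type*} [Fintype β] [DecidableEq β] (S : Set α) (g : α → α) (σ : Equiv.Perm β)
    (e : α ≃ β) (h : ∀ x, e (pw S g x) = σ (e x)) : psgn S g = Equiv.Perm.sign σ := by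
  classical
  have hf : Finite α := Finite.of_equiv β e.symm
  have h2 : pw S g = e.symm ∘ σ ∘ e := by
    funext x; simp [← h]
  have hb : Function.Bijective (pw S g) := by
    rw [h2]; exact e.symm.bijective.comp (σ.bijective.comp e.bijective)
  rw [psgn, dif_pos ⟨hf, hb⟩]
  letI := @Fintype.ofFinite α hf
  exact Equiv.Perm.sign_eq_sign_of_equiv _ _ e (fun x => by simp [h])

theorem pw_bij {α : Type*} {S : Set α} {g : α → α} (hg : Function.Injective g) [Finite α]
    (hS : ∀ x, g x ∈ S ↔ x ∈ S) : Function.Bijective (pw S g) := by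
  rw [← Finite.injective_iff_bijective]
  intro x y h
  unfold pw at h
  split_ifs at h with h1 h2 h2
  · exact hg h
  · rw [← h, hS] at h2; exact absurd h1 h2
  · rw [h, hS] at h1; exact absurd h2 h1
  · exact h

theorem psgn_mul {α : Type*} [Finite α] {S : Set α} {g h : α → α} (hg : Function.Injective g)
    (hh : Function.Injective h) (hS : ∀ x, g x ∈ S ↔ x ∈ S) (hS' : ∀ x, h x ∈ S ↔ x ∈ S) :
    psgn S (g ∘ h) = psgn S g * psgn S h := by
  classical
  letI := Fintype.ofFinite α
  rw [psgn_eq S g (Equiv.ofBijective _ (pw_bij hg hS)) (Equiv.refl _) (fun x => rfl),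
    psgn_eq S h (Equiv.ofBijective _ (pw_bij hh hS')) (Equiv.refl _) (fun x => rfl), ← map_mul]
  refine psgn_eq S _ _ (Equiv.refl _) (fun x => ?_)
  by_cases hx : x ∈ S <;> simp [pw, hx, hS']

theorem psgn_id {α : Type*} [Finite α] {S : Set α} : psgn S (fun x => x) = 1 := by
  classical
  letI := Fintype.ofFinite α
  rw [psgn_eq S _ 1 (Equiv.refl _) (fun x => by simp [pw]), map_one]

theorem psgn_invol {α : Type*} [Finite α] {S : Set α} {g : α → α} (hg : ∀ x, g (g x) = x)
    (hS : ∀ x, g x ∈ S ↔ x ∈ S) (hfix : ∀ x ∈ S, g x ≠ x) : psgn S g = (-1) ^ (S.ncard / 2) := by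
  classical
  letI := Fintype.ofFinite α
  have hi : Function.Injective g := Function.LeftInverse.injective hg
  rw [psgn_eq S g (Equiv.ofBijective _ (pw_bij hi hS)) (Equiv.refl _) (fun x => rfl),
    Equiv.Perm.sign_of_pow_two_eq_one]
  · congr 2
    rw [Set.ncard_eq_toFinset_card']
    have : (Finset.univ : Finset α).card = S.toFinset.card + Fintype.card ↑(Function.fixedPoints ⇑(Equiv.ofBijective (pw S g) (pw_bij hi hS))) := by
      rw [Finset.card_univ, ← Finset.card_add_card_compl S.toFinset, ← Set.toFinset_card]
      congr 2
      ext x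
      rw [Finset.mem_compl, Set.mem_toFinset, Set.mem_toFinset]
      by_cases hx : x ∈ S <;> simp [Function.mem_fixedPoints, Function.IsFixedPt, pw, hx, hfix]
    rw [Finset.card_univ] at this
    omega
  · ext x
    by_cases hx : x ∈ S <;> simp [pow_two, pw, hx, hS, hg]

/-- sign of the action of `g` on the vectors of norm `a` -/
noncomputable def chi (f : BilinForm K V) (a : K) (g : End K V) : ℤˣ :=
  psgn {x | f x x = a} g

def Iso (f : BilinForm K V) (g : End K V) : Prop := ∀ x y, f (g x) (g y) = f x y

theorem Iso.one (f : BilinForm K V) : Iso f 1 := fun _ _ => rfl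
theorem Iso.mul {f : BilinForm K V} {g h : End K V} (hg : Iso f g) (hh : Iso f h) :
    Iso f (g * h) := fun x y => (hg _ _).trans (hh _ _)
theorem Iso.pow {f : BilinForm K V} {g : End K V} (hg : Iso f g) (n : ℕ) :
    Iso f (g ^ n) := by
  induction n with
  | zero => exact Iso.one f
  | succ n ih => rw [pow_succ]; exact ih.mul hg
theorem Iso.neg {f : BilinForm K V} {g : End K V} (hg : Iso f g) :
    Iso f (-g) := fun x y => by simpa using hg x y
theorem Iso.inj {f : BilinForm K V} (hf : f.Nondegenerate) {g : End K V} (hg : Iso f g) :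
    Function.Injective g := by
  rw [← ker_eq_bot, LinearMap.ker_eq_bot']
  intro x hx
  apply hf.1 x
  intro y
  rw [← hg, hx]; simp

section fin
variable [Finite K] [FiniteDimensional K V] {f : BilinForm K V}

theorem chi_mul (hf : f.Nondegenerate) {g h : End K V} (hg : Iso f g) (hh : Iso f h) (a : K) :
    chi f a (g * h) = chi f a g * chi f a h := by
  haveI : Finite V := Module.finite_of_finite K
  exact psgn_mul (hg.inj hf) (hh.inj hf) (fun x => by simp [hg x x]) (fun x => by simp [hh x x])

theorem chi_one (f : BilinForm K V) (a : K) : chi f a 1 = 1 := by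
  haveI : Finite V := Module.finite_of_finite K
  exact psgn_id

theorem chi_pow (hf : f.Nondegenerate) {g : End K V} (hg : Iso f g) (a : K) (n : ℕ) :
    chi f a (g ^ n) = chi f a g ^ n := by
  induction n with
  | zero => simp [chi_one]
  | succ n ih => rw [pow_succ, chi_mul hf (hg.pow n) hg, ih, pow_succ]

/-- number of vectors of norm `a` -/
noncomputable def cnt (f : BilinForm K V) (a : K) : ℕ := {x | f x x = a}.ncard

noncomputable def nu (f : BilinForm K V) (a : K) : ℤˣ := chi f a (-1)

theorem nu_eq (h2 : (2 : K) ≠ 0) (f : BilinForm K V) {a : K} (ha : a ≠ 0) :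
    nu f a = (-1) ^ (cnt f a / 2) := by
  haveI : Finite V := Module.finite_of_finite K
  apply psgn_invol
  · simp
  · simp
  · intro x hx h
    have h3 : (2 : K) • x = 0 := by
      rw [two_smul]; nth_rewrite 1 [← h]; simp
    have : x = 0 := by simpa [h2] using h3
    subst this
    simp at hx
    exact ha hx.symm
end fin

/-- orthogonal decomposition -/
structure Sp (f : BilinForm K V) (W W' : Submodule K V) : Prop where
  compl : IsCompl W W'
  orth : ∀ x ∈ W, ∀ y ∈ W', f x y = 0

namespace Sp
variable {f : BilinForm K V} {W W' : Submodule K V}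
theorem symm (hs : f.IsSymm) (h : Sp f W W') : Sp f W' W :=
  ⟨h.compl.symm, fun x hx y hy => by rw [← hs.eq y x]; simpa using h.orth y hy x hx⟩

theorem exi (h : Sp f W W') (x : V) : ∃ (u : W) (v : W'), x = u + v := by
  have : x ∈ W ⊔ W' := by rw [h.compl.sup_eq_top]; trivial
  obtain ⟨u, hu, v, hv, rfl⟩ := mem_sup.1 this
  exact ⟨⟨u, hu⟩, ⟨v, hv⟩, rfl⟩

theorem nd (hs : f.IsSymm) (hf : f.Nondegenerate) (h : Sp f W W') : (f.restrict W).Nondegenerate := by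
  have hs' : (f.restrict W).IsRefl := fun x y hxy => by
    have := hs.eq (x : V) y
    simp at this hxy ⊢
    rw [← this, hxy]
  refine (LinearMap.IsRefl.nondegenerate_iff_separatingLeft hs').2 ?_
  intro x hx
  have : (x : V) = 0 := by
    apply hf.1
    intro y
    obtain ⟨u, v, rfl⟩ := h.exi y
    have := hx u
    simp at this
    simp [this, h.orth x x.2 v v.2]
  simpa using this
theorem nd' (hs : f.IsSymm) (hf : f.Nondegenerate) (h : Sp f W W') : (f.restrict W').Nondegenerate :=
  (h.symm hs).nd hs hf

theorem finrank [FiniteDimensional K V] (h : Sp f W W') :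
    finrank K V = finrank K W + finrank K W' :=
  (Submodule.finrank_add_eq_of_isCompl h.compl).symm

noncomputable def glue (h : Sp f W W') (g : End K W) (g' : End K W') : End K V :=
  LinearMap.ofIsCompl h.compl (W.subtype ∘ₗ g) (W'.subtype ∘ₗ g')

@[simp] theorem glue_l (h : Sp f W W') (g : End K W) (g' : End K W') (x : W) :
    h.glue g g' x = g x := by simp [glue]
@[simp] theorem glue_r (h : Sp f W W') (g : End K W) (g' : End K W') (x : W') :
    h.glue g g' x = g' x := by simp [glue]
theorem glue_add (h : Sp f W W') (g : End K W) (g' : End K W') (x : W) (y : W') :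
    h.glue g g' (x + y) = g x + g' y := by simp

theorem ext (h : Sp f W W') {A B : End K V} (h1 : ∀ x ∈ W, A x = B x) (h2 : ∀ x ∈ W', A x = B x) :
    A = B := by
  ext x
  obtain ⟨u, v, rfl⟩ := h.exi x
  simp [h1 u u.2, h2 v v.2]

theorem isoext (hs : f.IsSymm) (h : Sp f W W') {A : End K V} (m1 : ∀ x ∈ W, A x ∈ W)
    (m2 : ∀ x ∈ W', A x ∈ W') (h1 : ∀ x ∈ W, ∀ y ∈ W, f (A x) (A y) = f x y)
    (h2 : ∀ x ∈ W', ∀ y ∈ W', f (A x) (A y) = f x y) : Iso f A := by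
  intro x y
  obtain ⟨u, v, rfl⟩ := h.exi x
  obtain ⟨u', v', rfl⟩ := h.exi y
  have a1 := h.orth _ (m1 u u.2) _ (m2 v' v'.2)
  have a2 := (h.symm hs).orth _ (m2 v v.2) _ (m1 u' u'.2)
  have a3 := h.orth _ u.2 _ v'.2
  have a4 := (h.symm hs).orth _ v.2 _ u'.2
  simp [a1, a2, a3, a4, h1 u u.2 u' u'.2, h2 v v.2 v' v'.2]

theorem glue_iso (hs : f.IsSymm) (h : Sp f W W') {g : End K W} {g' : End K W'}
    (hg : Iso (f.restrict W) g) (hg' : Iso (f.restrict W') g') : Iso f (h.glue g g') := by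
  refine h.isoext hs ?_ ?_ ?_ ?_
  · intro x hx; rw [show x = ((⟨x, hx⟩ : W) : V) from rfl, glue_l]; exact (g _).2
  · intro x hx; rw [show x = ((⟨x, hx⟩ : W') : V) from rfl, glue_r]; exact (g' _).2
  · intro x hx y hy
    rw [show x = ((⟨x, hx⟩ : W) : V) from rfl, show y = ((⟨y, hy⟩ : W) : V) from rfl, glue_l, glue_l]
    simpa using hg ⟨x, hx⟩ ⟨y, hy⟩
  · intro x hx y hy
    rw [show x = ((⟨x, hx⟩ : W') : V) from rfl, show y = ((⟨y, hy⟩ : W') : V) from rfl, glue_r, glue_r]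
    simpa using hg' ⟨x, hx⟩ ⟨y, hy⟩
end Sp

theorem Sp.of_nd [FiniteDimensional K V] {f : BilinForm K V} (hs : f.IsSymm) {W : Submodule K V}
    (h : (f.restrict W).Nondegenerate) : Sp f W (f.orthogonal W) := by
  have hr : f.IsRefl := hs.isRefl
  refine ⟨LinearMap.BilinForm.isCompl_orthogonal_of_restrict_nondegenerate hr h, ?_⟩
  intro x hx y hy
  exact hy x hx

theorem Iso.restrict {f : BilinForm K V} {g : End K V} (hg : Iso f g)
    {W : Submodule K V} (hW : ∀ x ∈ W, g x ∈ W) : Iso (f.restrict W) (g.restrict hW) := by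
  intro x y
  simpa using hg x y

theorem chi_glue1 [Finite K] [FiniteDimensional K V] (h2 : (2 : K) ≠ 0) {f : BilinForm K V}
    (hs : f.IsSymm) (hf : f.Nondegenerate)
    {W W' : Submodule K V} (h : Sp f W W') {g : End K W} (hg : Iso (f.restrict W) g) (a : K) :
    chi f a (h.glue g 1) = chi (f.restrict W) a g := by
  classical
  haveI : Finite V := Module.finite_of_finite K
  letI := Fintype.ofFinite W
  letI := Fintype.ofFinite W'
  have hgi := hg.inj (h.nd hs hf)
  let e : V ≃ W' × W := ((W.prodEquivOfIsCompl W' h.compl).symm.toEquiv).trans (Equiv.prodComm _ _)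
  have he : ∀ (w : W) (w' : W'), e (w + w') = (w', w) := by
    intro w w'
    have : (w : V) + w' = W.prodEquivOfIsCompl W' h.compl (w, w') := by simp
    simp only [e, this, Equiv.trans_apply]
    simp
  have hb : ∀ b : K, Function.Bijective (pw {x : W | f.restrict W x x = b} g) := fun b =>
    pw_bij hgi (fun x => by simp only [Set.mem_ofPred_eq]; rw [hg x x])
  have key : ∀ b : K, chi (f.restrict W) b g = Equiv.Perm.sign (Equiv.ofBijective _ (hb b)) := fun b =>
    psgn_eq _ _ _ (Equiv.refl _) (fun x => rfl)
  have hQ : ∀ (w : W) (w' : W'), f ((w : V) + w') (w + w') = f.restrict W w w + f.restrict W' w' w' := by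
    intro w w'
    simp [h.orth w w.2 w' w'.2, (h.symm hs).orth w' w'.2 w w.2]
  have s1 : chi f a (h.glue g 1) = Equiv.Perm.sign (Equiv.prodCongrRight
      (fun y : W' => Equiv.ofBijective _ (hb (a - f.restrict W' y y)))) := by
    apply psgn_eq _ _ _ e
    intro x
    obtain ⟨u, v, rfl⟩ := h.exi x
    rw [he]
    simp only [Equiv.prodCongrRight_apply, Equiv.ofBijective_apply]
    unfold pw
    by_cases hx : f ((u : V) + v) (u + v) = a
    · rw [if_pos (by exact hx), if_pos (by simp only [Set.mem_ofPred_eq]; rw [hQ] at hx; rw [← hx]; ring),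
        h.glue_add]
      exact he (g u) v
    · rw [if_neg (by exact hx), if_neg (by simp only [Set.mem_ofPred_eq]; intro hh; apply hx; rw [hQ, hh]; ring), he]
  rw [s1, Equiv.Perm.sign_prodCongrRight]
  simp only [← key]
  rw [← Finset.mul_prod_erase _ _ (Finset.mem_univ (0 : W'))]
  have : ∏ x ∈ Finset.univ.erase (0 : W'), chi (f.restrict W) (a - f.restrict W' x x) g = 1 := by
    refine Finset.prod_involution (fun x _ => -x) ?_ ?_ ?_ ?_
    · intro x _
      simp [Int.units_mul_self]
    · intro x hx _ h3
      have h3' : (2 : K) • x = 0 := by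
        rw [two_smul]; nth_rewrite 1 [← h3]; simp
      have : x = 0 := by simpa [h2] using h3'
      simp [this] at hx
    · intro x hx; simpa using hx
    · simp
  rw [this]; simp

theorem chi_conj_eq [Finite K] [FiniteDimensional K V] {f : BilinForm K V}
    {V' : Type*} [AddCommGroup V'] [Module K V'] {f' : BilinForm K V'}
    (e : V ≃ₗ[K] V') (he : ∀ x y, f' (e x) (e y) = f x y) (hf : f.Nondegenerate) {g : End K V} (hg : Iso f g)
    {g' : End K V'} (h : ∀ x, e (g x) = g' (e x)) (a : K) : chi f' a g' = chi f a g := by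
  classical
  haveI : Finite V := Module.finite_of_finite K
  letI := Fintype.ofFinite V
  have hb : Function.Bijective (pw {x : V | f x x = a} g) :=
    pw_bij (hg.inj hf) (fun x => by simp only [Set.mem_ofPred_eq]; rw [hg x x])
  rw [chi, chi, psgn_eq _ (⇑g) (Equiv.ofBijective _ hb) (Equiv.refl _) (fun x => rfl)]
  apply psgn_eq _ _ _ e.symm.toEquiv
  intro x
  obtain ⟨x, rfl⟩ := e.surjective x
  have := he x x
  by_cases hx : f x x = a <;> simp [pw, hx, this, ← h]

theorem chi_split [Finite K] [FiniteDimensional K V] (h2 : (2 : K) ≠ 0) {f : BilinForm K V}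
    (hs : f.IsSymm) (hf : f.Nondegenerate)
    {W W' : Submodule K V} (h : Sp f W W') {g : End K V} (hg : Iso f g) (hW : ∀ x ∈ W, g x ∈ W)
    (hW' : ∀ x ∈ W', g x ∈ W') (a : K) :
    chi f a g = chi (f.restrict W) a (g.restrict hW) * chi (f.restrict W') a (g.restrict hW') := by
  have e1 : h.glue (g.restrict hW) 1 * (h.symm hs).glue (g.restrict hW') 1 = g := by
    refine h.ext ?_ ?_
    · intro x hx
      have := (h.symm hs).glue_r (g.restrict hW') 1 ⟨x, hx⟩
      have h3 := h.glue_l (g.restrict hW) 1 ⟨x, hx⟩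
      simp at this h3
      simp [this, h3]
    · intro x hx
      have := (h.symm hs).glue_l (g.restrict hW') 1 ⟨x, hx⟩
      have h3 := h.glue_r (g.restrict hW) 1 ⟨g x, hW' x hx⟩
      simp at this h3
      simp [this, h3]
  have i1 := h.glue_iso hs (hg.restrict hW) (Iso.one _)
  have i2 := (h.symm hs).glue_iso hs (hg.restrict hW') (Iso.one _)
  conv_lhs => rw [← e1]
  rw [chi_mul hf i1 i2, chi_glue1 h2 hs hf h (hg.restrict hW), chi_glue1 h2 hs hf (h.symm hs) (hg.restrict hW')]

theorem chi_glue [Finite K] [FiniteDimensional K V] (h2 : (2 : K) ≠ 0) {f : BilinForm K V}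
    (hs : f.IsSymm) (hf : f.Nondegenerate)
    {W W' : Submodule K V} (h : Sp f W W') {g : End K W} (hg : Iso (f.restrict W) g)
    {g' : End K W'} (hg' : Iso (f.restrict W') g') (a : K) :
    chi f a (h.glue g g') = chi (f.restrict W) a g * chi (f.restrict W') a g' := by
  have m1 : ∀ x ∈ W, h.glue g g' x ∈ W := by
    intro x hx; rw [show x = ((⟨x, hx⟩ : W) : V) from rfl, Sp.glue_l]; exact (g _).2
  have m2 : ∀ x ∈ W', h.glue g g' x ∈ W' := by
    intro x hx; rw [show x = ((⟨x, hx⟩ : W') : V) from rfl, Sp.glue_r]; exact (g' _).2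
  rw [chi_split h2 hs hf h (h.glue_iso hs hg hg') m1 m2]
  congr 2
  · ext x; simp
  · ext x; simp

theorem nu_split [Finite K] [FiniteDimensional K V] (h2 : (2 : K) ≠ 0) {f : BilinForm K V}
    (hs : f.IsSymm) (hf : f.Nondegenerate)
    {W W' : Submodule K V} (h : Sp f W W') (a : K) :
    nu f a = nu (f.restrict W) a * nu (f.restrict W') a := by
  rw [nu, chi_split h2 hs hf h (Iso.one f).neg (fun x hx => by simpa using hx) (fun x hx => by simpa using hx)]
  rfl

end

section
open Classical in
noncomputable def qc (a : K) : ℤˣ := if IsSquare a then 1 else -1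

section qc
variable [Finite K]
theorem two_ne (h4 : ¬ IsSquare (-1 : K)) : (2 : K) ≠ 0 := by
  intro h
  apply h4
  exact ⟨1, by linear_combination -h⟩
theorem isq_mul {a b : K} (ha : ¬ IsSquare a) (hb : ¬ IsSquare b) : IsSquare (a * b) := by
  classical
  let := Fintype.ofFinite K
  have ha0 : a ≠ 0 := fun h => ha (h ▸ IsSquare.zero)
  have hb0 : b ≠ 0 := fun h => hb (h ▸ IsSquare.zero)
  rw [← quadraticChar_one_iff_isSquare (mul_ne_zero ha0 hb0), map_mul,
    quadraticChar_neg_one_iff_not_isSquare.2 ha, quadraticChar_neg_one_iff_not_isSquare.2 hb]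
  rfl
theorem isq_cancel {a b : K} (ha0 : a ≠ 0) (ha : IsSquare a) : IsSquare (a * b) ↔ IsSquare b := by
  constructor
  · intro h
    have : b = (a * b) / a := by field_simp
    rw [this]; exact h.div ha
  · exact ha.mul
theorem qc_mul {a b : K} (ha0 : a ≠ 0) (hb0 : b ≠ 0) : qc (a * b) = qc a * qc b := by
  unfold qc
  by_cases ha : IsSquare a
  · have := isq_cancel (b := b) ha0 ha
    by_cases hb : IsSquare b <;> simp [ha, hb, this]
  · by_cases hb : IsSquare b
    · have := isq_cancel (b := a) hb0 hb
      rw [mul_comm] at this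
      simp [ha, hb, this]
    · simp [ha, hb, isq_mul ha hb]
theorem qc_one : qc (1 : K) = 1 := by simp [qc]
theorem qc_neg_one (h4 : ¬ IsSquare (-1 : K)) : qc (-1 : K) = -1 := by simp [qc, h4]
theorem qc_neg (h4 : ¬ IsSquare (-1 : K)) {a : K} (ha : a ≠ 0) : qc (-a) = - qc a := by
  rw [neg_eq_neg_one_mul, qc_mul (by simp) ha, qc_neg_one h4]; simp
theorem qc_sq {a : K} (ha : a ≠ 0) : qc (a ^ 2) = 1 := by simp [qc, IsSquare.sq]
theorem qc_pow {a : K} (ha : a ≠ 0) (n : ℕ) : qc (a ^ n) = qc a ^ n := by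
  induction n with
  | zero => simp [qc_one]
  | succ n ih => rw [pow_succ, qc_mul (pow_ne_zero _ ha) ha, ih, pow_succ]
theorem qc_eq_one {a : K} : qc a = 1 ↔ IsSquare a := by
  unfold qc; split_ifs with h <;> simp [h]
theorem qc_prod {ι : Type*} (s : Finset ι) (g : ι → K) (hg : ∀ i ∈ s, g i ≠ 0) :
    qc (∏ i ∈ s, g i) = ∏ i ∈ s, qc (g i) := by
  classical
  induction s using Finset.induction_on with
  | empty => simp [qc_one]
  | insert i s hi ih =>
    rw [Finset.prod_insert hi, Finset.prod_insert hi, qc_mul (hg i (by simp)), ih]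
    · intro j hj; exact hg j (by simp [hj])
    · exact Finset.prod_ne_zero_iff.2 (fun j hj => hg j (by simp [hj]))
theorem qc_neg_one_pow (h4 : ¬ IsSquare (-1 : K)) (n : ℕ) : qc ((-1 : K) ^ n) = (-1) ^ n := by
  rw [qc_pow (by simp), qc_neg_one h4]
end qc

/-- reflection -/
noncomputable def rfl' (f : BilinForm K V) (v : V) : End K V :=
  LinearMap.transvection ((-(2 / f v v)) • f v) v

theorem rfl'_apply (f : BilinForm K V) (v x : V) : rfl' f v x = x - (2 * f v x / f v v) • v := by
  simp [rfl', LinearMap.transvection.apply]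
  rw [sub_eq_add_neg]; congr 2; ring_nf

section refl
variable {f : BilinForm K V}
theorem rfl'_iso (hs : f.IsSymm) {v : V} (hv : f v v ≠ 0) : Iso f (rfl' f v) := by
  intro x y
  simp only [rfl'_apply, map_sub, map_smul, LinearMap.sub_apply, LinearMap.smul_apply, smul_eq_mul]
  rw [show f v x = f x v from hs.eq v x]
  field_simp; ring
theorem rfl'_self {v : V} (hv : f v v ≠ 0) : rfl' f v v = - v := by
  rw [rfl'_apply]
  rw [mul_div_assoc, div_self hv, mul_one, two_smul]; abel
theorem rfl'_orth {v x : V} (hv : f v x = 0) : rfl' f v x = x := by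
  rw [rfl'_apply]; simp [hv]
theorem rfl'_sq {v : V} (hv : f v v ≠ 0) : rfl' f v * rfl' f v = 1 := by
  ext x
  simp only [mul_apply]
  conv_lhs => rw [rfl'_apply f v x]
  rw [map_sub, map_smul, rfl'_self hv, rfl'_apply]; simp
theorem rfl'_sub (hs : f.IsSymm) {u v : V} (h : f u u = f v v) (hv : f (u - v) (u - v) ≠ 0) :
    rfl' f (u - v) u = v := by
  rw [rfl'_apply]
  have h1 := hs.eq u v
  have : 2 * f (u - v) u / f (u - v) (u - v) = 1 := by
    rw [div_eq_one_iff_eq hv]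
    simp at h1 ⊢
    rw [h, h1]; ring
  rw [this]; simp
theorem rfl'_add (hs : f.IsSymm) {u v : V} (h : f u u = f v v) (hv : f (u + v) (u + v) ≠ 0) :
    rfl' f (u + v) u = -v := by
  have := rfl'_sub hs (u := u) (v := -v) (by simpa using h) (by simpa using hv)
  simpa using this
theorem rfl'_det [FiniteDimensional K V] {v : V} (hv : f v v ≠ 0) : det (rfl' f v) = -1 := by
  rw [rfl', LinearMap.transvection.det]
  simp; field_simp; ring
theorem addsub (h2 : (2 : K) ≠ 0) (hs : f.IsSymm) {u v : V} (h : f u u = f v v) (hu : f u u ≠ 0) :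
    f (u - v) (u - v) ≠ 0 ∨ f (u + v) (u + v) ≠ 0 := by
  by_contra! hc
  obtain ⟨h1, h3⟩ := hc
  apply hu
  have : 2 * (2 * f u u) = 0 := by
    simp at h1 h3
    linear_combination h1 + h3 + 2 * h
  simpa [h2] using this

theorem chi_refl [Finite K] [FiniteDimensional K V] (h2 : (2 : K) ≠ 0) (hs : f.IsSymm) (hf : f.Nondegenerate)
    {v : V} (hv : f v v ≠ 0) {a : K} (ha : a ≠ 0) : chi f a (rfl' f v) = - qc (a * f v v) := by
  have hv0 : v ≠ 0 := fun h => hv (by simp [h])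
  have hr := LinearMap.BilinForm.isCompl_span_singleton_orthogonal (B := f) (x := v) (by simpa [LinearMap.BilinForm.IsOrtho] using hv)
  have sp : Sp f (K ∙ v) (f.orthogonal (K ∙ v)) := ⟨hr, fun x hx y hy => hy x hx⟩
  have m1 : ∀ x ∈ (K ∙ v), rfl' f v x ∈ (K ∙ v) := by
    intro x hx
    obtain ⟨c, rfl⟩ := mem_span_singleton.1 hx
    rw [map_smul, rfl'_self hv]
    exact Submodule.smul_mem _ _ (Submodule.neg_mem _ (mem_span_singleton_self v))
  have e2 : ∀ x ∈ f.orthogonal (K ∙ v), rfl' f v x = x := fun x hx =>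
    rfl'_orth (hx v (mem_span_singleton_self v))
  have m2 : ∀ x ∈ f.orthogonal (K ∙ v), rfl' f v x ∈ f.orthogonal (K ∙ v) := fun x hx => by rwa [e2 x hx]
  rw [chi_split h2 hs hf sp (rfl'_iso hs hv) m1 m2]
  have r1 : (rfl' f v).restrict m1 = -1 := by
    ext ⟨x, hx⟩
    obtain ⟨c, rfl⟩ := mem_span_singleton.1 hx
    simp [rfl'_self hv]
  have r2 : (rfl' f v).restrict m2 = 1 := by
    ext ⟨x, hx⟩
    simp [e2 x hx]
  rw [r1, r2, chi_one, mul_one]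
  change nu _ _ = _
  rw [nu_eq h2 _ ha]
  have hc : cnt (f.restrict (K ∙ v)) a = {c : K | c * c * f v v = a}.ncard := by
    let e := LinearEquiv.toSpanNonzeroSingleton K V v hv0
    rw [cnt, ← Set.ncard_image_of_injective {c : K | c * c * f v v = a} e.injective]
    congr 1
    ext x
    simp only [Set.mem_ofPred_eq, Set.mem_image]
    constructor
    · intro h
      obtain ⟨c, rfl⟩ := e.surjective x
      refine ⟨c, ?_, rfl⟩
      rw [← h]; simp [e, mul_assoc]
    · rintro ⟨c, h, rfl⟩
      rw [← h]; simp [e, mul_assoc]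
  rw [hc]
  by_cases hq : IsSquare (a * f v v)
  · obtain ⟨b, hb⟩ := hq
    have hb0 : b ≠ 0 := by
      rintro rfl; simp at hb; tauto
    have : {c : K | c * c * f v v = a} = {b / f v v, - (b / f v v)} := by
      ext c
      simp only [Set.mem_ofPred_eq, Set.mem_insert_iff, Set.mem_singleton_iff]
      rw [← mul_self_eq_mul_self_iff]
      constructor
      · intro h
        rw [← h] at hb
        field_simp
        linear_combination hb
      · intro h; rw [h]; field_simp; linear_combination -hb
    rw [this, Set.ncard_pair]
    · simp [qc, hb]
    · intro h
      have h3 : 2 * (b / f v v) = 0 := by linear_combination h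
      simp [h2, hb0, hv] at h3
  · have : {c : K | c * c * f v v = a} = ∅ := by
      ext c
      simp only [Set.mem_ofPred_eq, Set.mem_empty_iff_false, iff_false]
      rintro rfl
      exact hq ⟨c * f v v, by ring⟩
    rw [this]; simp [qc, hq]

theorem orthBasis [FiniteDimensional K V] (h2 : (2 : K) ≠ 0) (hs : f.IsSymm) (hf : f.Nondegenerate) :
    ∃ b : Basis (Fin (finrank K V)) K V, (∀ i j, i ≠ j → f (b i) (b j) = 0) ∧ ∀ i, f (b i) (b i) ≠ 0 := by
  have := invertibleOfNonzero h2
  obtain ⟨b, hb⟩ := LinearMap.BilinForm.exists_orthogonal_basis (B := f) (LinearMap.BilinForm.isSymm_iff.1 hs)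
  refine ⟨b, fun i j hij => hb hij, fun i => ?_⟩
  exact LinearMap.BilinForm.iIsOrtho.not_isOrtho_basis_self_of_nondegenerate hb hf i

theorem CD [FiniteDimensional K V] (h2 : (2 : K) ≠ 0) (hs : f.IsSymm) (hf : f.Nondegenerate)
    (P : End K V → Prop) (h1 : P 1) (hr : ∀ v g, f v v ≠ 0 → Iso f g → P g → P (rfl' f v * g)) :
    ∀ g, Iso f g → P g := by
  obtain ⟨b, hb, hb'⟩ := orthBasis h2 hs hf
  suffices H : ∀ k : ℕ, ∀ g, Iso f g → (∀ i : Fin (finrank K V), i.1 + k < finrank K V → g (b i) = b i) → P g from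
    fun g hg => H (finrank K V) g hg (fun i hi => by omega)
  intro k
  induction k with
  | zero =>
    intro g hg h
    have : g = 1 := b.ext (fun i => by simpa using h i i.2)
    rwa [this]
  | succ k ih =>
    intro g hg h
    by_cases hk : k < finrank K V
    swap
    · exact ih g hg (fun i hi => by omega)
    let j : Fin (finrank K V) := ⟨finrank K V - k - 1, by omega⟩
    have hgj : f (g (b j)) (g (b j)) = f (b j) (b j) := hg _ _
    have orth : ∀ i : Fin (finrank K V), i.1 + (k + 1) < finrank K V → f (g (b j)) (b i) = 0 ∧ f (b j) (b i) = 0 := by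
      intro i hi
      have hij : j ≠ i := by
        intro hji; rw [← hji] at hi; simp [j] at hi; omega
      refine ⟨?_, hb _ _ hij⟩
      rw [← h i hi, hg]; exact hb _ _ hij
    have lt : ∀ i : Fin (finrank K V), i.1 + k < finrank K V → i ≠ j → i.1 + (k + 1) < finrank K V := by
      intro i hi hij
      have : i.1 ≠ finrank K V - k - 1 := fun h => hij (Fin.ext h)
      omega
    rcases addsub h2 hs hgj (by rw [hgj]; exact hb' j) with hu | hu
    · have := ih (rfl' f (g (b j) - b j) * g) ((rfl'_iso hs hu).mul hg) (fun i hi => by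
        by_cases hij : i = j
        · subst hij
          exact rfl'_sub hs hgj hu
        · have := orth i (lt i hi hij)
          simp only [mul_apply]
          rw [h i (lt i hi hij)]
          apply rfl'_orth; simp [this])
      have := hr _ _ hu ((rfl'_iso hs hu).mul hg) this
      rwa [← mul_assoc, rfl'_sq hu, one_mul] at this
    · have := ih (rfl' f (b j) * (rfl' f (g (b j) + b j) * g)) ((rfl'_iso hs (hb' j)).mul ((rfl'_iso hs hu).mul hg)) (fun i hi => by
        by_cases hij : i = j
        · subst hij
          simp only [mul_apply]
          rw [rfl'_add hs hgj hu, map_neg, rfl'_self (hb' _), neg_neg]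
        · have := orth i (lt i hi hij)
          simp only [mul_apply]
          rw [h i (lt i hi hij), rfl'_orth (v := g (b j) + b j) (by simp [this]), rfl'_orth this.2])
      have := hr _ _ (hb' j) ((rfl'_iso hs (hb' j)).mul ((rfl'_iso hs hu).mul hg)) this
      rw [← mul_assoc, rfl'_sq (hb' j), one_mul] at this
      have := hr _ _ hu ((rfl'_iso hs hu).mul hg) this
      rwa [← mul_assoc, rfl'_sq hu, one_mul] at this

theorem chi_det [Finite K] [FiniteDimensional K V] (h4 : ¬ IsSquare (-1 : K)) (hs : f.IsSymm) (hf : f.Nondegenerate)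
    {g : End K V} (hg : Iso f g) :
    (((chi f 1 g * chi f (-1) g : ℤˣ) : ℤ) : K) = det g := by
  have h2 := two_ne h4
  refine CD h2 hs hf (fun g => (((chi f 1 g * chi f (-1) g : ℤˣ) : ℤ) : K) = det g) ?_ ?_ g hg
  · simp [chi_one]
  · intro v g hv hg ih
    rw [chi_mul hf (rfl'_iso hs hv) hg, chi_mul hf (rfl'_iso hs hv) hg, chi_refl h2 hs hf hv one_ne_zero,
      chi_refl h2 hs hf hv (by simp), map_mul, rfl'_det hv, ← ih, one_mul, neg_one_mul, qc_neg h4 hv]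
    have : (qc (f v v)) * qc (f v v) = 1 := Int.units_mul_self _
    have h5 : -qc (f v v) * chi f 1 g * (- -qc (f v v) * chi f (-1) g) = - (chi f 1 g * chi f (-1) g) := by
      calc _ = - ((qc (f v v)) * qc (f v v)) * (chi f 1 g * chi f (-1) g) := by
              rw [neg_neg]; simp only [neg_mul]; congr 1; ac_rfl
        _ = _ := by rw [this]; simp
    rw [h5]; simp

theorem chi_det_eq [Finite K] [FiniteDimensional K V] (h4 : ¬ IsSquare (-1 : K)) (hs : f.IsSymm) (hf : f.Nondegenerate)
    {g : End K V} (hg : Iso f g) {n : ℕ} (hd : det g = (-1) ^ n) :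
    chi f 1 g * chi f (-1) g = (-1) ^ n := by
  have := chi_det h4 hs hf hg
  rw [hd] at this
  have h2 := two_ne h4
  have h3 : ((1 : ℤ) : K) ≠ ((-1 : ℤ) : K) := by
    intro h; apply h2; push_cast at h; linear_combination h
  rcases Int.units_eq_one_or (chi f 1 g * chi f (-1) g) with h | h <;> rcases Nat.even_or_odd n with hn | hn <;>
    rw [h] at this ⊢ <;> simp [hn.neg_one_pow] at this h3 ⊢
  · exact h3 this
  · exact h3 this.symm

theorem nu_dim [Finite K] [FiniteDimensional K V] (h4 : ¬ IsSquare (-1 : K)) (hs : f.IsSymm) (hf : f.Nondegenerate) :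
    nu f 1 * nu f (-1) = (-1) ^ finrank K V := by
  apply chi_det_eq h4 hs hf (Iso.one f).neg
  rw [← neg_one_smul K (1 : End K V), LinearMap.det_smul]; simp

theorem nu_gram [Finite K] [FiniteDimensional K V] (h4 : ¬ IsSquare (-1 : K)) (hs : f.IsSymm) (hf : f.Nondegenerate)
    {a : K} (ha : a ≠ 0) (b : Basis (Fin (finrank K V)) K V) :
    nu f a = qc (-a) ^ finrank K V * qc (Matrix.of fun i j => f (b i) (b j)).det := by
  have h2 := two_ne h4
  obtain ⟨e, he, he'⟩ := orthBasis h2 hs hf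
  have hdet : ∀ b : Basis (Fin (finrank K V)) K V, (Matrix.of fun i j => f (b i) (b j)) = LinearMap.BilinForm.toMatrix b f := by
    intro b; ext i j; simp [LinearMap.BilinForm.toMatrix_apply]
  have d1 : (Matrix.of fun i j => f (e i) (e j)).det = ∏ i, f (e i) (e i) := by
    rw [← Matrix.det_diagonal]
    congr 1
    ext i j
    by_cases hij : i = j
    · subst hij; simp
    · simp [hij, he i j hij]
  have d2 : (Matrix.of fun i j => f (b i) (b j)).det = (e.toMatrix b).det ^ 2 * ∏ i, f (e i) (e i) := by
    rw [← d1, hdet, hdet, ← LinearMap.BilinForm.toMatrix_mul_basis_toMatrix e b f]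
    rw [Matrix.det_mul, Matrix.det_mul, Matrix.det_transpose]; ring
  have d3 : (e.toMatrix b).det ≠ 0 := by
    have := e.toMatrix_mul_toMatrix_flip b
    intro h0
    have h5 := congrArg Matrix.det this
    rw [Matrix.det_mul, h0] at h5
    simp at h5
  have hp : (∏ i, f (e i) (e i)) ≠ 0 := Finset.prod_ne_zero_iff.2 (fun i _ => he' i)
  rw [d2, qc_mul (pow_ne_zero _ d3) hp, qc_sq d3, one_mul, qc_prod _ _ (fun i _ => he' i)]
  suffices H : ∀ (k : ℕ), k ≤ finrank K V → ∃ g, Iso f g ∧ (∀ i : Fin (finrank K V), g (e i) = if i.1 < k then - e i else e i) ∧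
      chi f a g = ∏ i : Fin (finrank K V), (if i.1 < k then qc (-a) * qc (f (e i) (e i)) else 1) by
    obtain ⟨g, -, h, h'⟩ := H _ le_rfl
    have : g = -1 := e.ext (fun i => by simp [h])
    rw [nu, ← this, h']
    simp [Finset.prod_mul_distrib]
  intro k
  induction k with
  | zero => exact fun _ => ⟨1, Iso.one f, by simp, by simp [chi_one]⟩
  | succ k ih =>
    intro hk
    obtain ⟨g, h0, h1, h3⟩ := ih (by omega)
    let j : Fin (finrank K V) := ⟨k, by omega⟩
    refine ⟨rfl' f (e j) * g, (rfl'_iso hs (he' j)).mul h0, fun i => ?_, ?_⟩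
    · simp only [mul_apply]
      rw [h1]
      by_cases hij : i = j
      · subst hij; simp [j, rfl'_self (he' _)]
      · have : i.1 ≠ k := fun h => hij (Fin.ext h)
        have h6 := rfl'_orth (he j i (Ne.symm hij))
        by_cases hik : i.1 < k
        · rw [if_pos hik, if_pos (by omega), map_neg, h6]
        · rw [if_neg hik, if_neg (by omega), h6]
    · rw [chi_mul hf (rfl'_iso hs (he' j)) h0, h3, chi_refl h2 hs hf (he' j) ha]
      rw [Fintype.prod_eq_mul_prod_compl j, Fintype.prod_eq_mul_prod_compl j]
      have : ∏ i ∈ ({j} : Finset (Fin (finrank K V)))ᶜ, (if i.1 < k + 1 then qc (-a) * qc (f (e i) (e i)) else 1) =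
        ∏ i ∈ ({j} : Finset (Fin (finrank K V)))ᶜ, (if i.1 < k then qc (-a) * qc (f (e i) (e i)) else 1) := by
        apply Finset.prod_congr rfl
        intro i hi
        have : i.1 ≠ k := fun h => by simp at hi; exact hi (Fin.ext h)
        congr 1
        simp; omega
      rw [this]
      simp only [j, lt_irrefl, if_false, one_mul, lt_add_iff_pos_right, zero_lt_one, if_true]
      rw [← qc_mul (neg_ne_zero.2 ha) (he' _), neg_mul a, qc_neg h4 (mul_ne_zero ha (he' _))]

theorem hasDisc_iff [Finite K] [FiniteDimensional K V] (h4 : ¬ IsSquare (-1 : K)) (hs : f.IsSymm) (hf : f.Nondegenerate) :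
    HasDisc f 1 ↔ nu f (-1) = 1 := by
  have key := nu_gram h4 hs hf (a := -1) (by simp)
  simp only [neg_neg, qc_one, one_pow, one_mul] at key
  constructor
  · rintro ⟨b, c, h⟩
    rw [key b, h, one_mul, qc_sq c.ne_zero]
  · intro h
    let b := finBasis K V
    have hh := key b
    rw [h, eq_comm, qc_eq_one] at hh
    obtain ⟨c, hc⟩ := hh
    have hc0 : c ≠ 0 := by
      rintro rfl
      have hn := (LinearMap.BilinForm.nondegenerate_iff_det_ne_zero b).1 hf
      apply hn
      rw [mul_zero] at hc
      rw [← hc]; congr 1; ext i j; simp [LinearMap.BilinForm.toMatrix_apply]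
    exact ⟨b, Units.mk0 c hc0, by rw [hc]; simp [pow_two]⟩
end refl

end

section
section om
variable [Finite K] [FiniteDimensional K V] {f : BilinForm K V}

noncomputable def Iso.equiv (hf : f.Nondegenerate) {g : End K V} (hg : Iso f g) : V ≃ₗ[K] V :=
  LinearEquiv.ofInjectiveEndo g (hg.inj hf)

theorem Iso.equiv_coe (hf : f.Nondegenerate) {g : End K V} (hg : Iso f g) :
    ((hg.equiv hf : V ≃ₗ[K] V) : V →ₗ[K] V) = g := by
  ext x; simp [Iso.equiv]

theorem Iso.equiv_mem (hf : f.Nondegenerate) {g : End K V} (hg : Iso f g) :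
    hg.equiv hf ∈ orthGroup f := by
  intro x y
  simpa [Iso.equiv] using hg x y

noncomputable def chiHom (hf : f.Nondegenerate) (a : K) : orthGroup f →* ℤˣ where
  toFun g := chi f a ((g : V ≃ₗ[K] V) : V →ₗ[K] V)
  map_one' := chi_one f a
  map_mul' g h := chi_mul hf g.2 h.2 a

theorem omega_iff (h4 : ¬ IsSquare (-1 : K)) (hs : f.IsSymm) (hf : f.Nondegenerate) (φ : V ≃ₗ[K] V) :
    φ ∈ omegaGroup f ↔ Iso f (φ : V →ₗ[K] V) ∧ chi f 1 (φ : V →ₗ[K] V) = 1 ∧ chi f (-1) (φ : V →ₗ[K] V) = 1 := by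
  have h2 := two_ne h4
  have hO : ∀ x : V ≃ₗ[K] V, x ∈ omegaGroup f ↔ ∃ hx : x ∈ orthGroup f, (⟨x, hx⟩ : orthGroup f) ∈ commutator (orthGroup f) := by
    intro x
    rw [omegaGroup, ← Subgroup.map_subtype_commutator, Subgroup.mem_map]
    constructor
    · rintro ⟨y, hy, rfl⟩
      exact ⟨y.2, hy⟩
    · rintro ⟨hx, h⟩
      exact ⟨_, h, rfl⟩
  rw [hO]
  constructor
  · rintro ⟨hx, h⟩
    refine ⟨hx, ?_, ?_⟩
    · exact (Abelianization.commutator_subset_ker (chiHom hf 1)) h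
    · exact (Abelianization.commutator_subset_ker (chiHom hf (-1))) h
  · rintro ⟨hi, c1, c2⟩
    refine ⟨hi, ?_⟩
    let π : orthGroup f →* Abelianization (orthGroup f) := Abelianization.of
    let R : ∀ v : V, f v v ≠ 0 → orthGroup f := fun v hv => ⟨(rfl'_iso hs hv).equiv hf, (rfl'_iso hs hv).equiv_mem hf⟩
    have hR : ∀ v hv, (((R v hv : orthGroup f) : V ≃ₗ[K] V) : V →ₗ[K] V) = rfl' f v := fun v hv => Iso.equiv_coe hf (rfl'_iso hs hv)
    have hRx : ∀ v hv x, ((R v hv : orthGroup f) : V ≃ₗ[K] V) x = rfl' f v x := fun v hv x => by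
      rw [← hR v hv]; rfl
    have hR2 : ∀ v hv, π (R v hv) * π (R v hv) = 1 := by
      intro v hv
      rw [← map_mul]
      have : R v hv * R v hv = 1 := by
        apply Subtype.ext
        apply LinearEquiv.toLinearMap_injective
        change (((R v hv : orthGroup f) : V ≃ₗ[K] V) : V →ₗ[K] V) * (((R v hv : orthGroup f) : V ≃ₗ[K] V) : V →ₗ[K] V) = 1
        rw [hR v hv, rfl'_sq hv]
      rw [this, map_one]
    have conj : ∀ u v hu hv, ∀ g : orthGroup f, ∀ c : K, c ≠ 0 → (g : V ≃ₗ[K] V) u = c • v → π (R u hu) = π (R v hv) := by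
      intro u v hu hv g c hc hg
      have : g * R u hu = R v hv * g := by
        apply Subtype.ext
        ext x
        change (g : V ≃ₗ[K] V) ((R u hu : V ≃ₗ[K] V) x) = (R v hv : V ≃ₗ[K] V) ((g : V ≃ₗ[K] V) x)
        rw [hRx u hu, hRx v hv, rfl'_apply, rfl'_apply, map_sub, map_smul, hg]
        have e1 : f u u = c * c * f v v := by
          rw [← g.2 u u, hg]; simp; ring
        have e2 : f u x = c * f v ((g : V ≃ₗ[K] V) x) := by
          rw [← g.2 u x, hg]; simp
        rw [e1, e2, smul_smul]
        congr 2; field_simp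
      have := congrArg π this
      rw [map_mul, map_mul, mul_comm] at this
      exact mul_right_cancel this
    have key : ∀ u v hu hv, IsSquare (f u u * f v v) → π (R u hu) = π (R v hv) := by
      intro u v hu hv ⟨c, hc⟩
      have hc0 : c ≠ 0 := by
        rintro rfl; simp [hu, hv] at hc
      have hv' : f ((c / f v v) • v) ((c / f v v) • v) = f u u := by
        simp; field_simp; linear_combination -hc
      have hcv : c / f v v ≠ 0 := div_ne_zero hc0 hv
      rcases addsub h2 hs hv'.symm hu with h | h
      · exact conj u v hu hv (R _ h) _ hcv (by rw [hRx _ h, rfl'_sub hs hv'.symm h])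
      · exact conj u v hu hv (R _ h) _ (neg_ne_zero.2 hcv) (by rw [hRx _ h, rfl'_add hs hv'.symm h, neg_smul])
    obtain ⟨A, hA, hA2⟩ : ∃ A : Abelianization (orthGroup f), (∀ v hv, IsSquare (f v v) → π (R v hv) = A) ∧ A * A = 1 := by
      by_cases h : ∃ v, ∃ hv : f v v ≠ 0, IsSquare (f v v)
      · obtain ⟨v, hv, hq⟩ := h
        exact ⟨π (R v hv), fun u hu hq' => key u v hu hv (hq'.mul hq), hR2 v hv⟩
      · push Not at h
        exact ⟨1, fun v hv hq => absurd hq (h v hv), by simp⟩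
    obtain ⟨B, hB, hB2⟩ : ∃ A : Abelianization (orthGroup f), (∀ v hv, ¬ IsSquare (f v v) → π (R v hv) = A) ∧ A * A = 1 := by
      by_cases h : ∃ v, ∃ hv : f v v ≠ 0, ¬ IsSquare (f v v)
      · obtain ⟨v, hv, hq⟩ := h
        exact ⟨π (R v hv), fun u hu hq' => key u v hu hv (isq_mul hq' hq), hR2 v hv⟩
      · push Not at h
        exact ⟨1, fun v hv hq => absurd (h v hv) hq, by simp⟩
    have main := CD h2 hs hf (fun g => ∀ hg : Iso f g, π ⟨hg.equiv hf, hg.equiv_mem hf⟩ =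
        (if chi f 1 g = 1 then 1 else A) * (if chi f (-1) g = 1 then 1 else B)) ?_ ?_ _ hi hi
    · have e : (⟨hi.equiv hf, hi.equiv_mem hf⟩ : orthGroup f) = ⟨φ, hi⟩ := by
        apply Subtype.ext
        apply LinearEquiv.toLinearMap_injective
        exact Iso.equiv_coe hf hi
      rw [e, c1, c2] at main
      simp at main
      exact (QuotientGroup.eq_one_iff _).1 main
    · intro hg
      have : (⟨hg.equiv hf, hg.equiv_mem hf⟩ : orthGroup f) = 1 := by
        apply Subtype.ext
        apply LinearEquiv.toLinearMap_injective
        exact Iso.equiv_coe hf hg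
      rw [this]; simp [chi_one]
    · intro v g hv hg ih hrg
      have : (⟨hrg.equiv hf, hrg.equiv_mem hf⟩ : orthGroup f) = R v hv * ⟨hg.equiv hf, hg.equiv_mem hf⟩ := by
        apply Subtype.ext
        apply LinearEquiv.toLinearMap_injective
        refine (Iso.equiv_coe hf hrg).trans ?_
        change _ = (((R v hv : orthGroup f) : V ≃ₗ[K] V) : V →ₗ[K] V) * (hg.equiv hf : V →ₗ[K] V)
        rw [hR v hv, Iso.equiv_coe hf hg]
      rw [this, map_mul, ih hg, chi_mul hf (rfl'_iso hs hv) hg, chi_mul hf (rfl'_iso hs hv) hg,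
        chi_refl h2 hs hf hv one_ne_zero, chi_refl h2 hs hf hv (by simp), one_mul, neg_one_mul, qc_neg h4 hv, neg_neg]
      by_cases hq : IsSquare (f v v)
      · rw [hA v hv hq, show qc (f v v) = 1 from qc_eq_one.2 hq]
        rcases Int.units_eq_one_or (chi f 1 g) with h | h <;> simp [h, ← mul_assoc, hA2]
      · rw [hB v hv hq, show qc (f v v) = -1 by simp [qc, hq]]
        rcases Int.units_eq_one_or (chi f (-1) g) with h | h <;> simp [h, mul_comm]
        split_ifs <;> [exact hB2; rw [mul_left_comm, hB2, mul_one]]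
end om

end

section
section lag
variable {n : ℕ}
/-- hyperbolic model -/
def hyp (K : Type*) [Field K] (n : ℕ) : BilinForm K ((Fin n → K) × (Fin n → K)) :=
  LinearMap.mk₂ K (fun x y => x.2 ⬝ᵥ y.1 + y.2 ⬝ᵥ x.1)
    (by intros; simp [add_dotProduct, dotProduct_add]; ring)
    (by intros; simp [smul_dotProduct, dotProduct_smul]; ring)
    (by intros; simp [add_dotProduct, dotProduct_add]; ring)
    (by intros; simp [smul_dotProduct, dotProduct_smul]; ring)

theorem hyp_apply (x y) : hyp K n x y = x.2 ⬝ᵥ y.1 + y.2 ⬝ᵥ x.1 := rfl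

theorem hyp_symm : (hyp K n).IsSymm := ⟨fun x y => by simp [hyp_apply, add_comm]⟩

theorem hyp_nd : (hyp K n).Nondegenerate := by
  have hr : (hyp K n).IsRefl := hyp_symm.isRefl
  refine (LinearMap.IsRefl.nondegenerate_iff_separatingLeft hr).2 ?_
  intro x hx
  have h1 : ∀ i, x.1 i = 0 := fun i => by simpa [hyp_apply] using hx (0, Pi.single i 1)
  have h2 : ∀ i, x.2 i = 0 := fun i => by simpa [hyp_apply] using hx (Pi.single i 1, 0)
  exact Prod.ext (funext h1) (funext h2)

noncomputable def HH (A : Matrix (Fin n) (Fin n) K) : End K ((Fin n → K) × (Fin n → K)) :=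
  LinearMap.prodMap A.mulVecLin (A⁻¹).transpose.mulVecLin

theorem HH_mul {A B : Matrix (Fin n) (Fin n) K} : HH (A * B) = HH A * HH B := by
  apply LinearMap.ext; intro x
  simp [HH, Matrix.mul_inv_rev]

theorem HH_iso {A : Matrix (Fin n) (Fin n) K} (hA : A.det ≠ 0) : Iso (hyp K n) (HH A) := by
  intro x y
  have key : ∀ u v : Fin n → K, ((A⁻¹).transpose.mulVec u) ⬝ᵥ (A.mulVec v) = u ⬝ᵥ v := by
    intro u v
    rw [Matrix.mulVec_transpose, ← Matrix.dotProduct_mulVec, Matrix.mulVec_mulVec,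
      Matrix.nonsing_inv_mul _ (isUnit_iff_ne_zero.2 hA), Matrix.one_mulVec]
  simp only [hyp_apply, HH, LinearMap.prodMap_apply, Matrix.mulVecLin_apply, key]

theorem HH_diag_single [Finite K] (h4 : ¬ IsSquare (-1 : K)) (i : Fin n) (c : Kˣ) {a : K} (ha : a ≠ 0) :
    chi (hyp K n) a (HH (Matrix.diagonal fun j => ((Pi.mulSingle i c : Fin n → Kˣ) j : K))) = qc (c : K) := by
  have h2 := two_ne h4
  set v1 : (Fin n → K) × (Fin n → K) := (Pi.single i 1, -Pi.single i 1)
  set v2 : (Fin n → K) × (Fin n → K) := (Pi.single i 1, -Pi.single i (c : K))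
  have e1 : hyp K n v1 v1 = -2 := by simp [hyp_apply, v1]; ring
  have e2 : hyp K n v2 v2 = -2 * c := by simp [hyp_apply, v2]; ring
  have hv1 : hyp K n v1 v1 ≠ 0 := by rw [e1]; simpa using h2
  have hv2 : hyp K n v2 v2 ≠ 0 := by rw [e2]; simpa using h2
  have : HH (Matrix.diagonal fun j => ((Pi.mulSingle i c : Fin n → Kˣ) j : K)) = rfl' (hyp K n) v1 * rfl' (hyp K n) v2 := by
    apply LinearMap.ext; rintro ⟨x, ξ⟩
    have hinv : (Matrix.diagonal fun j => ((Pi.mulSingle i c : Fin n → Kˣ) j : K))⁻¹ =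
      Matrix.diagonal fun j => (((Pi.mulSingle i c : Fin n → Kˣ) j)⁻¹ : K) := by
      apply Matrix.inv_eq_right_inv
      rw [Matrix.diagonal_mul_diagonal]
      simp
    have hc : (c : K) ≠ 0 := c.ne_zero
    rw [mul_apply, rfl'_apply, rfl'_apply, e1, e2]
    simp only [HH, LinearMap.prodMap_apply, hinv]
    refine Prod.ext ?_ ?_ <;> funext j <;> by_cases hj : j = i
    · subst hj; simp [hyp_apply, v1, v2, Matrix.mulVec_diagonal]; field_simp; ring
    · simp [hyp_apply, v1, v2, Matrix.mulVec_diagonal, hj]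
    · subst hj; simp [hyp_apply, v1, v2, Matrix.mulVec_diagonal]; field_simp; ring
    · simp [hyp_apply, v1, v2, Matrix.mulVec_diagonal, hj]
  have hc : (c : K) ≠ 0 := c.ne_zero
  rw [this, chi_mul hyp_nd (rfl'_iso hyp_symm hv1) (rfl'_iso hyp_symm hv2), chi_refl h2 hyp_symm hyp_nd hv1 ha,
    chi_refl h2 hyp_symm hyp_nd hv2 ha, e1, e2, neg_mul_neg, ← mul_assoc, qc_mul (a := a * -2) (b := (c : K)) (mul_ne_zero ha (neg_ne_zero.2 h2)) hc, ← mul_assoc, Int.units_mul_self, one_mul]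

theorem HH_chi [Finite K] (h4 : ¬ IsSquare (-1 : K)) (A : Matrix (Fin n) (Fin n) K) (hA : A.det ≠ 0) {a : K} (ha : a ≠ 0) :
    chi (hyp K n) a (HH A) = qc A.det := by
  have h2 := two_ne h4
  refine Matrix.diagonal_transvection_induction_of_det_ne_zero
    (fun A => chi (hyp K n) a (HH A) = qc A.det) A hA ?_ ?_ ?_
  · intro D hD
    have hd : ∀ i, D i ≠ 0 := by simpa [Finset.prod_ne_zero_iff] using hD
    have hu : ∀ d : Fin n → Kˣ, (Matrix.diagonal fun j => (d j : K)).det ≠ 0 := fun d => by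
      simp [Finset.prod_ne_zero_iff]
    let χ1 : (Fin n → Kˣ) →* ℤˣ :=
      { toFun := fun d => chi (hyp K n) a (HH (Matrix.diagonal fun j => (d j : K)))
        map_one' := by
          have : HH (Matrix.diagonal fun j => (((1 : Fin n → Kˣ) j : Kˣ) : K)) = 1 := by
            apply LinearMap.ext; intro x
            simp [HH]
          rw [this, chi_one]
        map_mul' := fun d d' => by
          rw [← chi_mul hyp_nd (HH_iso (hu d)) (HH_iso (hu d')), ← HH_mul, Matrix.diagonal_mul_diagonal]
          rfl }
    let χ2 : (Fin n → Kˣ) →* ℤˣ :=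
      { toFun := fun d => ∏ j, qc (d j : K)
        map_one' := by simp [qc_one]
        map_mul' := fun d d' => by
          rw [← Finset.prod_mul_distrib]
          exact Finset.prod_congr rfl fun j _ => by simp [qc_mul] }
    have : χ1 = χ2 := by
      apply MonoidHom.functions_ext
      intro i c
      refine (HH_diag_single h4 i c ha).trans ?_
      change _ = ∏ j, qc ((Pi.mulSingle i c : Fin n → Kˣ) j : K)
      rw [Finset.prod_eq_single i]
      · simp
      · intro j _ hj; simp [hj, qc_one]
      · simp
    have := DFunLike.congr_fun this (fun j => Units.mk0 (D j) (hd j))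
    simpa [χ1, χ2, qc_prod _ _ (fun i _ => hd i)] using this
  · intro t
    have : t.toMatrix = (Matrix.TransvectionStruct.mk t.i t.j t.hij (t.c / 2)).toMatrix *
      (Matrix.TransvectionStruct.mk t.i t.j t.hij (t.c / 2)).toMatrix := by
      simp only [Matrix.TransvectionStruct.toMatrix]
      rw [Matrix.transvection_mul_transvection_same _ _ t.hij]
      congr 1; field_simp <;> ring
    have hi := HH_iso (A := (Matrix.TransvectionStruct.mk t.i t.j t.hij (t.c / 2)).toMatrix) (by rw [Matrix.TransvectionStruct.det]; simp)
    rw [Matrix.TransvectionStruct.det, qc_one, this, HH_mul, chi_mul hyp_nd hi hi, Int.units_mul_self]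
  · intro A B hA hB h1 h3
    rw [HH_mul, chi_mul hyp_nd (HH_iso hA) (HH_iso hB), h1, h3, Matrix.det_mul, qc_mul hA hB]

theorem odd_pow_one {s : ℤˣ} {n : ℕ} (hn : Odd n) (h : s ^ n = 1) : s = 1 := by
  rcases Int.units_eq_one_or s with h' | h'
  · exact h'
  · rw [h', hn.neg_one_pow] at h; exact absurd h (by decide)

theorem card_odd [Finite K] (h2 : (2 : K) ≠ 0) : ((Nat.card K : ℕ) : K) = 0 ∧ Odd (Nat.card K) := by
  classical
  letI := Fintype.ofFinite K
  rw [Nat.card_eq_fintype_card]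
  have h0 : ((Fintype.card K : ℕ) : K) = 0 := by simp
  refine ⟨h0, ?_⟩
  rw [← Nat.not_even_iff_odd]
  intro h
  have h5 : ringChar K ≠ 2 := by
    intro h6
    have := ringChar.Nat.cast_ringChar (R := K)
    rw [h6] at this; exact h2 (by exact_mod_cast this)
  exact absurd (FiniteField.odd_card_of_char_ne_two h5) (by simpa [Nat.even_iff] using h)

theorem chi_unip [Finite K] [FiniteDimensional K V] (h2 : (2 : K) ≠ 0) {f : BilinForm K V} (hf : f.Nondegenerate)
    {u : End K V} (hu : Iso f u) (h : (u - 1) * (u - 1) = 0) (a : K) : chi f a u = 1 := by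
  have h1 : ∀ m : ℕ, u ^ m = 1 + m • (u - 1) := by
    intro m
    induction m with
    | zero => simp
    | succ m ih =>
      have : u = 1 + (u - 1) := by abel
      rw [pow_succ, ih]
      nth_rw 2 [this]
      rw [mul_add, add_mul, add_mul, smul_mul_assoc m (u-1) (u-1), h]
      simp only [smul_mul_assoc, succ_nsmul, mul_one, one_mul, smul_zero, add_zero]
      abel
  obtain ⟨h3, h5⟩ := card_odd h2
  apply odd_pow_one h5
  rw [← chi_pow hf hu, h1, ← Nat.cast_smul_eq_nsmul K, h3, zero_smul, add_zero, chi_one]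

theorem chi_lag [Finite K] [FiniteDimensional K V] (h4 : ¬ IsSquare (-1 : K)) {f : BilinForm K V}
    (hs : f.IsSymm) (hf : f.Nondegenerate) {E : Type*} [AddCommGroup E] [Module K E] [FiniteDimensional K E]
    (ι : E →ₗ[K] V) (hi : Function.Injective ι) (h0 : ∀ x y, f (ι x) (ι y) = 0)
    (hd : finrank K V = 2 * finrank K E) {g : End K V} (hg : Iso f g) {k : End K E}
    (hk : ∀ x, g (ι x) = ι (k x)) {a : K} (ha : a ≠ 0) : chi f a g = qc (det k) := by
  have h2 := two_ne h4
  set b := finBasis K E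
  set n := finrank K E
  have hsurj : Function.Surjective ((LinearMap.lcomp K K ι) ∘ₗ f) := by
    intro ξ
    obtain ⟨η, hη⟩ := LinearMap.dualMap_surjective_of_injective hi ξ
    refine ⟨(f.toDual hf).symm η, ?_⟩
    ext x
    simp [LinearMap.BilinForm.apply_toDual_symm_apply, ← hη]
  obtain ⟨w, hw⟩ := LinearMap.exists_rightInverse_of_surjective _ (LinearMap.range_eq_top.2 hsurj)
  have hw' : ∀ ξ x, f (w ξ) (ι x) = ξ x := fun ξ x => by
    have := LinearMap.congr_fun (LinearMap.congr_fun hw ξ) x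
    simpa using this
  let w0 : Fin n → V := fun j => w (b.coord j)
  have hw0 : ∀ j x, f (w0 j) (ι x) = b.repr x j := fun j x => by simp [w0, hw']
  let w1 : Fin n → V := fun j => w0 j - ∑ l, (f (w0 j) (w0 l) / 2) • ι (b l)
  have hw1 : ∀ j x, f (w1 j) (ι x) = b.repr x j := fun j x => by
    simp [w1, hw0, h0]
  have hw11 : ∀ i j, f (w1 i) (w1 j) = 0 := fun i j => by
    have e : f (w1 i) (w1 j) = f (w1 i) (w0 j) - ∑ l, (f (w0 j) (w0 l) / 2) * f (w1 i) (ι (b l)) := by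
      conv_lhs => rw [show w1 j = w0 j - ∑ l, (f (w0 j) (w0 l) / 2) • ι (b l) from rfl]
      simp
    have e2 : f (w1 i) (w0 j) = f (w0 i) (w0 j) - ∑ l, (f (w0 i) (w0 l) / 2) * f (ι (b l)) (w0 j) := by
      conv_lhs => rw [show w1 i = w0 i - ∑ l, (f (w0 i) (w0 l) / 2) • ι (b l) from rfl]
      simp
    have e3 : ∀ l, f (ι (b l)) (w0 j) = b.repr (b l) j := fun l => by rw [← hw0]; exact hs.eq _ _
    rw [e, e2]
    simp only [e3, hw1, Basis.repr_self, Finsupp.single_apply, mul_ite, mul_one, mul_zero, Finset.sum_ite_eq',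
      Finset.sum_ite_eq, Finset.mem_univ, if_true]
    have := hs.eq (w0 i) (w0 j)
    rw [this]; field_simp; ring
  let e0 : (Fin n → K) × (Fin n → K) →ₗ[K] V :=
    LinearMap.coprod (ι ∘ₗ b.equivFun.symm.toLinearMap) (Fintype.linearCombination K w1)
  have he0 : ∀ x y, f (e0 x) (e0 y) = hyp K n x y := by
    rintro ⟨x, ξ⟩ ⟨y, η⟩
    have a1 : ∀ ξ y, f (Fintype.linearCombination K w1 ξ) (ι (b.equivFun.symm y)) = ξ ⬝ᵥ y := fun ξ y => by
      rw [Fintype.linearCombination_apply]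
      simp only [map_sum, LinearMap.sum_apply, map_smul, LinearMap.smul_apply, hw1, smul_eq_mul, dotProduct]
      refine Finset.sum_congr rfl fun i _ => ?_
      congr 1
      exact congrFun (b.equivFun.apply_symm_apply y) i
    have a2 : ∀ ξ y, f (ι (b.equivFun.symm y)) (Fintype.linearCombination K w1 ξ)  = ξ ⬝ᵥ y := fun ξ y => by
      rw [← a1]; exact hs.eq _ _
    have a3 : f (Fintype.linearCombination K w1 ξ) (Fintype.linearCombination K w1 η) = 0 := by
      simp [Fintype.linearCombination_apply, hw11]
    simp only [e0, LinearMap.coprod_apply, LinearMap.comp_apply, LinearEquiv.coe_coe, map_add, LinearMap.add_apply, hyp_apply, h0, a1, a2, a3]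
    ring
  have hinj : Function.Injective e0 := by
    rw [← ker_eq_bot, LinearMap.ker_eq_bot']
    intro x hx
    apply hyp_nd.1 x
    intro y
    rw [← he0, hx]; simp
  let e : ((Fin n → K) × (Fin n → K)) ≃ₗ[K] V := LinearEquiv.ofInjectiveOfFinrankEq e0 hinj (by simp [hd]; ring)
  have he : ∀ x, e x = e0 x := fun x => rfl
  let g0 : End K ((Fin n → K) × (Fin n → K)) := e.symm.toLinearMap ∘ₗ g ∘ₗ e.toLinearMap
  have hg0e : ∀ x, e (g0 x) = g (e x) := fun x => by simp [g0]
  have hg0 : Iso (hyp K n) g0 := fun x y => by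
    rw [← he0, ← he0, ← he, ← he, ← he, ← he, hg0e, hg0e, hg, ]
  rw [chi_conj_eq e (fun x y => by rw [he, he, he0]) hyp_nd hg0 hg0e a]
  set A := LinearMap.toMatrix b b k
  have hA : A.det = det k := LinearMap.det_toMatrix b k
  have hkinj : Function.Injective k := by
    intro x y hxy
    apply hi; apply hg.inj hf
    rw [hk, hk, hxy]
  have hA0 : A.det ≠ 0 := by
    rw [hA]
    have := (LinearMap.isUnit_iff_ker_eq_bot k).2 (ker_eq_bot.2 hkinj)
    exact ((LinearMap.isUnit_iff_isUnit_det k).1 this).ne_zero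
  have hgA : ∀ x, g0 (x, 0) = (A.mulVec x, 0) := fun x => by
    apply e.injective
    rw [hg0e, he, he]
    simp only [e0, LinearMap.coprod_apply, LinearMap.comp_apply, LinearEquiv.coe_coe, map_zero, add_zero, hk]
    congr 1
    apply b.equivFun.injective
    rw [LinearEquiv.apply_symm_apply]
    have := LinearMap.toMatrix_mulVec_repr b b k (b.equivFun.symm x)
    have h7 : ((b.repr (b.equivFun.symm x)) : Fin n → K) = x := b.equivFun.apply_symm_apply x
    rw [h7] at this
    rw [this]; rfl
  have hAi : (A⁻¹).det ≠ 0 := by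
    rw [Matrix.det_nonsing_inv, Ring.inverse_eq_inv']; exact inv_ne_zero hA0
  set u := g0 * HH A⁻¹
  have hu : Iso (hyp K n) u := hg0.mul (HH_iso hAi)
  have hu1 : ∀ x, u (x, 0) = (x, 0) := fun x => by
    simp [u, HH, hgA, Matrix.mulVec_mulVec, Matrix.mul_nonsing_inv _ (isUnit_iff_ne_zero.2 hA0)]
  have hu2 : ∀ x, (u x).2 = x.2 := fun x => by
    funext i
    have := hu x (Pi.single i 1, 0)
    rw [hu1] at this
    simpa [hyp_apply] using this
  have hgu : g0 = u * HH A := by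
    simp only [u]
    rw [mul_assoc, ← HH_mul, Matrix.nonsing_inv_mul _ (isUnit_iff_ne_zero.2 hA0)]
    apply LinearMap.ext; intro x; simp [HH]
  have hsq : (u - 1) * (u - 1) = 0 := by
    apply LinearMap.ext; intro x
    have : (u - 1) x = (((u - 1) x).1, 0) := Prod.ext rfl (by simp [hu2])
    rw [mul_apply, this]
    simp [hu1]
  rw [hgu, chi_mul hyp_nd hu (HH_iso hA0), HH_chi h4 A hA0 ha, chi_unip h2 hyp_nd hu hsq, one_mul, hA]
end lag

end

section
section det
variable [FiniteDimensional K V]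
theorem det_compl {W W' : Submodule K V} (h : IsCompl W W') {g : End K V} (hW : ∀ x ∈ W, g x ∈ W)
    (hW' : ∀ x ∈ W', g x ∈ W') : det g = det (g.restrict hW) * det (g.restrict hW') := by
  rw [← LinearMap.det_prodMap, ← LinearMap.det_conj _ (Submodule.prodEquivOfIsCompl W W' h)]
  congr 1
  apply LinearMap.ext; intro x
  obtain ⟨⟨u, v⟩, rfl⟩ := (Submodule.prodEquivOfIsCompl W W' h).surjective x
  simp

theorem det_neg_id {W : Submodule K V} {g : End K V} (hW : ∀ x ∈ W, g x ∈ W) (h : ∀ x ∈ W, g x = - x) :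
    det (g.restrict hW) = (-1) ^ finrank K W := by
  have : g.restrict hW = (-1 : K) • (1 : End K W) := by
    ext x; simp [h x x.2]
  rw [this, LinearMap.det_smul]; simp

theorem det_pos_id {W : Submodule K V} {g : End K V} (hW : ∀ x ∈ W, g x ∈ W) (h : ∀ x ∈ W, g x = x) :
    det (g.restrict hW) = 1 := by
  have : g.restrict hW = (1 : End K W) := by
    ext x; simp [h x x.2]
  rw [this]; simp

theorem invol_compl (h2 : (2 : K) ≠ 0) {b : End K V} (hb : b * b = 1) :
    IsCompl (ker (b - 1)) (ker (b + 1)) := by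
  have hb' : ∀ x, b (b x) = x := fun x => LinearMap.congr_fun hb x
  constructor
  · rw [Submodule.disjoint_def]
    intro x h1 h3
    simp [sub_eq_zero] at h1 h3
    rw [h1, ← two_smul K, smul_eq_zero] at h3
    exact h3.resolve_left h2
  · rw [codisjoint_iff, eq_top_iff]
    intro x _
    refine mem_sup.2 ⟨(2 : K)⁻¹ • (x + b x), ?_, (2 : K)⁻¹ • (x - b x), ?_, ?_⟩
    · simp [hb', add_comm]
    · simp [hb']
    · rw [← smul_add, add_add_sub_cancel, ← two_smul K x, smul_smul, inv_mul_cancel₀ h2, one_smul]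

theorem det_invol (h2 : (2 : K) ≠ 0) {b : End K V} (hb : b * b = 1) :
    det b = (-1) ^ finrank K (ker (b + 1)) := by
  have hb' : ∀ x, b (b x) = x := fun x => LinearMap.congr_fun hb x
  have h1 : ∀ x ∈ ker (b - 1), b x = x := fun x hx => by simpa [sub_eq_zero] using hx
  have h3 : ∀ x ∈ ker (b + 1), b x = -x := fun x hx => by simpa [add_eq_zero_iff_eq_neg] using hx
  rw [det_compl (invol_compl h2 hb) (fun x hx => (h1 x hx).symm ▸ hx) (fun x hx => by rw [h3 x hx]; exact neg_mem hx),
    det_pos_id _ h1, det_neg_id _ h3, one_mul]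

theorem det_cayley {B : BilinForm K V} (hB : B.Nondegenerate) {g : End K V} (hg : Iso B g)
    (hi : Function.Injective (g + 1 : End K V)) : det g = 1 := by
  classical
  let b := finBasis K V
  have h1 : B.comp g (g + 1) = B.comp (g + 1) LinearMap.id := by
    ext x y
    simp [hg x y, add_comm]
  have h3 := congrArg (fun f => (LinearMap.BilinForm.toMatrix b f).det) h1
  simp only [LinearMap.BilinForm.toMatrix_comp b b, Matrix.det_mul, Matrix.det_transpose, LinearMap.det_toMatrix] at h3
  have h5 : (LinearMap.BilinForm.toMatrix b B).det ≠ 0 := (LinearMap.BilinForm.nondegenerate_iff_det_ne_zero b).1 hB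
  have h6 : det (g + 1) ≠ 0 := by
    have := (LinearMap.isUnit_iff_ker_eq_bot (g + 1)).2 (ker_eq_bot.2 hi)
    exact ((LinearMap.isUnit_iff_isUnit_det _).1 this).ne_zero
  simp only [LinearMap.det_id, mul_one] at h3
  apply mul_right_cancel₀ h5
  apply mul_right_cancel₀ h6
  rw [h3]; ring

theorem g1_compl (h2 : (2 : K) ≠ 0) {B : BilinForm K V} (hB : B.Nondegenerate) {g : End K V}
    (hg : Iso B g) {k : ℕ} (hk : g ^ 2 ^ k = 1) :
    IsCompl (ker (g + 1)) (range (g + 1)) ∧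
    (∀ x ∈ ker (g + 1), ∀ y ∈ range (g + 1), B x y = 0 ∧ B y x = 0) := by
  have ho : ∀ x ∈ ker (g + 1), ∀ y ∈ range (g + 1), B x y = 0 ∧ B y x = 0 := by
    rintro x hx _ ⟨z, rfl⟩
    have hx' : g x = -x := by simpa [add_eq_zero_iff_eq_neg] using hx
    have e1 := hg x z
    have e2 := hg z x
    rw [hx'] at e1 e2
    simp at e1 e2 ⊢
    exact ⟨by rw [← e1]; ring, by rw [← e2]; ring⟩
  refine ⟨?_, ho⟩
  have hdis : Disjoint (ker (g + 1)) (range (g + 1)) := by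
    rw [Submodule.disjoint_def]
    rintro _ hx ⟨y, rfl⟩
    set x := (g + 1) y with hxd
    have hx' : g x = -x := by simpa [add_eq_zero_iff_eq_neg] using hx
    have hy : g y = x - y := by simp [hxd]
    have hp : ∀ m : ℕ, (g ^ (2 * m)) y = y - (2 * m : K) • x := by
      intro m
      induction m with
      | zero => simp
      | succ m ih =>
        rw [mul_add, mul_one, add_comm, pow_add, mul_apply, ih, pow_two, mul_apply]
        simp only [map_sub, map_smul, hx', hy, map_neg]
        push_cast
        module
    rcases k with _ | k
    · simp at hk
      rw [hk] at hx'
      simp at hx'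
      have : (2 : K) • x = 0 := by rw [two_smul]; nth_rw 1 [hx']; simp
      exact (smul_eq_zero.1 this).resolve_left h2
    · have := hp (2 ^ k)
      rw [← pow_succ', hk] at this
      have h5 : (2 * ((2 ^ k : ℕ) : K)) • x = 0 := by
        rw [End.one_apply] at this
        exact sub_eq_self.1 this.symm
      refine (smul_eq_zero.1 h5).resolve_left ?_
      push_cast
      exact mul_ne_zero h2 (pow_ne_zero _ h2)
  refine ⟨hdis, ?_⟩
  rw [codisjoint_iff]
  apply Submodule.eq_top_of_disjoint _ _ ?_ hdis
  rw [add_comm, LinearMap.finrank_range_add_finrank_ker]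

theorem det_iso2 (h2 : (2 : K) ≠ 0) {B : BilinForm K V} (hB : B.Nondegenerate) {g : End K V}
    (hg : Iso B g) {k : ℕ} (hk : g ^ 2 ^ k = 1) (he : Even (finrank K (ker (g + 1)))) : det g = 1 := by
  obtain ⟨hc, ho⟩ := g1_compl h2 hB hg hk
  have h1 : ∀ x ∈ ker (g + 1), g x = -x := fun x hx => by simpa [add_eq_zero_iff_eq_neg] using hx
  have m2 : ∀ x ∈ range (g + 1), g x ∈ range (g + 1) := by
    rintro _ ⟨y, rfl⟩; exact ⟨g y, by simp⟩
  rw [det_compl hc (fun x hx => by rw [h1 x hx]; exact neg_mem hx) m2, det_neg_id _ h1, he.neg_one_pow, one_mul]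
  apply det_cayley (B := B.restrict (range (g + 1)))
  · constructor
    · intro x hx
      apply Subtype.ext
      apply hB.1
      intro y
      obtain ⟨u, hu, v, hv, rfl⟩ := mem_sup.1 (hc.sup_eq_top ▸ Submodule.mem_top : y ∈ _ ⊔ _)
      have := hx ⟨v, hv⟩
      simp at this
      simp [this, (ho u hu x x.2).2]
    · intro x hx
      apply Subtype.ext
      apply hB.2
      intro y
      obtain ⟨u, hu, v, hv, rfl⟩ := mem_sup.1 (hc.sup_eq_top ▸ Submodule.mem_top : y ∈ _ ⊔ _)
      have := hx ⟨v, hv⟩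
      simp at this
      simp [this, (ho u hu x x.2).1]
  · exact hg.restrict m2
  · intro x y hxy
    apply Subtype.ext
    rw [← sub_eq_zero]
    have h5 : ((x : V) - y) ∈ ker (g + 1) := by
      have := congrArg (fun z : range (g + 1) => (z : V)) hxy
      simp at this
      simp [sub_add_sub_comm, this]
    have h6 : ((x : V) - y) ∈ range (g + 1) := sub_mem x.2 y.2
    exact Submodule.disjoint_def.1 hc.disjoint _ h5 h6

theorem alt_even (h2 : (2 : K) ≠ 0) {B : BilinForm K V} (hB : B.Nondegenerate) (ha : ∀ x y, B x y = - B y x) :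
    Even (finrank K V) := by
  classical
  let b := finBasis K V
  have h5 : (LinearMap.BilinForm.toMatrix b B).det ≠ 0 := (LinearMap.BilinForm.nondegenerate_iff_det_ne_zero b).1 hB
  have h : (LinearMap.BilinForm.toMatrix b B).transpose = -(LinearMap.BilinForm.toMatrix b B) := by
    ext i j; simp [LinearMap.BilinForm.toMatrix_apply]; exact ha _ _
  have := congrArg Matrix.det h
  rw [Matrix.det_transpose, Matrix.det_neg, Fintype.card_fin] at this
  by_contra ho
  rw [Nat.not_even_iff_odd] at ho
  rw [ho.neg_one_pow] at this
  apply h5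
  have h7 : 2 * (LinearMap.BilinForm.toMatrix b B).det = 0 := by linear_combination this
  exact (mul_eq_zero.1 h7).resolve_left h2

theorem det_alt2 (h2 : (2 : K) ≠ 0) {B : BilinForm K V} (hB : B.Nondegenerate) (ha : ∀ x y, B x y = - B y x)
    {g : End K V} (hg : Iso B g) {k : ℕ} (hk : g ^ 2 ^ k = 1) : det g = 1 := by
  apply det_iso2 h2 hB hg hk
  obtain ⟨hc, ho⟩ := g1_compl h2 hB hg hk
  have hsep : ∀ x : ker (g + 1), (∀ y : ker (g + 1), B x y = 0) → x = 0 := by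
    intro x hx
    apply Subtype.ext
    apply hB.1
    intro y
    obtain ⟨u, hu, v, hv, rfl⟩ := mem_sup.1 (hc.sup_eq_top ▸ Submodule.mem_top : y ∈ _ ⊔ _)
    have := hx ⟨u, hu⟩
    simp at this
    simp [this, (ho x x.2 v hv).1]
  apply alt_even h2 (B := B.restrict (ker (g + 1)))
  · exact ⟨fun x hx => hsep x hx, fun x hx => hsep x fun y => by rw [ha]; simpa using hx y⟩
  · intro x y; simpa using ha x y

theorem iso_half {B : BilinForm K V} (hB : B.Nondegenerate) (ha : ∀ x y, B x y = - B y x)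
    {E : Submodule K V} (hE : ∀ x ∈ E, ∀ y ∈ E, B x y = 0) : 2 * finrank K E ≤ finrank K V := by
  have hr : B.IsRefl := fun x y h => by rw [ha, h, neg_zero]
  have := LinearMap.BilinForm.finrank_orthogonal hB E
  have h3 : E ≤ B.orthogonal E := fun x hx y hy => hE y hy x hx
  have h5 := Submodule.finrank_mono h3
  have h6 := E.finrank_le
  omega

theorem det_anti (h2 : (2 : K) ≠ 0) {B : BilinForm K V} (hB : B.Nondegenerate) (ha : ∀ x y, B x y = - B y x)
    {b : End K V} (hb : b * b = 1) (hg : ∀ x y, B (b x) (b y) = - B x y) :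
    ∃ m, finrank K V = 2 * m ∧ det b = (-1) ^ m := by
  have hb' : ∀ x, b (b x) = x := fun x => LinearMap.congr_fun hb x
  have h1 : ∀ x ∈ ker (b - 1), b x = x := fun x hx => by simpa [sub_eq_zero] using hx
  have h3 : ∀ x ∈ ker (b + 1), b x = -x := fun x hx => by simpa [add_eq_zero_iff_eq_neg] using hx
  have aux : ∀ c : K, c = - c → c = 0 := fun c hc => by
    have : 2 * c = 0 := by linear_combination hc
    exact (mul_eq_zero.1 this).resolve_left h2
  have e1 := iso_half hB ha (E := ker (b - 1)) fun x hx y hy => aux _ (by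
    have := hg x y; rwa [h1 x hx, h1 y hy] at this)
  have e2 := iso_half hB ha (E := ker (b + 1)) fun x hx y hy => aux _ (by
    have := hg x y; rw [h3 x hx, h3 y hy] at this; simpa using this)
  have e3 := Submodule.finrank_add_eq_of_isCompl (invol_compl h2 hb)
  exact ⟨finrank K (ker (b + 1)), by omega, det_invol h2 hb⟩
end det

end

section
theorem orth_inv [FiniteDimensional K V] {f : BilinForm K V} (hf : f.Nondegenerate) {g : End K V}
    (hg : Iso f g) {W : Submodule K V} (hW : ∀ x ∈ W, g x ∈ W) : ∀ x ∈ f.orthogonal W, g x ∈ f.orthogonal W := by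
  have h1 : W.map g = W := by
    apply Submodule.eq_of_le_of_finrank_eq
    · rintro _ ⟨x, hx, rfl⟩; exact hW x hx
    · exact (LinearEquiv.finrank_eq (Submodule.equivMapOfInjective g (hg.inj hf) W)).symm
  intro x hx y hy
  rw [← h1] at hy
  obtain ⟨w, hw, rfl⟩ := hy
  exact (hg w x).trans (hx w hw)

theorem emb_inj {P : Type*} [AddCommGroup P] [Module K P] {f : BilinForm K V} (Ψ : P →ₗ[K] V)
    (hF : (f.comp Ψ Ψ).Nondegenerate) : Function.Injective Ψ := by
  rw [← ker_eq_bot, LinearMap.ker_eq_bot']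
  intro x hx
  apply hF.1 x
  intro y
  simp [hx]

theorem emb_nd {P : Type*} [AddCommGroup P] [Module K P] {f : BilinForm K V} (Ψ : P →ₗ[K] V)
    (hF : (f.comp Ψ Ψ).Nondegenerate) : (f.restrict (range Ψ)).Nondegenerate := by
  constructor
  · rintro ⟨_, u, rfl⟩ hx
    have := hF.1 u fun v => by simpa using hx ⟨Ψ v, v, rfl⟩
    simp [this]
  · rintro ⟨_, u, rfl⟩ hx
    have := hF.2 u fun v => by simpa using hx ⟨Ψ v, v, rfl⟩
    simp [this]

theorem emb_chi [Finite K] [FiniteDimensional K V] {P : Type*} [AddCommGroup P] [Module K P] [FiniteDimensional K P]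
    {f : BilinForm K V} (Ψ : P →ₗ[K] V) (hF : (f.comp Ψ Ψ).Nondegenerate)
    {g : End K V} (hg : Iso f g) {G : End K P} (hG : ∀ u, g (Ψ u) = Ψ (G u))
    (hW : ∀ x ∈ range Ψ, g x ∈ range Ψ) (a : K) :
    chi (f.restrict (range Ψ)) a (g.restrict hW) = chi (f.comp Ψ Ψ) a G := by
  refine chi_conj_eq (LinearEquiv.ofInjective Ψ (emb_inj Ψ hF)) ?_ hF ?_ ?_ a
  · intro x y; simp
  · intro x y; simp [← hG, hg (Ψ x) (Ψ y)]
  · intro x; apply Subtype.ext; simp [hG]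

theorem emb_finrank {P : Type*} [AddCommGroup P] [Module K P] [FiniteDimensional K P]
    {f : BilinForm K V} (Ψ : P →ₗ[K] V) (hF : (f.comp Ψ Ψ).Nondegenerate) :
    finrank K (range Ψ) = finrank K P := LinearMap.finrank_range_of_inj (emb_inj Ψ hF)

def Skew (f : BilinForm K V) (T : End K V) : Prop := ∀ x y, f (T x) y = - f x (T y)

theorem Skew.pow {f : BilinForm K V} {T : End K V} (h : Skew f T) (i : ℕ) (x y : V) :
    f ((T ^ i) x) y = (-1) ^ i * f x ((T ^ i) y) := by
  induction i generalizing y with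
  | zero => simp
  | succ i ih => rw [pow_succ', mul_apply, h, ih, ← mul_apply, ← pow_succ, ← pow_succ', pow_succ (-1 : K)]; ring

theorem Skew.orth {f : BilinForm K V} {T : End K V} (h : Skew f T) {W : Submodule K V} (hW : ∀ x ∈ W, T x ∈ W) :
    ∀ x ∈ f.orthogonal W, T x ∈ f.orthogonal W := by
  intro x hx y hy
  have h1 : f (T y) x = 0 := hx _ (hW y hy)
  have h3 := h y x
  rw [h1] at h3
  exact neg_eq_zero.1 h3.symm

theorem Skew.restrict {f : BilinForm K V} {T : End K V} (h : Skew f T) {W : Submodule K V} (hW : ∀ x ∈ W, T x ∈ W) :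
    Skew (f.restrict W) (T.restrict hW) := fun x y => by simpa using h x y

def HZ (f : BilinForm K V) (T : End K V) : Prop :=
  ∀ d, Odd d → ∀ x y, (T ^ d) x = 0 → (T ^ d) y = 0 → f x ((T ^ (d - 1)) y) = 0

theorem rpow {T : End K V} {W : Submodule K V} (hW : ∀ x ∈ W, T x ∈ W) (i : ℕ) (x : W) :
    (((T.restrict hW) ^ i) x : V) = (T ^ i) x := by
  induction i generalizing x with
  | zero => simp
  | succ i ih => rw [pow_succ, mul_apply, ih, pow_succ, mul_apply]; simp

theorem HZ.restrict {f : BilinForm K V} {T : End K V} (h : HZ f T) {W : Submodule K V} (hW : ∀ x ∈ W, T x ∈ W) :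
    HZ (f.restrict W) (T.restrict hW) := fun d hd x y hx hy => by
  have := h d hd x y (by rw [← rpow hW, hx]; rfl) (by rw [← rpow hW, hy]; rfl)
  simpa [rpow] using this

theorem nil_restrict {T : End K V} (h : IsNilpotent T) {W : Submodule K V} (hW : ∀ x ∈ W, T x ∈ W) :
    IsNilpotent (T.restrict hW) := by
  obtain ⟨k, hk⟩ := h
  exact ⟨k, by ext x; rw [rpow, hk]; simp⟩

theorem top_index {T : End K V} [Nontrivial V] (h : IsNilpotent T) : ∃ D, T ^ (D + 1) = 0 ∧ T ^ D ≠ 0 := by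
  classical
  have h0 : Nat.find h ≠ 0 := fun h0 => by
    have := Nat.find_spec h; rw [h0] at this; simp at this
  refine ⟨Nat.find h - 1, ?_, Nat.find_min h (by omega)⟩
  rw [Nat.sub_add_cancel (by omega)]; exact Nat.find_spec h

theorem two_pow_semisimple (h2 : (2 : K) ≠ 0) {g : End K V} {k : ℕ} (hk : g ^ 2 ^ k = 1) : g.IsSemisimple := by
  apply End.isSemisimple_of_squarefree_aeval_eq_zero (p := X ^ 2 ^ k - 1)
  · apply Polynomial.Separable.squarefree
    have := Polynomial.separable_X_pow_sub_C (F := K) (n := 2 ^ k) (1 : K) (by push_cast; exact pow_ne_zero _ h2) one_ne_zero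
    simpa using this
  · simp [hk]

theorem nd_of_sep {f : BilinForm K V} (hs : f.IsSymm) (h : ∀ x, (∀ y, f x y = 0) → x = 0) : f.Nondegenerate := by
  have hr : f.IsRefl := hs.isRefl
  exact (LinearMap.IsRefl.nondegenerate_iff_separatingLeft hr).2 h

theorem pow_ge {T : End K V} {D : ℕ} (h : T ^ D = 0) {i : ℕ} (hi : D ≤ i) : T ^ i = 0 := pow_eq_zero_of_le hi h

section block
variable [FiniteDimensional K V] {f : BilinForm K V}
/-- block embedding -/
noncomputable def Psi (T : End K V) (D : ℕ) (X : Submodule K V) : (Fin D → X) →ₗ[K] V :=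
  ∑ i : Fin D, (T ^ (i : ℕ)) ∘ₗ X.subtype ∘ₗ LinearMap.proj i

theorem Psi_apply (T : End K V) (D : ℕ) (X : Submodule K V) (u) : Psi T D X u = ∑ i : Fin D, (T ^ (i : ℕ)) (u i) := by
  simp [Psi]

theorem Psi_single (T : End K V) (D : ℕ) (X : Submodule K V) (j : Fin D) (v : X) :
    Psi T D X (Pi.single j v) = (T ^ (j : ℕ)) v := by
  rw [Psi_apply, Finset.sum_eq_single j]
  · simp
  · intro i _ hj; rw [Pi.single_eq_of_ne hj]; simp
  · simp

theorem Psi_nd (hs : f.IsSymm) {T : End K V} (hT : Skew f T) {D : ℕ} {X : Submodule K V} (hD : ∀ x ∈ X, (T ^ (D + 1)) x = 0)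
    (hX : ∀ x : X, (∀ y : X, f x ((T ^ D) y) = 0) → x = 0) :
    (f.comp (Psi T (D + 1) X) (Psi T (D + 1) X)).Nondegenerate := by
  apply nd_of_sep
  · exact ⟨fun x y => by simpa using hs.eq _ _⟩
  intro u hu
  have : ∀ m : ℕ, ∀ i : Fin (D + 1), (i : ℕ) = m → u i = 0 := by
    intro m
    induction m using Nat.strong_induction_on with
    | _ m ih =>
      intro i hi
      apply hX
      intro v
      have := hu (Pi.single (Fin.rev i) v)
      rw [LinearMap.BilinForm.comp_apply, Psi_single, Psi_apply, map_sum, LinearMap.sum_apply,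
        Finset.sum_eq_single i] at this
      · rw [hT.pow, ← mul_apply, ← pow_add] at this
        have h3 : (i : ℕ) + ((Fin.rev i : Fin (D + 1)) : ℕ) = D := by rw [Fin.val_rev]; omega
        rw [h3] at this
        exact (mul_eq_zero.1 this).resolve_left (pow_ne_zero _ (by simp))
      · intro j _ hj
        rcases lt_or_gt_of_ne (Fin.val_ne_of_ne hj) with h | h
        · rw [ih j (by omega) j rfl]; simp
        · rw [hT.pow, ← mul_apply, ← pow_add, End.pow_map_zero_of_le (by rw [Fin.val_rev]; omega) (hD v v.2)]; simp
      · simp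
  exact funext fun i => this i i rfl

theorem Tg {T g : End K V} {η : K} (hη : η * η = 1) (h : g * T = η • (T * g)) (i : ℕ) (x : V) :
    g ((T ^ i) x) = η ^ i • (T ^ i) (g x) := by
  induction i generalizing x with
  | zero => simp
  | succ i ih =>
    have h1 : ∀ x, g (T x) = η • T (g x) := fun x => by simpa using LinearMap.congr_fun h x
    rw [pow_succ, mul_apply, ih, h1, map_smul, mul_apply, smul_smul, ← pow_succ]

theorem block_step [Finite K] (h4 : ¬ IsSquare (-1 : K)) (hs : f.IsSymm) (hf : f.Nondegenerate) [Nontrivial V]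
    {T : End K V} (hT : Skew f T) (hn : IsNilpotent T) (hz : HZ f T) {g : End K V} (hg : Iso f g)
    {k : ℕ} (hk : g ^ 2 ^ k = 1) {η : K} (hη : η * η = 1) (hgT : g * T = η • (T * g)) {a : K} (ha : a ≠ 0) :
    ∃ W : Submodule K V, W ≠ ⊥ ∧ (f.restrict W).Nondegenerate ∧ (∀ x ∈ W, T x ∈ W) ∧ ∃ hW : ∀ x ∈ W, g x ∈ W,
      (η = 1 → chi (f.restrict W) a (g.restrict hW) = 1) ∧
      (η = -1 → g * g = 1 → ∃ r, finrank K W = 4 * r ∧ chi (f.restrict W) a (g.restrict hW) = (-1) ^ r) := by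
  have h2 := two_ne h4
  obtain ⟨D, hD, hD'⟩ := top_index hn
  have hodd : Odd D := by
    by_contra hc
    rw [Nat.not_odd_iff_even] at hc
    apply hD'
    apply LinearMap.ext; intro y
    apply hf.2
    intro x
    exact hz (D + 1) hc.add_one x y (by simp [hD]) (by simp [hD])
  obtain ⟨e, he⟩ : ∃ e, D + 1 = 2 * e := by obtain ⟨e, rfl⟩ := hodd; exact ⟨e + 1, by ring⟩
  obtain ⟨X, hXi, hXc⟩ := End.isSemisimple_iff.1 (two_pow_semisimple h2 hk) (ker (T ^ D)) (by
    rw [End.mem_invtSubmodule]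
    intro x hx
    have hx' : (T ^ D) x = 0 := hx
    have := Tg hη hgT D x
    rw [hx', map_zero] at this
    rw [Submodule.mem_comap, mem_ker]
    have h0 : η ^ D ≠ 0 := pow_ne_zero _ fun h => by simp [h] at hη
    exact (smul_eq_zero.1 this.symm).resolve_left h0)
  have hX : ∀ x ∈ X, g x ∈ X := fun x hx => hXi hx
  have hXs : ∀ x : X, (∀ y : X, f x ((T ^ D) y) = 0) → x = 0 := by
    intro x hx
    apply Subtype.ext
    have h0 : (T ^ D) (x : V) = 0 := by
      apply hf.1; intro y
      obtain ⟨u, hu, v, hv, rfl⟩ := mem_sup.1 (hXc.sup_eq_top ▸ Submodule.mem_top : y ∈ _ ⊔ _)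
      have hu' : (T ^ D) u = 0 := hu
      rw [hT.pow, map_add, hu', zero_add, hx ⟨v, hv⟩, mul_zero]
    exact Submodule.disjoint_def.1 hXc.disjoint _ h0 x.2
  let h : BilinForm K X := f.comp X.subtype ((T ^ D) ∘ₗ X.subtype)
  have hh : ∀ x y, h x y = f x ((T ^ D) y) := fun x y => rfl
  have halt : ∀ x y, h x y = - h y x := fun x y => by
    have h1 := hT.pow D x y
    rw [hodd.neg_one_pow] at h1
    rw [hh, hh, show f y ((T ^ D) x) = f ((T ^ D) x) y from hs.eq _ _, h1]; simp
  have hnd : h.Nondegenerate := ⟨fun x hx => hXs x hx, fun x hx => hXs x fun y => by rw [← hh, halt, hx, neg_zero]⟩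
  have hXg : ∀ x y, h (g.restrict hX x) (g.restrict hX y) = η * h x y := by
    intro x y
    have h1 := Tg hη hgT D (y : V)
    have h3 : (T ^ D) (g y) = η ^ D • g ((T ^ D) y) := by
      rw [h1, smul_smul, ← mul_pow, hη, one_pow, one_smul]
    have h5 : η ^ D = η := by
      obtain ⟨r, rfl⟩ := hodd
      rw [pow_succ, pow_mul, pow_two, hη, one_pow, one_mul]
    rw [hh, hh, LinearMap.restrict_coe_apply, LinearMap.restrict_coe_apply, h3, h5, map_smul, hg, smul_eq_mul]
  have hΨ := Psi_nd hs hT (D := D) (X := X) (fun x _ => by rw [hD]; rfl) hXs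
  obtain ⟨Ψ, hPs⟩ : ∃ Ψ, Ψ = Psi T (D + 1) X := ⟨_, rfl⟩
  rw [← hPs] at hΨ
  have heven := alt_even h2 hnd halt
  let G : End K (Fin (D + 1) → X) := LinearMap.pi fun i => (η ^ (i : ℕ) • g.restrict hX) ∘ₗ LinearMap.proj i
  have hG : ∀ u, g (Ψ u) = Ψ (G u) := fun u => by
    rw [hPs, Psi_apply, Psi_apply, map_sum]
    refine Finset.sum_congr rfl fun i _ => ?_
    rw [Tg hη hgT i _, ← map_smul]
    rfl
  have hW : ∀ x ∈ range Ψ, g x ∈ range Ψ := by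
    rintro _ ⟨u, rfl⟩; rw [hG]; exact ⟨_, rfl⟩
  let ι : (Fin e → X) →ₗ[K] (Fin (D + 1) → X) :=
    LinearMap.pi fun i => if h : e ≤ (i : ℕ) then LinearMap.proj ⟨i - e, by omega⟩ else 0
  have hι : ∀ v i, ι v i = if h : e ≤ (i : ℕ) then v ⟨i - e, by omega⟩ else 0 := fun v i => by
    simp only [ι, LinearMap.pi_apply]; split_ifs <;> rfl
  let kk : End K (Fin e → X) := LinearMap.pi fun i => (η ^ (e + i : ℕ) • g.restrict hX) ∘ₗ LinearMap.proj i
  have hchi : chi (f.comp Ψ Ψ) a G = qc (det kk) := by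
    apply chi_lag h4 _ hΨ ι _ _ _ _ _ ha
    · exact ⟨fun x y => by simpa using hs.eq _ _⟩
    · intro u v huv
      funext i
      have := congrFun huv ⟨e + i, by omega⟩
      rw [hι, hι, dif_pos (by simp), dif_pos (by simp)] at this
      simpa using this
    · intro u v
      rw [LinearMap.BilinForm.comp_apply]
      rw [hPs, Psi_apply, Psi_apply, map_sum]
      refine Finset.sum_eq_zero fun i _ => ?_
      rw [map_sum, LinearMap.sum_apply]
      refine Finset.sum_eq_zero fun j _ => ?_
      rw [hι, hι]
      split_ifs
      · rw [hT.pow, ← mul_apply, ← pow_add, pow_ge hD (by omega)]; simp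
      all_goals simp
    · rw [Module.finrank_pi_fintype, Module.finrank_pi_fintype]; simp [he, mul_assoc]
    · intro x y; simp [← hG, hg (Ψ x) (Ψ y)]
    · intro v
      funext i
      rw [hι]
      simp only [G, kk, LinearMap.pi_apply, LinearMap.comp_apply, LinearMap.proj_apply]
      rw [hι]
      split_ifs with h
      · simp only [LinearMap.smul_apply]
        congr 2; omega
      · simp
  have hdk : det kk = det (g.restrict hX) ^ e := by
    simp only [kk]
    rw [LinearMap.det_pi]
    simp only [LinearMap.det_smul]
    obtain ⟨r, hr⟩ := heven
    have : ∀ i : ℕ, (η ^ i) ^ finrank K X = 1 := fun i => by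
      rw [hr, ← two_mul, pow_mul, ← pow_mul η, mul_comm i 2, pow_mul, pow_two, hη, one_pow, one_pow]
    simp [this]
  have hfr : finrank K (range Ψ) = 2 * e * finrank K X := by
    rw [emb_finrank Ψ hΨ, Module.finrank_pi_fintype]; simp [he]
  refine ⟨range Ψ, ?_, emb_nd Ψ hΨ, ?_, hW, ?_, ?_⟩
  · intro hb
    rw [hb] at hfr
    simp at hfr
    rcases hfr with h0 | h0
    · omega
    · have : X = ⊥ := h0
      rw [this] at hXc
      have := eq_top_of_isCompl_bot hXc
      rw [LinearMap.ker_eq_top] at this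
      exact hD' this
  · rintro _ ⟨u, rfl⟩
    rw [show Ψ u = ∑ i : Fin (D + 1), (T ^ (i : ℕ)) (u i) by rw [hPs]; exact Psi_apply T (D + 1) X u, map_sum]
    refine Submodule.sum_mem _ fun i _ => ?_
    rw [← mul_apply, ← pow_succ']
    by_cases hi : (i : ℕ) + 1 < D + 1
    · refine ⟨Pi.single ⟨i + 1, hi⟩ (u i), ?_⟩
      rw [hPs, Psi_single]
    · rw [pow_ge hD (by omega)]; simp
  · rintro rfl
    rw [emb_chi Ψ hΨ hg hG hW, hchi, hdk, det_alt2 h2 hnd halt (k := k) (fun x y => by rw [hXg, one_mul])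
      (by ext x; rw [rpow, hk]; simp), one_pow, qc_one]
  · rintro rfl hgg
    obtain ⟨m, hm, hdm⟩ := det_anti h2 hnd halt (b := g.restrict hX) (by
      ext x; simpa using LinearMap.congr_fun hgg x) (fun x y => by rw [hXg]; ring)
    refine ⟨e * m, by rw [hfr, hm]; ring, ?_⟩
    rw [emb_chi Ψ hΨ hg hG hW, hchi, hdk, hdm, ← pow_mul, qc_neg_one_pow h4, mul_comm]
end block

theorem G0 [Finite K] (h4 : ¬ IsSquare (-1 : K)) {a η : K} (ha : a ≠ 0) (hη : η * η = 1) : ∀ (m : ℕ) (V : Type*) [AddCommGroup V] [Module K V] [FiniteDimensional K V]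
    (f : BilinForm K V) (hs : f.IsSymm) (hf : f.Nondegenerate) (hm : finrank K V = m)
    (T : End K V) (hT : Skew f T) (hn : IsNilpotent T) (hz : HZ f T) (g : End K V) (hg : Iso f g)
    (k : ℕ) (hk : g ^ 2 ^ k = 1)  (hgT : g * T = η • (T * g)),
    (η = 1 → chi f a g = 1) ∧ (η = -1 → g * g = 1 → ∃ r, finrank K V = 4 * r ∧ chi f a g = (-1) ^ r) := by
  have h2 := two_ne h4
  intro m
  induction m using Nat.strong_induction_on with
  | _ m ih =>
    intro V _ _ _ f hs hf hm T hT hn hz g hg k hk hgT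
    rcases subsingleton_or_nontrivial V with hV | hV
    · have : g = 1 := Subsingleton.elim _ _
      rw [this, chi_one]
      exact ⟨fun _ => rfl, fun _ _ => ⟨0, by simp [finrank_zero_of_subsingleton], by simp⟩⟩
    obtain ⟨W, hb, hW, hTW, hgW, c1, c2⟩ := block_step h4 hs hf hT hn hz hg hk hη hgT ha
    have sp := Sp.of_nd hs hW
    have hgW' := orth_inv hf hg hgW
    have hTW' := hT.orth hTW
    have hfr := sp.finrank
    have hpos : 0 < finrank K W := by
      rw [Module.finrank_pos_iff]; exact Submodule.nontrivial_iff_ne_bot.2 hb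
    obtain ⟨d1, d2⟩ := ih _ (by omega) (f.orthogonal W) (f.restrict _) (hs.restrict _) (sp.nd' hs hf) rfl
      (T.restrict hTW') (hT.restrict hTW') (nil_restrict hn hTW') (hz.restrict hTW')
      (g.restrict hgW') (hg.restrict hgW') k (by ext x; rw [rpow, hk]; simp)
      (by ext x; simpa using LinearMap.congr_fun hgT x)
    rw [chi_split h2 hs hf sp hg hgW hgW']
    refine ⟨fun h => by rw [c1 h, d1 h, one_mul], fun h h' => ?_⟩
    obtain ⟨r, hr, e1⟩ := c2 h h'
    obtain ⟨r', hr', e2⟩ := d2 h (by ext x; simpa using LinearMap.congr_fun h' x)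
    exact ⟨r + r', by rw [hfr, hr, hr']; ring, by rw [e1, e2, pow_add]⟩

end

section
/-- Chebyshev-type pair -/
noncomputable def tq (K : Type*) [Field K] : ℕ → K[X] × K[X]
  | 0 => (2, 0)
  | n + 1 => (C (1/2) * (X * (tq K n).1 + (X ^ 2 - 4) * (tq K n).2), C (1/2) * ((tq K n).1 + X * (tq K n).2))

theorem tq_id (h2 : (2 : K) ≠ 0) (n : ℕ) : (tq K n).1 ^ 2 - (X ^ 2 - 4) * (tq K n).2 ^ 2 = 4 ∧
    derivative (tq K n).1 = (n : K[X]) * (tq K n).2 ∧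
    (n : K[X]) * (tq K n).1 = derivative (tq K n).2 * (X ^ 2 - 4) + (tq K n).2 * X := by
  have hc : (C (1/2) : K[X]) * 2 = 1 := by
    rw [show (2 : K[X]) = C 2 from rfl, ← C_mul]; simp [h2]
  induction n with
  | zero => simp [tq]; norm_num
  | succ n ih =>
    obtain ⟨i1, i2, i3⟩ := ih
    have d4 : derivative (4 : K[X]) = 0 := by rw [show (4 : K[X]) = C 4 from rfl, derivative_C]
    have d5 : derivative (X ^ 2 - 4 : K[X]) = 2 * X := by
      rw [derivative_sub, d4, derivative_X_pow]; simp; rfl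
    have d6 : derivative (C (1/2) : K[X]) = 0 := derivative_C
    simp only [tq, d6, zero_mul, zero_add, derivative_add, derivative_mul, derivative_X, d5]
    generalize (tq K n).1 = t at *
    generalize (tq K n).2 = q at *
    generalize C (1/2 : K) = c at *
    generalize derivative t = t' at *
    generalize derivative q = q' at *
    subst i2
    push_cast
    refine ⟨?_, ?_, ?_⟩
    · linear_combination 4 * c ^ 2 * i1 + 4 * (2 * c + 1) * hc
    · linear_combination -c * i3
    · linear_combination c * X * i3

theorem tq_sep (h2 : (2 : K) ≠ 0) {n : ℕ} (hn : (n : K) ≠ 0) : (tq K n).2.Separable := by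
  obtain ⟨i1, i2, i3⟩ := tq_id h2 n
  have hc : (C (1 / (4 * n ^ 2)) : K[X]) * (4 * (n : K[X]) ^ 2) = 1 := by
    rw [show (4 : K[X]) = C 4 from rfl, show (n : K[X]) = C (n : K) by simp, ← C_pow, ← C_mul, ← C_mul]
    have : (4 : K) ≠ 0 := by
      rw [show (4 : K) = 2 * 2 by norm_num]; exact mul_ne_zero h2 h2
    rw [one_div_mul_cancel (by positivity), C_1]
  generalize (tq K n).1 = t at *
  generalize (tq K n).2 = q at *
  generalize C (1 / (4 * n ^ 2) : K) = c at *
  refine ⟨c * ((n : K[X]) * t * X - (n : K[X]) ^ 2 * (X ^ 2 - 4) * q), c * ((n : K[X]) * t * (X ^ 2 - 4)), ?_⟩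
  linear_combination hc + c * (n : K[X]) ^ 2 * i1 - c * (n : K[X]) * t * i3

theorem tq_end (h2 : (2 : K) ≠ 0) {φ ψ : End K V} (h : φ * ψ = 1) (h' : ψ * φ = 1) (n : ℕ) :
    (2 : K) • φ ^ n = aeval (φ + ψ) (tq K n).1 + (φ - ψ) * aeval (φ + ψ) (tq K n).2 ∧
    (2 : K) • ψ ^ n = aeval (φ + ψ) (tq K n).1 - (φ - ψ) * aeval (φ + ψ) (tq K n).2 := by
  have hN : (φ - ψ) * (φ - ψ) = aeval (φ + ψ) (X ^ 2 - 4 : K[X]) := by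
    have : aeval (φ + ψ) (4 : K[X]) = (4 : End K V) := by
      rw [show (4 : K[X]) = C 4 from rfl, aeval_C]; exact map_ofNat (algebraMap K (End K V)) 4
    rw [map_sub, this, map_pow, aeval_X]
    simp only [pow_two, mul_add, add_mul, sub_mul, mul_sub, h, h']
    rw [show (4 : End K V) = 1 + 1 + 1 + 1 by norm_num]; abel
  have hc : Commute (φ - ψ) (φ + ψ) := by
    simp only [Commute, SemiconjBy, mul_add, add_mul, sub_mul, mul_sub, h, h']; abel
  have hca : ∀ p : K[X], (φ - ψ) * aeval (φ + ψ) p = aeval (φ + ψ) p * (φ - ψ) := fun p => by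
    induction p using Polynomial.induction_on' with
    | add p q hp hq => simp [mul_add, add_mul, hp, hq]
    | monomial n a => 
      rw [aeval_monomial, ← mul_assoc, ← Algebra.commutes, mul_assoc, mul_assoc, (hc.pow_right n).eq]
  have hM : (2 : K) • φ = (φ + ψ) + (φ - ψ) := by rw [two_smul]; abel
  have hM' : (2 : K) • ψ = (φ + ψ) - (φ - ψ) := by rw [two_smul]; abel
  induction n with
  | zero => 
    have : aeval (φ + ψ) (2 : K[X]) = (2 : K) • (1 : End K V) := by
      rw [show (2 : K[X]) = C 2 from rfl, aeval_C]; rfl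
    simp [tq, this]
  | succ n ih =>
    obtain ⟨i1, i2⟩ := ih
    have e1 : (2 : K) • φ ^ (n + 1) = (1/2 : K) • (((2 : K) • φ ^ n) * ((2 : K) • φ)) := by
      rw [smul_mul_smul, ← pow_succ, smul_smul]; congr 1; field_simp
    have e2 : (2 : K) • ψ ^ (n + 1) = (1/2 : K) • (((2 : K) • ψ ^ n) * ((2 : K) • ψ)) := by
      rw [smul_mul_smul, ← pow_succ, smul_smul]; congr 1; field_simp
    have hX : ∀ p : K[X], aeval (φ + ψ) (X * p) = aeval (φ + ψ) p * (φ + ψ) := fun p => by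
      rw [mul_comm, map_mul, aeval_X]
    have hY : ∀ p : K[X], aeval (φ + ψ) ((X ^ 2 - 4) * p) = (φ - ψ) * aeval (φ + ψ) p * (φ - ψ) := fun p => by
      rw [map_mul, ← hN, mul_assoc, hca, ← mul_assoc, hca]
    have hC : ∀ p : K[X], aeval (φ + ψ) (C (1/2) * p) = (1/2 : K) • aeval (φ + ψ) p := fun p => by
      rw [map_mul, aeval_C, Algebra.smul_def]
    rw [e1, e2, i1, i2, hM, hM']
    simp only [tq]
    rw [hC, hC, map_add, map_add, hX, hY, hX, mul_smul_comm, ← smul_add, ← smul_sub]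
    have h5 : (φ - ψ) * aeval (φ + ψ) (tq K n).1 = aeval (φ + ψ) (tq K n).1 * (φ - ψ) := hca _
    clear e1 e2 hX hY hC i1 i2 hM hM' hca hN
    generalize aeval (φ + ψ) (tq K n).1 = t at *
    generalize aeval (φ + ψ) (tq K n).2 = q at *
    generalize φ + ψ = m at *
    generalize φ - ψ = l at *
    constructor
    · congr 1
      simp only [mul_add, add_mul, h5, mul_assoc]; abel
    · congr 1
      simp only [mul_add, add_mul, mul_sub, sub_mul, h5, mul_assoc]; abel

end

section
noncomputable def pT (K : Type*) [Field K] (o n : ℕ) : K[X] := X ^ ((o - 1) * n) * (X ^ (2 * n) - 1)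
noncomputable def Tm (o n : ℕ) (φ : End K V) : End K V := aeval φ (pT K o n)
noncomputable def Mm (o : ℕ) (φ : End K V) : End K V := φ + φ ^ (o - 1)
noncomputable def Nm (o : ℕ) (φ : End K V) : End K V := φ - φ ^ (o - 1)

structure QS (f : BilinForm K V) (φ : End K V) (o n : ℕ) : Prop where
  symm : f.IsSymm
  nd : f.Nondegenerate
  iso : Iso f φ
  pos : 0 < o
  ord : φ ^ o = 1
  nK : (n : K) ≠ 0
  nil : IsNilpotent (Tm o n φ)

theorem inv_aeval {φ : End K V} {W : Submodule K V} (hW : ∀ x ∈ W, φ x ∈ W) (c : K[X]) :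
    ∀ x ∈ W, aeval φ c x ∈ W := fun x hx => by
  induction c using Polynomial.induction_on' with
  | add p q hp hq => simpa using W.add_mem hp hq
  | monomial n a =>
    rw [aeval_monomial, mul_apply, Module.algebraMap_end_apply]
    refine W.smul_mem _ ?_
    induction n with
    | zero => simpa
    | succ n ih => rw [pow_succ', mul_apply]; exact hW _ ih

theorem raeval {φ : End K V} {W : Submodule K V} (hW : ∀ x ∈ W, φ x ∈ W) (c : K[X]) (x : W) :
    ((aeval (φ.restrict hW) c x : W) : V) = aeval φ c x := by
  induction c using Polynomial.induction_on' with
  | add p q hp hq => simp [hp, hq]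
  | monomial n a =>
    rw [aeval_monomial, mul_apply, Module.algebraMap_end_apply, aeval_monomial, mul_apply,
      Module.algebraMap_end_apply, Submodule.coe_smul, rpow]

theorem Tm_inv {φ : End K V} {W : Submodule K V} (hW : ∀ x ∈ W, φ x ∈ W) (o n : ℕ) :
    ∀ x ∈ W, Tm o n φ x ∈ W := inv_aeval hW _

theorem Tm_res {φ : End K V} {W : Submodule K V} (hW : ∀ x ∈ W, φ x ∈ W) (o n : ℕ) :
    Tm o n (φ.restrict hW) = (Tm o n φ).restrict (Tm_inv hW o n) := by
  ext x; rw [Tm, raeval]; rfl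

theorem Tm_resp {φ : End K V} {W : Submodule K V} (hW : ∀ x ∈ W, φ x ∈ W) (o n i : ℕ) (x : W) :
    (((Tm o n (φ.restrict hW)) ^ i) x : V) = ((Tm o n φ) ^ i) x := by
  rw [Tm_res, rpow]

theorem adj_of {f : BilinForm K V} {A B : End K V} (h : ∀ x y, f (A x) y = f x (B y)) (c : K[X]) (x y : V) :
    f (aeval A c x) y = f x (aeval B c y) := by
  have hp : ∀ n x y, f ((A ^ n) x) y = f x ((B ^ n) y) := fun n => by
    induction n with
    | zero => simp
    | succ n ih => intro x y; rw [pow_succ, mul_apply, ih, h, pow_succ', mul_apply]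
  induction c using Polynomial.induction_on' generalizing x y with
  | add p q hp hq => simp [hp, hq]
  | monomial n a =>
    simp only [aeval_monomial, mul_apply, Module.algebraMap_end_apply, map_smul, LinearMap.smul_apply, hp]

theorem aeval_comm (φ : End K V) (p q : K[X]) : Commute (aeval φ p) (aeval φ q) := by
  rw [Commute, SemiconjBy, ← map_mul, mul_comm, map_mul]

namespace QS
variable {f : BilinForm K V} {φ : End K V} {o n : ℕ}

theorem mp (h : QS f φ o n) : φ * φ ^ (o - 1) = 1 := by
  rw [← pow_succ', Nat.sub_add_cancel h.pos, h.ord]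
theorem pm (h : QS f φ o n) : φ ^ (o - 1) * φ = 1 := by
  rw [← pow_succ, Nat.sub_add_cancel h.pos, h.ord]
theorem adj (h : QS f φ o n) (x y : V) : f (φ x) y = f x ((φ ^ (o - 1)) y) := by
  rw [← h.iso x, ← mul_apply, h.mp]; rfl
theorem adj' (h : QS f φ o n) (x y : V) : f ((φ ^ (o - 1)) x) y = f x (φ y) := by
  rw [h.symm.eq, ← h.adj, h.symm.eq]
theorem npos (h : QS f φ o n) : n ≠ 0 := by
  rintro rfl; exact h.nK (by simp)
theorem Teq (h : QS f φ o n) : Tm o n φ = φ ^ n - (φ ^ (o - 1)) ^ n := by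
  rw [Tm, pT]
  simp only [map_mul, map_pow, aeval_X, map_sub, map_one]
  rw [mul_sub, mul_one, pow_mul, two_mul, pow_add, ← mul_assoc, ← Commute.mul_pow, h.pm, one_pow, one_mul]
  exact h.pm.trans h.mp.symm
theorem skew (h : QS f φ o n) : Skew f (Tm o n φ) := fun x y => by
  have h1 := adj_of h.adj (X ^ n) x y
  have h3 := adj_of h.adj' (X ^ n) x y
  simp only [map_pow, aeval_X] at h1 h3
  rw [h.Teq, LinearMap.sub_apply, map_sub, LinearMap.sub_apply, h1, h3, LinearMap.sub_apply, map_sub]; ring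
theorem Msa (h : QS f φ o n) (c : K[X]) (x y : V) : f (aeval (Mm o φ) c x) y = f x (aeval (Mm o φ) c y) := by
  apply adj_of
  intro x y
  simp [Mm, h.adj, h.adj', add_comm]
theorem Nsk (h : QS f φ o n) (x y : V) : f (Nm o φ x) y = - f x (Nm o φ y) := by
  simp [Nm, h.adj, h.adj']
theorem NM (h : QS f φ o n) (c : K[X]) : Commute (Nm o φ) (aeval (Mm o φ) c) := by
  have e1 : Nm o φ = aeval φ (X - X ^ (o - 1) : K[X]) := by simp [Nm]
  have e2 : Mm o φ = aeval φ (X + X ^ (o - 1) : K[X]) := by simp [Mm]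
  rw [e1, e2, ← aeval_comp]
  exact aeval_comm _ _ _
theorem NN (h : QS f φ o n) : Nm o φ * Nm o φ = aeval (Mm o φ) (X ^ 2 - 4 : K[X]) := by
  have : aeval (Mm o φ) (4 : K[X]) = (4 : End K V) := by
    rw [show (4 : K[X]) = C 4 from rfl, aeval_C]; exact map_ofNat (algebraMap K (End K V)) 4
  rw [map_sub, this, map_pow, aeval_X, Nm, Mm]
  simp only [pow_two, mul_add, add_mul, sub_mul, mul_sub, h.mp, h.pm]
  rw [show (4 : End K V) = 1 + 1 + 1 + 1 by norm_num]; abel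
theorem TNq (h2 : (2 : K) ≠ 0) (h : QS f φ o n) : Tm o n φ = Nm o φ * aeval (Mm o φ) (tq K n).2 := by
  obtain ⟨e1, e2⟩ := tq_end h2 h.mp h.pm n
  have : (2 : K) • Tm o n φ = (2 : K) • (Nm o φ * aeval (Mm o φ) (tq K n).2) := by
    rw [h.Teq, smul_sub, e1, e2, Nm, Mm, two_smul]; abel
  exact smul_right_injective _ h2 this

theorem restrict (h : QS f φ o n) {W : Submodule K V} (hW : ∀ x ∈ W, φ x ∈ W) (hn : (f.restrict W).Nondegenerate) :
    QS (f.restrict W) (φ.restrict hW) o n where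
  symm := h.symm.restrict W
  nd := hn
  iso := h.iso.restrict hW
  pos := h.pos
  ord := by ext x; rw [rpow, h.ord]; rfl
  nK := h.nK
  nil := by rw [Tm_res]; exact nil_restrict h.nil _

theorem rev (h : QS f φ o n) {β : End K V} (hb : φ * β * φ = β) : β * φ = φ ^ (o - 1) * β ∧ β * φ ^ (o - 1) = φ * β := by
  constructor
  · conv_rhs => rw [← hb, mul_assoc φ, ← mul_assoc, h.pm, one_mul]
  · conv_lhs => rw [← hb, mul_assoc, h.mp, mul_one]
theorem revT (h : QS f φ o n) {β : End K V} (hb : φ * β * φ = β) : β * Tm o n φ = (-1 : K) • (Tm o n φ * β) := by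
  obtain ⟨h1, h3⟩ := h.rev hb
  have g1 : SemiconjBy β φ (φ ^ (o - 1)) := h1
  have g3 : SemiconjBy β (φ ^ (o - 1)) φ := h3
  rw [h.Teq, mul_sub, sub_mul, (g1.pow_right n).eq, (g3.pow_right n).eq]; simp
end QS

def HC (f : BilinForm K V) (φ : End K V) (s t : ℤˣ) : Prop :=
  ∃ β : End K V, Iso f β ∧ β * β = 1 ∧ φ * β * φ = β ∧ chi f 1 β = s ∧ chi f (-1) β = t

theorem HC.glue [Finite K] [FiniteDimensional K V] (h2 : (2 : K) ≠ 0) {f : BilinForm K V} (hs : f.IsSymm) (hf : f.Nondegenerate)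
    {W W' : Submodule K V} (sp : Sp f W W') {φ : End K V} (hW : ∀ x ∈ W, φ x ∈ W) (hW' : ∀ x ∈ W', φ x ∈ W')
    {s t s' t' : ℤˣ} (h : HC (f.restrict W) (φ.restrict hW) s t) (h' : HC (f.restrict W') (φ.restrict hW') s' t') :
    HC f φ (s * s') (t * t') := by
  obtain ⟨b, b1, b2, b3, rfl, rfl⟩ := h
  obtain ⟨c, c1, c2, c3, rfl, rfl⟩ := h'
  have gl : ∀ x (hx : x ∈ W), sp.glue b c x = b ⟨x, hx⟩ := fun x hx => sp.glue_l b c ⟨x, hx⟩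
  have gr : ∀ x (hx : x ∈ W'), sp.glue b c x = c ⟨x, hx⟩ := fun x hx => sp.glue_r b c ⟨x, hx⟩
  refine ⟨sp.glue b c, sp.glue_iso hs b1 c1, sp.ext ?_ ?_, sp.ext ?_ ?_, chi_glue h2 hs hf sp b1 c1 1, chi_glue h2 hs hf sp b1 c1 (-1)⟩
  · intro x hx
    rw [mul_apply, gl x hx, gl _ (b _).2]
    have := LinearMap.congr_fun b2 ⟨x, hx⟩
    simpa using congrArg Subtype.val this
  · intro x hx
    rw [mul_apply, gr x hx, gr _ (c _).2]
    have := LinearMap.congr_fun c2 ⟨x, hx⟩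
    simpa using congrArg Subtype.val this
  · intro x hx
    rw [mul_apply, mul_apply, gl _ (hW x hx)]
    have := LinearMap.congr_fun b3 ⟨x, hx⟩
    rw [← show ((φ.restrict hW * b * φ.restrict hW) ⟨x, hx⟩ : V) = φ (b ⟨φ x, hW x hx⟩) from rfl, this]
    exact (gl x hx).symm
  · intro x hx
    rw [mul_apply, mul_apply, gr _ (hW' x hx)]
    have := LinearMap.congr_fun c3 ⟨x, hx⟩
    rw [← show ((φ.restrict hW' * c * φ.restrict hW') ⟨x, hx⟩ : V) = φ (c ⟨φ x, hW' x hx⟩) from rfl, this]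
    exact (gr x hx).symm

theorem HC.neg [Finite K] [FiniteDimensional K V] {f : BilinForm K V} (hf : f.Nondegenerate) {φ : End K V} {s t : ℤˣ} (h : HC f φ s t) :
    HC f φ (nu f 1 * s) (nu f (-1) * t) := by
  obtain ⟨b, b1, b2, b3, rfl, rfl⟩ := h
  have e : -b = (-1) * b := by simp
  refine ⟨-b, b1.neg, by simp [b2], by simp [b3], ?_, ?_⟩
  · rw [e, chi_mul hf (Iso.one f).neg b1]; rfl
  · rw [e, chi_mul hf (Iso.one f).neg b1]; rfl

theorem HC.triv [Finite K] [FiniteDimensional K V] [Subsingleton V] (f : BilinForm K V) (φ : End K V) : HC f φ 1 1 :=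
  ⟨1, Iso.one f, by simp, Subsingleton.elim _ _, chi_one f 1, chi_one f (-1)⟩

theorem HZ.glue {f : BilinForm K V} (hs : f.IsSymm)
    {W W' : Submodule K V} (sp : Sp f W W') {T : End K V} (hW : ∀ x ∈ W, T x ∈ W) (hW' : ∀ x ∈ W', T x ∈ W')
    (h : HZ (f.restrict W) (T.restrict hW)) (h' : HZ (f.restrict W') (T.restrict hW')) : HZ f T := by
  intro d hd x y hx hy
  have inv : ∀ (U : Submodule K V), (∀ x ∈ U, T x ∈ U) → ∀ i, ∀ x ∈ U, (T ^ i) x ∈ U := fun U hU i x hx => by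
    simpa using inv_aeval hU (X ^ i : K[X]) x hx
  have key : ∀ x, (T ^ d) x = 0 → ∃ (u : W) (v : W'), x = u + v ∧ (T.restrict hW ^ d) u = 0 ∧ (T.restrict hW' ^ d) v = 0 := by
    intro x hx
    obtain ⟨u, v, rfl⟩ := sp.exi x
    rw [map_add] at hx
    have h1 : (T ^ d) (u : V) ∈ W' := by
      rw [eq_neg_of_add_eq_zero_left hx]; exact W'.neg_mem (inv W' hW' d _ v.2)
    have h3 := Submodule.disjoint_def.1 sp.compl.disjoint _ (inv W hW d _ u.2) h1
    rw [h3, zero_add] at hx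
    exact ⟨u, v, rfl, Subtype.ext (by rw [rpow, h3]; rfl), Subtype.ext (by rw [rpow, hx]; rfl)⟩
  obtain ⟨u, v, rfl, hu, hv⟩ := key x hx
  obtain ⟨u', v', rfl, hu', hv'⟩ := key y hy
  have a1 := h d hd u u' hu hu'
  have a2 := h' d hd v v' hv hv'
  have a3 := sp.orth u u.2 _ (inv W' hW' (d - 1) _ v'.2)
  have a4 := (sp.symm hs).orth v v.2 _ (inv W hW (d - 1) _ u'.2)
  simp [rpow] at a1 a2
  simp [a1, a2, a3, a4]

structure IsO (f : BilinForm K V) (φ : End K V) (o n : ℕ) (ε : K) (t : ℕ) (x : V) : Prop where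
  sg : ε = 1 ∨ ε = -1
  kil : aeval φ ((X - C ε) ^ (2 * t + 1)) x = 0
  ne : f x ((Tm o n φ ^ (2 * t)) x) ≠ 0

def OT (f : BilinForm K V) (φ : End K V) (o n : ℕ) : Prop := ∃ ε t x, IsO f φ o n ε t x

theorem IsO.lift {f : BilinForm K V} {φ : End K V} {o n : ℕ} {W : Submodule K V} {hW : ∀ x ∈ W, φ x ∈ W}
    {ε : K} {t : ℕ} {x : W} (h : IsO (f.restrict W) (φ.restrict hW) o n ε t x) : IsO f φ o n ε t x := by
  obtain ⟨h1, h3, h4⟩ := h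
  refine ⟨h1, ?_, ?_⟩
  · rw [← raeval hW, h3]; rfl
  · simpa [Tm_resp] using h4

theorem IsO.down {f : BilinForm K V} {φ : End K V} {o n : ℕ} {W : Submodule K V} (hW : ∀ x ∈ W, φ x ∈ W)
    {ε : K} {t : ℕ} {x : W} (h : IsO f φ o n ε t x) : IsO (f.restrict W) (φ.restrict hW) o n ε t x := by
  obtain ⟨h1, h3, h4⟩ := h
  refine ⟨h1, ?_, ?_⟩
  · apply Subtype.ext; rw [raeval hW, h3]; rfl
  · simpa [Tm_resp] using h4

theorem poly_inv {ε : K} (G : K[X]) (hu : G.eval ε ≠ 0) (c : K[X]) (D : ℕ) :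
    ∃ g : K[X], (X - C ε) ^ D ∣ c - g.comp ((X - C ε) * G) := by
  induction D with
  | zero => exact ⟨0, by simp⟩
  | succ D ih =>
    obtain ⟨g, e, he⟩ := ih
    refine ⟨g + C (e.eval ε / G.eval ε ^ D) * X ^ D, ?_⟩
    obtain ⟨e', he'⟩ : (X - C ε) ∣ e - C (e.eval ε / G.eval ε ^ D) * G ^ D := by
      rw [dvd_iff_isRoot, IsRoot.def]
      simp only [eval_sub, eval_mul, eval_C, eval_pow]
      field_simp; simp
    refine ⟨e', ?_⟩
    simp only [add_comp, mul_comp, C_comp, pow_comp, X_comp]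
    rw [mul_pow]
    linear_combination he + (X - C ε) ^ D * he'

theorem pT_fac (h2 : (2 : K) ≠ 0) (o : ℕ) {n : ℕ} (hn : (n : K) ≠ 0) {ε : K} (he : ε = 1 ∨ ε = -1) :
    ∃ G : K[X], pT K o n = (X - C ε) * G ∧ G.eval ε ≠ 0 := by
  have h1 : ε ^ (2 * n) = 1 := by rcases he with rfl | rfl <;> simp
  have h0 : ε ≠ 0 := by rintro rfl; rcases he with h | h <;> simp at h
  obtain ⟨r, hr⟩ : (X - C ε) ∣ (X ^ (2 * n) - 1 : K[X]) := by
    rw [dvd_iff_isRoot, IsRoot.def]; simp [h1]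
  refine ⟨X ^ ((o - 1) * n) * r, by rw [pT, hr]; ring, ?_⟩
  have h3 := congrArg (fun p => eval ε (derivative p)) hr
  simp only [derivative_sub, derivative_X_pow, derivative_one, derivative_mul, derivative_X, derivative_C, eval_add, eval_sub, eval_mul, eval_C, eval_pow, eval_X, eval_one, eval_zero, sub_zero, sub_self, zero_mul, add_zero, one_mul] at h3
  rw [eval_mul, ← h3]
  simp [h0, hn, h2]

theorem QS.poly (h2 : (2 : K) ≠ 0) {f : BilinForm K V} {φ : End K V} {o n : ℕ} (h : QS f φ o n) {ε : K} (he : ε = 1 ∨ ε = -1)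
    (D : ℕ) (c : K[X]) : ∃ g : K[X], ∀ x, aeval φ ((X - C ε) ^ D) x = 0 → aeval φ c x = aeval (Tm o n φ) g x := by
  obtain ⟨G, hG, hu⟩ := pT_fac h2 o h.nK he
  obtain ⟨g, e, he⟩ := poly_inv G hu c D
  refine ⟨g, fun x hx => ?_⟩
  rw [Tm, hG, ← aeval_comp, ← sub_eq_zero, ← LinearMap.sub_apply, ← map_sub, he, mul_comm, map_mul, mul_apply, hx, map_zero]

end

section
theorem mapQ_aeval {M : End K V} {U : Submodule K V} (hU : ∀ x ∈ U, M x ∈ U) (k : K[X]) (hk : U ≤ U.comap (aeval M k)) :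
    U.mapQ U (aeval M k) hk = aeval (U.mapQ U M hU) k := by
  ext x
  simp only [LinearMap.comp_apply, Submodule.mkQ_apply, Submodule.mapQ_apply]
  induction k using Polynomial.induction_on' with
  | add p q hp hq =>
    have := hp (inv_aeval hU p)
    have := hq (inv_aeval hU q)
    simp_all
  | monomial n a =>
    simp only [aeval_monomial, mul_apply, Module.algebraMap_end_apply, Submodule.Quotient.mk_smul]
    congr 1
    clear hk
    induction n with
    | zero => simp
    | succ n ih => rw [pow_succ', pow_succ', mul_apply, mul_apply, ← ih]; rfl

theorem norm_lemma {r : K[X]} (hr : Irreducible r) : ∀ (m : ℕ) (V : Type _) [AddCommGroup V] [Module K V] [FiniteDimensional K V]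
    (hm : finrank K V = m) (M : End K V) (hM : IsNilpotent (aeval M r)),
    ∃ j, finrank K V = j * r.natDegree ∧ ∀ k : K[X], det (aeval M k) = (Algebra.norm K (AdjoinRoot.mk r k)) ^ j := by
  haveI : Fact (Irreducible r) := ⟨hr⟩
  haveI : FiniteDimensional K (AdjoinRoot r) := (AdjoinRoot.powerBasis hr.ne_zero).finite
  intro m
  induction m using Nat.strong_induction_on with
  | _ m ih =>
  intro V _ _ _ hm M hM
  rcases subsingleton_or_nontrivial V with hV | hV
  · refine ⟨0, by simp [finrank_zero_of_subsingleton], fun k => ?_⟩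
    rw [pow_zero, Subsingleton.elim (aeval M k) LinearMap.id, LinearMap.det_id]
  obtain ⟨D, hD1, hD⟩ := top_index hM
  obtain ⟨x, hx⟩ : ∃ x, (aeval M r ^ D) x ≠ 0 := by
    by_contra! h; exact hD (LinearMap.ext h)
  obtain ⟨v, hv⟩ : ∃ v, v = (aeval M r ^ D) x := ⟨_, rfl⟩
  rw [← hv] at hx
  have hv0 : aeval M r v = 0 := by rw [hv, ← mul_apply, ← pow_succ', hD1]; rfl
  obtain ⟨W, hWd⟩ : ∃ W, W = ker (aeval M r) := ⟨_, rfl⟩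
  have hW : ∀ x ∈ W, M x ∈ W := by
    intro x hx
    rw [hWd, mem_ker] at hx ⊢
    have := (aeval_comm M r X).eq
    rw [aeval_X] at this
    rw [← mul_apply, this, mul_apply, hx, map_zero]
  have hz : ∀ a ∈ Ideal.span {r}, aeval (M.restrict hW) a = 0 := by
    intro a ha
    obtain ⟨b, rfl⟩ := Ideal.mem_span_singleton.1 ha
    have : aeval (M.restrict hW) r = 0 := by
      ext y; rw [raeval]; have := hWd.le y.2; rw [mem_ker] at this; rw [this]; rfl
    rw [map_mul, this, zero_mul]
  obtain ⟨L, hL⟩ : ∃ L : AdjoinRoot r →ₐ[K] End K W, ∀ k, L (AdjoinRoot.mk r k) = aeval (M.restrict hW) k :=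
    ⟨Ideal.Quotient.liftₐ _ (aeval (M.restrict hW)) hz, fun k => rfl⟩
  have hvW : v ∈ W := by rw [hWd]; exact hv0
  obtain ⟨l, hl⟩ : ∃ l : AdjoinRoot r →ₗ[K] V, ∀ a, l a = (L a ⟨v, hvW⟩ : W) :=
    ⟨W.subtype.comp ((LinearMap.applyₗ ⟨v, hvW⟩).comp L.toLinearMap), fun a => rfl⟩
  have hinj : Function.Injective l := by
    rw [← ker_eq_bot, LinearMap.ker_eq_bot']
    intro a ha
    by_contra h0
    rw [hl] at ha
    have h1 : L a ⟨v, hvW⟩ = 0 := Subtype.ext ha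
    have h2 : (L a⁻¹ * L a) ⟨v, hvW⟩ = ⟨v, hvW⟩ := by rw [← map_mul, inv_mul_cancel₀ h0, map_one]; rfl
    rw [mul_apply, h1, map_zero] at h2
    exact hx (congrArg Subtype.val h2).symm
  have hlk : ∀ k a, aeval M k (l a) = l (AdjoinRoot.mk r k * a) := by
    intro k a
    rw [hl, hl, map_mul, hL, mul_apply, raeval]
  have hU : ∀ x ∈ range l, M x ∈ range l := by
    rintro _ ⟨a, rfl⟩
    have := hlk X a
    rw [aeval_X] at this
    exact ⟨_, this.symm⟩
  have hfr : finrank K (range l) = r.natDegree := by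
    rw [LinearMap.finrank_range_of_inj hinj, (AdjoinRoot.powerBasis hr.ne_zero).finrank, AdjoinRoot.powerBasis_dim]
  have hq := Submodule.finrank_quotient_add_finrank (range l)
  obtain ⟨j, hj, hd⟩ := ih (finrank K (V ⧸ range l)) (by have := hr.natDegree_pos; omega) _ rfl ((range l).mapQ _ M hU) (by
    obtain ⟨N, hN⟩ := hM
    refine ⟨N, ?_⟩
    rw [← map_pow, ← mapQ_aeval hU _ (inv_aeval hU _)]
    ext x
    simp [hN])
  refine ⟨j + 1, by rw [← hq, hj, hfr]; ring, fun k => ?_⟩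
  rw [LinearMap.det_eq_det_mul_det _ _ (inv_aeval hU k), mapQ_aeval hU, hd, pow_succ']
  congr 1
  rw [Algebra.norm_apply, ← LinearMap.det_conj _ (LinearEquiv.ofInjective l hinj)]
  congr 1
  ext ⟨_, a, rfl⟩
  have : (⟨l a, a, rfl⟩ : range l) = LinearEquiv.ofInjective l hinj a := rfl
  rw [this]
  simp [hlk]

def Jz (A : End K V) (d : ℕ) : Prop := ∀ x, (A ^ d) x = 0 → ∃ y, (A ^ (d - 1)) x = (A ^ d) y

theorem ker_inv {φ A : End K V} (h : Commute φ A) : ∀ x ∈ ker A, φ x ∈ ker A := by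
  intro x hx
  rw [mem_ker] at hx ⊢
  rw [← mul_apply, ← h.eq, mul_apply, hx, map_zero]

theorem I_fr [FiniteDimensional K V] (A : End K V) (j : ℕ) :
    finrank K ((ker (A ^ (j + 1))).map (A ^ j)) + finrank K (ker (A ^ j)) = finrank K (ker (A ^ (j + 1))) := by
  have := LinearMap.finrank_range_add_finrank_ker ((A ^ j).domRestrict (ker (A ^ (j + 1))))
  rw [← this, LinearMap.range_domRestrict]
  congr 1
  rw [LinearMap.ker_domRestrict]
  symm
  have hle : ker (A ^ j) ≤ ker (A ^ (j + 1)) := by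
    intro x hx
    rw [mem_ker] at hx ⊢
    rw [pow_succ', mul_apply, hx, map_zero]
  exact (Submodule.comapSubtypeEquivOfLe hle).finrank_eq

theorem I_le (A : End K V) (j : ℕ) :
    (ker (A ^ (j + 2))).map (A ^ (j + 1)) ≤ (ker (A ^ (j + 1))).map (A ^ j) := by
  rintro _ ⟨x, hx, rfl⟩
  refine ⟨A x, ?_, ?_⟩
  · show (A ^ (j + 1)) (A x) = 0
    rw [← mul_apply, ← pow_succ]; exact hx
  · rw [← mul_apply, ← pow_succ]

theorem I_dvd [FiniteDimensional K V] (φ : End K V) {p : K[X]} (hp : Irreducible p) (j : ℕ) :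
    p.natDegree ∣ finrank K ((ker (aeval φ p ^ (j + 1))).map (aeval φ p ^ j)) := by
  have hI : ∀ x ∈ (ker (aeval φ p ^ (j + 1))).map (aeval φ p ^ j), φ x ∈ (ker (aeval φ p ^ (j + 1))).map (aeval φ p ^ j) := by
    rintro _ ⟨x, hx, rfl⟩
    have c : ∀ i, Commute φ (aeval φ p ^ i) := fun i => by
      have := aeval_comm φ X (p ^ i); rwa [aeval_X, map_pow] at this
    refine ⟨φ x, ker_inv (c _) x hx, ?_⟩
    rw [← mul_apply, ← mul_apply, (c j).eq]
  obtain ⟨k, hk, -⟩ := norm_lemma hp _ _ rfl (φ.restrict hI) ⟨1, by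
    rw [pow_one]
    ext ⟨_, x, hx, rfl⟩
    rw [raeval]
    show aeval φ p ((aeval φ p ^ j) x) = 0
    rw [← mul_apply, ← pow_succ']; exact hx⟩
  exact ⟨k, by rw [hk, mul_comm]⟩

theorem edMult_of_Jz [FiniteDimensional K V] {φ : End K V} {p : K[X]} {d : ℕ} (hd : d ≠ 0) (h : Jz (aeval φ p) d) : edMult φ p d = 0 := by
  obtain ⟨d, rfl⟩ := Nat.exists_eq_succ_of_ne_zero hd
  have h1 := I_fr (aeval φ p) d
  have h2 := I_fr (aeval φ p) (d + 1)
  have h3 : finrank K ((ker (aeval φ p ^ (d + 1))).map (aeval φ p ^ d)) ≤ finrank K ((ker (aeval φ p ^ (d + 1 + 1))).map (aeval φ p ^ (d + 1))) := by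
    apply Submodule.finrank_mono
    rintro _ ⟨x, hx, rfl⟩
    obtain ⟨y, hy⟩ := h x hx
    refine ⟨y, ?_, hy.symm⟩
    show (aeval φ p ^ (d + 1 + 1)) y = 0
    rw [pow_succ', mul_apply, ← hy, ← mul_apply]
    simp only [Nat.succ_eq_add_one, Nat.add_sub_cancel]
    rw [← pow_succ']; exact hx
  rw [edMult]
  show (2 * finrank K (ker (aeval φ p ^ (d + 1))) - finrank K (ker (aeval φ p ^ (d + 1 + 1))) - finrank K (ker (aeval φ p ^ d))) / _ = 0
  rw [show 2 * finrank K (ker (aeval φ p ^ (d + 1))) - finrank K (ker (aeval φ p ^ (d + 1 + 1))) - finrank K (ker (aeval φ p ^ d)) = 0 by omega]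
  simp

theorem Jz_of_edMult [FiniteDimensional K V] {φ : End K V} {p : K[X]} (hp : Irreducible p) {d : ℕ} (hd : d ≠ 0) (h : edMult φ p d = 0) : Jz (aeval φ p) d := by
  obtain ⟨d, rfl⟩ := Nat.exists_eq_succ_of_ne_zero hd
  have h1 := I_fr (aeval φ p) d
  have h2 := I_fr (aeval φ p) (d + 1)
  have h3 := Nat.dvd_sub (I_dvd φ hp d) (I_dvd φ hp (d + 1))
  rw [edMult] at h
  change (2 * finrank K (ker (aeval φ p ^ (d + 1))) - finrank K (ker (aeval φ p ^ (d + 1 + 1))) - finrank K (ker (aeval φ p ^ d))) / _ = 0 at h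
  rw [show 2 * finrank K (ker (aeval φ p ^ (d + 1))) - finrank K (ker (aeval φ p ^ (d + 1 + 1))) - finrank K (ker (aeval φ p ^ d)) =
    finrank K ((ker (aeval φ p ^ (d + 1))).map (aeval φ p ^ d)) - finrank K ((ker (aeval φ p ^ (d + 1 + 1))).map (aeval φ p ^ (d + 1))) by omega] at h
  have h5 := Nat.eq_zero_of_dvd_of_lt h3 ((Nat.div_eq_zero_iff.1 h).resolve_left hp.natDegree_pos.ne')
  have h6 := Submodule.eq_of_le_of_finrank_le (I_le (aeval φ p) d) (by rw [show d + 2 = d + 1 + 1 from rfl]; omega)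
  intro x hx
  have : (aeval φ p ^ d) x ∈ (ker (aeval φ p ^ (d + 2))).map (aeval φ p ^ (d + 1)) := by
    rw [h6]; exact ⟨x, hx, rfl⟩
  obtain ⟨y, -, hy⟩ := this
  exact ⟨y, hy.symm⟩

theorem Jz_inj {A : End K V} (h : ∀ x, A x = 0 → x = 0) (d : ℕ) : Jz A d := by
  intro x hx
  have : ∀ d x, (A ^ d) x = 0 → x = 0 := by
    intro d
    induction d with
    | zero => intro x hx; exact hx
    | succ d ih => intro x hx; rw [pow_succ', mul_apply] at hx; exact ih x (h _ hx)
  rw [this d x hx]; exact ⟨0, by simp⟩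

/-- coprime splitting -/
theorem cop_fix (φ : End K V) {p c : K[X]} (h : IsCoprime p c) {x : V} (hx : aeval φ p x = 0) : ∃ s : K[X], aeval φ (s * c) x = x := by
  obtain ⟨u, v, huv⟩ := h
  refine ⟨v, ?_⟩
  have := congrArg (fun k => aeval φ k x) huv
  simpa [map_add, map_mul, mul_apply, hx] using this

theorem ap (φ : End K V) (p q : K[X]) (x : V) : aeval φ (p * q) x = aeval φ p (aeval φ q x) := by
  rw [map_mul]; rfl

theorem Jz_mul {φ : End K V} {p c : K[X]} (h : IsCoprime p c) {d : ℕ} (hd : d ≠ 0) (h1 : Jz (aeval φ p) d) (h2 : Jz (aeval φ c) d) :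
    Jz (aeval φ (p * c)) d := by
  have key : ∀ (p c : K[X]), IsCoprime p c → Jz (aeval φ p) d → ∀ x, aeval φ (p ^ d) x = 0 → ∃ y, aeval φ ((p * c) ^ (d - 1)) x = aeval φ ((p * c) ^ d) y := by
    intro p c h h1 x hx
    rw [map_pow] at hx
    obtain ⟨y, hy⟩ := h1 x hx
    rw [← map_pow, ← map_pow] at hy
    rw [← map_pow] at hx
    have hy' : aeval φ (p ^ (d + 1)) y = 0 := by
      rw [pow_succ', ap, ← hy, ← ap, ← pow_succ', Nat.sub_add_cancel (Nat.pos_of_ne_zero hd), hx]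
    obtain ⟨s, hs⟩ := cop_fix φ (h.pow_left (m := d + 1)) hy'
    refine ⟨aeval φ s y, ?_⟩
    rw [mul_pow, mul_comm, ap, hy, ← ap]
    conv_lhs => rw [← hs]
    rw [← ap, ← ap]
    obtain ⟨d, rfl⟩ := Nat.exists_eq_succ_of_ne_zero hd
    congr 2
    simp only [Nat.succ_eq_add_one, Nat.add_sub_cancel]; ring
  intro x hx
  rw [← map_pow] at hx
  obtain ⟨u, v, huv⟩ := h.pow (m := d) (n := d)
  obtain ⟨y1, e1⟩ := key c p h.symm h2 (aeval φ (u * p ^ d) x) (by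
    rw [← ap, show c ^ d * (u * p ^ d) = u * (p * c) ^ d by rw [mul_pow]; ring, ap, hx, map_zero])
  obtain ⟨y2, e2⟩ := key p c h h1 (aeval φ (v * c ^ d) x) (by
    rw [← ap, show p ^ d * (v * c ^ d) = v * (p * c) ^ d by rw [mul_pow]; ring, ap, hx, map_zero])
  refine ⟨y1 + y2, ?_⟩
  rw [← map_pow, ← map_pow, map_add, ← e2, mul_comm p c, ← e1, ← map_add, ← LinearMap.add_apply, ← map_add, huv, map_one]; rfl

theorem Jz_div {φ : End K V} {p c : K[X]} (h : IsCoprime p c) {d : ℕ} (hd : d ≠ 0) (h1 : Jz (aeval φ (p * c)) d) : Jz (aeval φ p) d := by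
  intro x hx
  rw [← map_pow] at hx
  obtain ⟨y, hy⟩ := h1 x (by rw [← map_pow, mul_pow, mul_comm, ap, hx, map_zero])
  rw [← map_pow, ← map_pow] at hy
  have h3 : aeval φ p (aeval φ (p ^ (d - 1)) x) = 0 := by
    rw [← ap, ← pow_succ', Nat.sub_add_cancel (Nat.pos_of_ne_zero hd), hx]
  obtain ⟨s, hs⟩ := cop_fix φ (h.pow_right (n := d - 1)) h3
  refine ⟨aeval φ (s * c ^ d) y, ?_⟩
  rw [← map_pow, ← map_pow, ← hs, ← ap, show s * c ^ (d - 1) * p ^ (d - 1) = s * (p * c) ^ (d - 1) by rw [mul_pow]; ring, ap, hy, ← ap, ← ap]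
  congr 2; rw [mul_pow]; ring

theorem Jz_link [FiniteDimensional K V] {f : BilinForm K V} (hs : f.IsSymm) (hf : f.Nondegenerate) {T : End K V} (hT : Skew f T) {d : ℕ} :
    Jz T d ↔ ∀ x y, (T ^ d) x = 0 → (T ^ d) y = 0 → f x ((T ^ (d - 1)) y) = 0 := by
  constructor
  · intro h x y hx hy
    obtain ⟨z, hz⟩ := h y hy
    have := hT.pow d x z
    rw [hx, map_zero, LinearMap.zero_apply] at this
    rw [hz]
    rcases mul_eq_zero.1 this.symm with h | h
    · exact absurd h (pow_ne_zero _ (by simp))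
    · exact h
  · intro h y hy
    have hr : f.IsRefl := hs.isRefl
    have : (T ^ (d - 1)) y ∈ f.orthogonal (f.orthogonal (range (T ^ d))) := by
      rw [LinearMap.BilinForm.mem_orthogonal_iff]
      intro x hx
      rw [LinearMap.BilinForm.mem_orthogonal_iff] at hx
      refine h x y ?_ hy
      apply hf.1
      intro z
      rw [hT.pow, hs.eq]
      rw [show f ((T ^ d) z) x = 0 from hx _ ⟨z, rfl⟩, mul_zero]
    rw [LinearMap.BilinForm.orthogonal_orthogonal hf hr] at this
    obtain ⟨z, hz⟩ := this
    exact ⟨z, hz.symm⟩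

theorem rho_sep (h2 : (2 : K) ≠ 0) {n : ℕ} (hn : (n : K) ≠ 0) : (X ^ (2 * n) - 1 : K[X]).Separable := by
  have := separable_X_pow_sub_C (F := K) (n := 2 * n) 1 (by push_cast; exact mul_ne_zero h2 hn) one_ne_zero
  simpa using this

namespace QS
variable {f : BilinForm K V} {φ : End K V} {o n : ℕ}

theorem inj (h : QS f φ o n) (x : V) (hx : φ x = 0) : x = 0 := by
  have := congrArg (fun g : End K V => g x) h.pm
  simp only [mul_apply, hx, map_zero] at this
  exact this.symm

theorem copX (n : ℕ) (hn : n ≠ 0) (m : ℕ) : IsCoprime (X ^ m : K[X]) (X ^ (2 * n) - 1) := by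
  apply IsCoprime.pow_left
  refine ⟨X ^ (2 * n - 1), -1, ?_⟩
  rw [← pow_succ, show 2 * n - 1 + 1 = 2 * n by omega]; ring

theorem aeval_inj (h : QS f φ o n) {p : K[X]} (hp : IsCoprime p (pT K o n)) (x : V) (hx : aeval φ p x = 0) : x = 0 := by
  obtain ⟨N, hN⟩ := h.nil
  obtain ⟨s, hs⟩ := cop_fix φ (hp.pow_right (n := N)) hx
  rw [ap, map_pow] at hs
  rw [Tm] at hN
  rw [hN] at hs
  simpa using hs.symm

/-- irreducible `p`: either injective or splits off `pT`. -/
theorem cases (h2 : (2 : K) ≠ 0) (h : QS f φ o n) {p : K[X]} (hp : Irreducible p) :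
    (∀ x, aeval φ p x = 0 → x = 0) ∨ ∃ c, pT K o n = p * c ∧ IsCoprime p c := by
  by_cases hX : p ∣ X
  · left
    obtain ⟨c, hc⟩ := hX
    intro x hx
    apply h.inj
    rw [← aeval_X (R := K) φ, hc, mul_comm, ap, hx, map_zero]
  by_cases hT : p ∣ pT K o n
  · right
    have h3 : p ∣ X ^ (2 * n) - 1 := by
      rcases hp.prime.dvd_or_dvd hT with h | h
      · exact absurd (hp.prime.dvd_of_dvd_pow h) hX
      · exact h
    obtain ⟨c, hc⟩ := h3
    refine ⟨X ^ ((o - 1) * n) * c, by rw [pT, hc]; ring, ?_⟩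
    have hs := rho_sep h2 h.nK
    rw [hc] at hs
    exact IsCoprime.mul_right ((hp.coprime_iff_not_dvd.2 hX).pow_right) hs.isCoprime
  · left
    exact h.aeval_inj (hp.coprime_iff_not_dvd.2 hT)

theorem Jz_p (h2 : (2 : K) ≠ 0) (h : QS f φ o n) {p : K[X]} (hp : Irreducible p) {d : ℕ} (hd : d ≠ 0) (hj : Jz (Tm o n φ) d) : Jz (aeval φ p) d := by
  rcases h.cases h2 hp with h | ⟨c, hc, hcp⟩
  · exact Jz_inj h d
  · rw [Tm, hc] at hj; exact Jz_div hcp hd hj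

theorem Jz_T (h2 : (2 : K) ≠ 0) (h : QS f φ o n) {d : ℕ} (hd : d ≠ 0) (hj : ∀ p : K[X], p.Monic → Irreducible p → Jz (aeval φ p) d) : Jz (Tm o n φ) d := by
  have key : ∀ a : K[X], a.Separable → Jz (aeval φ a) d := by
    intro a
    induction a using WfDvdMonoid.induction_on_irreducible with
    | zero => intro h; exact absurd h not_separable_zero
    | unit u hu =>
      intro _
      apply Jz_inj
      intro x hx
      obtain ⟨s, hs⟩ := cop_fix φ (c := 0) (by rwa [isCoprime_zero_right]) hx
      simpa using hs.symm
    | mul a i ha hi ih =>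
      intro hs
      refine Jz_mul hs.isCoprime hd ?_ (ih hs.of_mul_right)
      have h1 := hj _ (monic_mul_leadingCoeff_inv hi.ne_zero) (irreducible_mul_leadingCoeff_inv.2 hi)
      refine Jz_div ⟨0, C i.leadingCoeff, ?_⟩ hd h1
      rw [zero_mul, zero_add, ← C_mul, mul_inv_cancel₀ (leadingCoeff_ne_zero.2 hi.ne_zero), C_1]
  exact Jz_mul (copX n h.npos _) hd (Jz_inj (fun x hx => by
    have h1 : ∀ m x, (φ ^ m) x = 0 → x = 0 := by
      intro m
      induction m with
      | zero => intro x hx; exact hx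
      | succ m ih => intro x hx; rw [pow_succ', mul_apply] at hx; exact ih x (h.inj _ hx)
    rw [map_pow, aeval_X] at hx; exact h1 _ x hx) d) (key _ (rho_sep h2 h.nK))

theorem ed_of_HZ [FiniteDimensional K V] (h2 : (2 : K) ≠ 0) (h : QS f φ o n) (hz : HZ f (Tm o n φ)) {p : K[X]} (hp : Irreducible p) {d : ℕ} (hd : Odd d) : edMult φ p d = 0 :=
  edMult_of_Jz hd.pos.ne' (h.Jz_p h2 hp hd.pos.ne' ((Jz_link h.symm h.nd h.skew).2 (hz d hd)))

theorem HZ_of_ed [FiniteDimensional K V] (h2 : (2 : K) ≠ 0) (h : QS f φ o n) (hz : ∀ (p : K[X]) (d : ℕ), p.Monic → Irreducible p → Odd d → edMult φ p d = 0) : HZ f (Tm o n φ) :=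
  fun d hd => (Jz_link h.symm h.nd h.skew).1 (h.Jz_T h2 hd.pos.ne' fun p hp hpi => Jz_of_edMult hpi hd.pos.ne' (hz p d hp hpi hd))
end QS

end

section
noncomputable def Wb (o n : ℕ) (φ : End K V) (D : ℕ) (Y : Submodule K V) : Submodule K V := range (Psi (Tm o n φ) (D + 1) Y)

section tb
variable [FiniteDimensional K V] {f : BilinForm K V} {φ : End K V} {o n D : ℕ} {Y : Submodule K V}

theorem Wb_mem (hD : ∀ x ∈ Y, ((Tm o n φ) ^ (D + 1)) x = 0) (i : ℕ) {x : V} (hx : x ∈ Y) : ((Tm o n φ) ^ i) x ∈ Wb o n φ D Y := by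
  by_cases hi : i < D + 1
  · exact ⟨Pi.single ⟨i, hi⟩ ⟨x, hx⟩, Psi_single _ _ _ _ _⟩
  · rw [End.pow_map_zero_of_le (by omega) (hD x hx)]; exact zero_mem _

theorem Wb_le {U : Submodule K V} (h : ∀ i, ∀ x ∈ Y, ((Tm o n φ) ^ i) x ∈ U) : Wb o n φ D Y ≤ U := by
  rintro _ ⟨u, rfl⟩
  rw [Psi_apply]
  exact U.sum_mem fun i _ => h i _ (u i).2

theorem Wb_ext (hD : ∀ x ∈ Y, ((Tm o n φ) ^ (D + 1)) x = 0) {M : Type*} [AddCommGroup M] [Module K M] {A B : Wb o n φ D Y →ₗ[K] M}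
    (h : ∀ i x (hx : x ∈ Y), A ⟨_, Wb_mem hD i hx⟩ = B ⟨_, Wb_mem hD i hx⟩) : A = B := by
  have h1 : Wb o n φ D Y ≤ (LinearMap.eqLocus A B).map (Wb o n φ D Y).subtype :=
    Wb_le fun i x hx => ⟨⟨_, Wb_mem hD i hx⟩, h i x hx, rfl⟩
  ext w
  obtain ⟨w', hw', e⟩ := h1 w.2
  rw [← Subtype.ext e]; exact hw'

theorem Wb_T (hD : ∀ x ∈ Y, ((Tm o n φ) ^ (D + 1)) x = 0) : ∀ x ∈ Wb o n φ D Y, Tm o n φ x ∈ Wb o n φ D Y := by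
  have : Wb o n φ D Y ≤ (Wb o n φ D Y).comap (Tm o n φ) := Wb_le fun i x hx => by
    rw [Submodule.mem_comap, ← mul_apply, ← pow_succ']; exact Wb_mem hD _ hx
  exact this

theorem Wb_poly (h2 : (2 : K) ≠ 0) (h : QS f φ o n) {ε : K} (he : ε = 1 ∨ ε = -1) {m : ℕ}
    (hk : ∀ x ∈ Y, aeval φ ((X - C ε) ^ m) x = 0) : ∃ g : K[X], ∀ x ∈ Wb o n φ D Y, φ x = aeval (Tm o n φ) g x := by
  obtain ⟨g, hg⟩ := h.poly h2 he m X
  refine ⟨g, fun x hx => ?_⟩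
  rw [aeval_X] at hg
  apply hg
  have : Wb o n φ D Y ≤ ker (aeval φ ((X - C ε) ^ m)) := Wb_le fun i x hx => by
    rw [mem_ker, Tm, ← map_pow, ← ap, mul_comm, ap, hk x hx, map_zero]
  exact this hx

theorem Wb_phi (h2 : (2 : K) ≠ 0) (h : QS f φ o n) (hD : ∀ x ∈ Y, ((Tm o n φ) ^ (D + 1)) x = 0) {ε : K} (he : ε = 1 ∨ ε = -1) {m : ℕ}
    (hk : ∀ x ∈ Y, aeval φ ((X - C ε) ^ m) x = 0) : ∀ x ∈ Wb o n φ D Y, φ x ∈ Wb o n φ D Y := by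
  obtain ⟨g, hg⟩ := Wb_poly (D := D) h2 h he hk
  intro x hx
  rw [hg x hx]
  exact inv_aeval (Wb_T hD) g x hx

theorem Wb_nd (h : QS f φ o n) (hD : ∀ x ∈ Y, ((Tm o n φ) ^ (D + 1)) x = 0)
    (hX : ∀ x : Y, (∀ y : Y, f x ((Tm o n φ ^ D) y) = 0) → x = 0) : (f.restrict (Wb o n φ D Y)).Nondegenerate :=
  emb_nd _ (Psi_nd h.symm h.skew hD hX)

theorem Wb_fr (h : QS f φ o n) (hD : ∀ x ∈ Y, ((Tm o n φ) ^ (D + 1)) x = 0)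
    (hX : ∀ x : Y, (∀ y : Y, f x ((Tm o n φ ^ D) y) = 0) → x = 0) : finrank K (Wb o n φ D Y) = (D + 1) * finrank K Y := by
  rw [Wb, emb_finrank _ (Psi_nd h.symm h.skew hD hX), Module.finrank_pi_fintype]; simp

theorem semi_poly {β T S : End K V} (h : β * T = S * β) (g : K[X]) : β * aeval T g = aeval S g * β := by
  induction g using Polynomial.induction_on' with
  | add p q hp hq => rw [map_add, map_add, mul_add, add_mul, hp, hq]
  | monomial n a =>
    have : SemiconjBy β T S := h
    rw [aeval_monomial, aeval_monomial, ← mul_assoc, ← Algebra.commutes, mul_assoc, (this.pow_right n).eq, mul_assoc]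

/-- reversing from anticommuting with `T`. -/
theorem rev_of_anti {β T : End K V} (hf : f.Nondegenerate) (hg : Iso f φ) (hT : Skew f T) {g : K[X]} (hp : φ = aeval T g) (hb : β * T = -T * β) :
    φ * β * φ = β := by
  have h1 : aeval (-T) g * φ = 1 := by
    ext z
    rw [← sub_eq_zero]
    apply hf.2
    intro x
    rw [map_sub, mul_apply, ← adj_of (A := T) (B := -T) (fun x y => by rw [hT]; simp) g, ← hp, hg]
    simp
  have h3 : Commute φ (aeval (-T) g) := by
    have : aeval (-T) g = aeval T (g.comp (-X)) := by rw [aeval_comp]; simp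
    rw [this, hp]; exact aeval_comm _ _ _
  rw [mul_assoc]
  conv_lhs => rw [hp, semi_poly hb, ← hp, ← mul_assoc, h3.eq, h1, one_mul]

theorem Wb_rev (h2 : (2 : K) ≠ 0) (h : QS f φ o n) (hD : ∀ x ∈ Y, ((Tm o n φ) ^ (D + 1)) x = 0)
    (hX : ∀ x : Y, (∀ y : Y, f x ((Tm o n φ ^ D) y) = 0) → x = 0) {ε : K} (he : ε = 1 ∨ ε = -1) {m : ℕ}
    (hk : ∀ x ∈ Y, aeval φ ((X - C ε) ^ m) x = 0) (s : End K V) (hsY : ∀ x ∈ Y, s x ∈ Y) (hss : ∀ x ∈ Y, s (s x) = x)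
    (hsf : ∀ i, ∀ x ∈ Y, ∀ y ∈ Y, f (s x) ((Tm o n φ ^ i) (s y)) = (-1) ^ i * f x ((Tm o n φ ^ i) y))
    (hW : ∀ x ∈ Wb o n φ D Y, φ x ∈ Wb o n φ D Y) :
    ∃ β : End K (Wb o n φ D Y), Iso (f.restrict (Wb o n φ D Y)) β ∧ β * β = 1 ∧ φ.restrict hW * β * φ.restrict hW = β ∧
      ∀ i x (hx : x ∈ Y), (β ⟨_, Wb_mem hD i hx⟩ : V) = (-1 : K) ^ i • (Tm o n φ ^ i) (s x) := by
  have hinj := emb_inj _ (Psi_nd h.symm h.skew hD hX)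
  obtain ⟨β, hβ⟩ : ∃ β : End K (Wb o n φ D Y), ∀ i x (hx : x ∈ Y), (β ⟨_, Wb_mem hD i hx⟩ : V) = (-1 : K) ^ i • (Tm o n φ ^ i) (s x) := by
    let e : (Fin (D + 1) → Y) ≃ₗ[K] Wb o n φ D Y := LinearEquiv.ofInjective (Psi (Tm o n φ) (D + 1) Y) hinj
    let R : End K (Fin (D + 1) → Y) := LinearMap.pi fun i => (-1 : K) ^ (i : ℕ) • (s.restrict hsY ∘ₗ LinearMap.proj i)
    refine ⟨(e : _ →ₗ[K] _) ∘ₗ R ∘ₗ (e.symm : _ →ₗ[K] _), fun i x hx => ?_⟩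
    by_cases hi : i < D + 1
    · have h1 : (⟨_, Wb_mem hD i hx⟩ : Wb o n φ D Y) = e (Pi.single ⟨i, hi⟩ ⟨x, hx⟩) := Subtype.ext (Psi_single (Tm o n φ) (D + 1) Y ⟨i, hi⟩ ⟨x, hx⟩).symm
      have h3 : R (Pi.single ⟨i, hi⟩ ⟨x, hx⟩) = Pi.single ⟨i, hi⟩ ((-1 : K) ^ i • s.restrict hsY ⟨x, hx⟩) := by
        ext j
        by_cases hj : j = ⟨i, hi⟩
        · subst hj; simp [R]
        · simp [R, Pi.single_eq_of_ne hj]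
      rw [h1, LinearMap.comp_apply, LinearMap.comp_apply, LinearEquiv.coe_coe, LinearEquiv.coe_coe, e.symm_apply_apply, h3]
      refine (Psi_single (Tm o n φ) (D + 1) Y ⟨i, hi⟩ _).trans ?_
      rw [Submodule.coe_smul, map_smul]; rfl
    · have h1 : (⟨_, Wb_mem hD i hx⟩ : Wb o n φ D Y) = 0 := Subtype.ext (End.pow_map_zero_of_le (by omega) (hD x hx))
      rw [h1, map_zero, End.pow_map_zero_of_le (by omega) (hD _ (hsY x hx))]; simp
  obtain ⟨g, hg⟩ := Wb_poly (D := D) h2 h he hk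
  have hTs : (Tm o n φ).restrict (Wb_T hD) = Tm o n (φ.restrict hW) := (Tm_res hW o n).symm
  have hgen : ∀ i x (hx : x ∈ Y), β ⟨_, Wb_mem hD i hx⟩ = (-1 : K) ^ i • (⟨_, Wb_mem hD i (hsY x hx)⟩ : Wb o n φ D Y) := fun i x hx => Subtype.ext (hβ i x hx)
  have hiso : Iso (f.restrict (Wb o n φ D Y)) β := by
    have : (f.restrict (Wb o n φ D Y)).comp β β = f.restrict (Wb o n φ D Y) := by
      apply Wb_ext hD
      intro i x hx
      apply Wb_ext hD
      intro j y hy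
      rw [LinearMap.BilinForm.comp_apply, hgen i x hx, hgen j y hy]
      simp only [map_smul, LinearMap.smul_apply, smul_eq_mul]
      show (-1) ^ j * ((-1) ^ i * f ((Tm o n φ ^ i) (s x)) ((Tm o n φ ^ j) (s y))) = f ((Tm o n φ ^ i) x) ((Tm o n φ ^ j) y)
      have e3 : ∀ z, (Tm o n φ ^ i) ((Tm o n φ ^ j) z) = (Tm o n φ ^ (i + j)) z := fun z => by rw [pow_add]; rfl
      rw [h.skew.pow, h.skew.pow, e3, e3, hsf _ x hx y hy, pow_add]
      have e1 : ((-1 : K) ^ i) * (-1) ^ i = 1 := by rw [← mul_pow]; simp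
      have e2 : ((-1 : K) ^ j) * (-1) ^ j = 1 := by rw [← mul_pow]; simp
      obtain ⟨z, hz⟩ : ∃ z, z = f x ((Tm o n φ ^ (i + j)) y) := ⟨_, rfl⟩
      rw [← hz]
      linear_combination z * ((-1 : K) ^ j * (-1) ^ j * (-1) ^ i) * e1 + z * (-1) ^ i * e2
    intro x y
    exact LinearMap.congr_fun (LinearMap.congr_fun this x) y
  refine ⟨β, hiso, ?_, ?_, hβ⟩
  · apply Wb_ext hD
    intro i x hx
    rw [mul_apply, hgen i x hx, map_smul, hgen i _ (hsY x hx), smul_smul, ← mul_pow]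
    apply Subtype.ext
    simp [hss x hx]
  · refine rev_of_anti (f := f.restrict (Wb o n φ D Y)) (T := (Tm o n φ).restrict (Wb_T hD)) (g := g) (Wb_nd h hD hX) (h.iso.restrict hW) (h.skew.restrict _) ?_ ?_
    · ext w; rw [raeval]; exact hg w w.2
    · apply Wb_ext hD
      intro i x hx
      have e1 : ∀ (x : V) (hx : x ∈ Y), (Tm o n φ).restrict (Wb_T hD) ⟨_, Wb_mem hD i hx⟩ = ⟨_, Wb_mem hD (i + 1) hx⟩ := fun x hx => Subtype.ext (by
        show Tm o n φ ((Tm o n φ ^ i) x) = (Tm o n φ ^ (i + 1)) x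
        rw [pow_succ', mul_apply])
      rw [mul_apply, e1 x hx, hgen _ x hx, mul_apply, hgen _ x hx, map_smul, LinearMap.neg_apply, e1 _ (hsY x hx), pow_succ]
      simp
end tb

def oneB (c : K) : BilinForm K K := c • LinearMap.mul K K
theorem oneB_apply (c x y : K) : oneB c x y = c * (x * y) := rfl
theorem oneB_symm (c : K) : (oneB c).IsSymm := ⟨fun x y => by simp [oneB_apply, mul_comm]⟩
theorem oneB_nd {c : K} (hc : c ≠ 0) : (oneB c).Nondegenerate := nd_of_sep (oneB_symm c) fun x hx => by
  simpa [oneB_apply, hc] using hx 1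

theorem oneB_nu [Finite K] (h4 : ¬ IsSquare (-1 : K)) {c a : K} (hc : c ≠ 0) (ha : a ≠ 0) : nu (oneB c) a = qc (-a) * qc c := by
  haveI : Unique (Fin (finrank K K)) := by rw [finrank_self]; infer_instance
  rw [nu_gram h4 (oneB_symm c) (oneB_nd hc) ha ((Basis.singleton (Fin 1) K).reindex (finCongr (finrank_self K).symm)), Matrix.det_unique]
  rw [show qc (-a) ^ finrank K K = qc (-a) by rw [finrank_self, pow_one]]
  simp [oneB_apply]

def prB {V' : Type*} [AddCommGroup V'] [Module K V'] (f : BilinForm K V) (f' : BilinForm K V') : BilinForm K (V × V') :=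
  f.comp (LinearMap.fst K V V') (LinearMap.fst K V V') + f'.comp (LinearMap.snd K V V') (LinearMap.snd K V V')

section pr
variable {V' : Type*} [AddCommGroup V'] [Module K V'] {f : BilinForm K V} {f' : BilinForm K V'}
theorem prB_apply (x y) : prB f f' x y = f x.1 y.1 + f' x.2 y.2 := rfl
theorem prB_symm (hs : f.IsSymm) (hs' : f'.IsSymm) : (prB f f').IsSymm := ⟨fun x y => by simp [prB_apply, hs.eq x.1 y.1, hs'.eq x.2 y.2]⟩
theorem prB_nd (hs : f.IsSymm) (hs' : f'.IsSymm) (hf : f.Nondegenerate) (hf' : f'.Nondegenerate) : (prB f f').Nondegenerate :=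
  nd_of_sep (prB_symm hs hs') fun x hx => by
    refine Prod.ext (hf.1 _ fun y => ?_) (hf'.1 _ fun y => ?_)
    · simpa [prB_apply] using hx (y, 0)
    · simpa [prB_apply] using hx (0, y)

theorem prB_chi [Finite K] [FiniteDimensional K V] [FiniteDimensional K V'] (h2 : (2 : K) ≠ 0) (hs : f.IsSymm) (hs' : f'.IsSymm) (hf : f.Nondegenerate) (hf' : f'.Nondegenerate)
    {g : End K V} {g' : End K V'} (hg : Iso f g) (hg' : Iso f' g') (a : K) :
    chi (prB f f') a (LinearMap.prodMap g g') = chi f a g * chi f' a g' := by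
  have e1 : (prB f f').comp (LinearMap.inl K V V') (LinearMap.inl K V V') = f := by ext x y; simp [prB_apply]
  have e2 : (prB f f').comp (LinearMap.inr K V V') (LinearMap.inr K V V') = f' := by ext x y; simp [prB_apply]
  have sp : Sp (prB f f') (range (LinearMap.inl K V V')) (range (LinearMap.inr K V V')) :=
    ⟨LinearMap.isCompl_range_inl_inr, by rintro _ ⟨x, rfl⟩ _ ⟨y, rfl⟩; simp [prB_apply]⟩
  have hG : Iso (prB f f') (LinearMap.prodMap g g') := fun x y => by simp [prB_apply, hg x.1 y.1, hg' x.2 y.2]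
  rw [chi_split h2 (prB_symm hs hs') (prB_nd hs hs' hf hf') sp hG (by rintro _ ⟨x, rfl⟩; exact ⟨g x, by simp⟩) (by rintro _ ⟨x, rfl⟩; exact ⟨g' x, by simp⟩),
    emb_chi (G := g) _ (by rw [e1]; exact hf) hG (by intro u; simp), emb_chi (G := g') _ (by rw [e2]; exact hf') hG (by intro u; simp), e1, e2]
end pr

end

section
noncomputable def Ob (o n : ℕ) (φ : End K V) (t : ℕ) (x : V) : Submodule K V := Wb o n φ (2 * t) (K ∙ x)

noncomputable def kap (K : Type*) [Field K] (t : ℕ) : ℤˣ := qc (∏ k : Fin (t + 1), (-1 : K) ^ (k : ℕ))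

section ob
variable [FiniteDimensional K V] {f : BilinForm K V} {φ : End K V} {o n t : ℕ} {ε : K} {x : V}

theorem IsO.T0 (h2 : (2 : K) ≠ 0) (h : QS f φ o n) (i : IsO f φ o n ε t x) : (Tm o n φ ^ (2 * t + 1)) x = 0 := by
  obtain ⟨G, hG, -⟩ := pT_fac h2 o h.nK i.sg
  rw [Tm, hG, ← map_pow, mul_pow, mul_comm, ap, i.kil, map_zero]

theorem IsO.D (h2 : (2 : K) ≠ 0) (h : QS f φ o n) (i : IsO f φ o n ε t x) : ∀ y ∈ K ∙ x, (Tm o n φ ^ (2 * t + 1)) y = 0 := by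
  intro y hy
  obtain ⟨c, rfl⟩ := mem_span_singleton.1 hy
  rw [map_smul, i.T0 h2 h, smul_zero]

theorem IsO.X (i : IsO f φ o n ε t x) : ∀ y : (K ∙ x), (∀ z : (K ∙ x), f y ((Tm o n φ ^ (2 * t)) z) = 0) → y = 0 := by
  rintro ⟨y, hy⟩ hz
  obtain ⟨c, rfl⟩ := mem_span_singleton.1 hy
  have := hz ⟨x, mem_span_singleton_self x⟩
  simp [i.ne] at this
  simp [this]

theorem IsO.k (i : IsO f φ o n ε t x) : ∀ y ∈ K ∙ x, aeval φ ((Polynomial.X - C ε) ^ (2 * t + 1)) y = 0 := by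
  intro y hy
  obtain ⟨c, rfl⟩ := mem_span_singleton.1 hy
  rw [map_smul, i.kil, smul_zero]

theorem IsO.mem (h2 : (2 : K) ≠ 0) (h : QS f φ o n) (i : IsO f φ o n ε t x) (j : ℕ) : (Tm o n φ ^ j) x ∈ Ob o n φ t x :=
  Wb_mem (i.D h2 h) j (mem_span_singleton_self x)

theorem IsO.inv (h2 : (2 : K) ≠ 0) (h : QS f φ o n) (i : IsO f φ o n ε t x) : ∀ y ∈ Ob o n φ t x, φ y ∈ Ob o n φ t x :=
  Wb_phi h2 h (i.D h2 h) i.sg i.k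

theorem IsO.ndW (h2 : (2 : K) ≠ 0) (h : QS f φ o n) (i : IsO f φ o n ε t x) : (f.restrict (Ob o n φ t x)).Nondegenerate :=
  Wb_nd h (i.D h2 h) i.X

theorem IsO.x0 (i : IsO f φ o n ε t x) : x ≠ 0 := by rintro rfl; exact i.ne (by simp)

theorem IsO.fr (h2 : (2 : K) ≠ 0) (h : QS f φ o n) (i : IsO f φ o n ε t x) : finrank K (Ob o n φ t x) = 2 * t + 1 := by
  rw [Ob, Wb_fr h (i.D h2 h) i.X, finrank_span_singleton i.x0, mul_one]

theorem IsO.ext (h2 : (2 : K) ≠ 0) (h : QS f φ o n) (i : IsO f φ o n ε t x) {M : Type*} [AddCommGroup M] [Module K M] {A B : Ob o n φ t x →ₗ[K] M}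
    (hh : ∀ j, A ⟨_, i.mem h2 h j⟩ = B ⟨_, i.mem h2 h j⟩) : A = B := by
  apply Wb_ext (i.D h2 h)
  intro j y hy
  obtain ⟨c, rfl⟩ := mem_span_singleton.1 hy
  have e : (⟨_, Wb_mem (i.D h2 h) j hy⟩ : Ob o n φ t x) = c • ⟨_, i.mem h2 h j⟩ := Subtype.ext (map_smul _ _ _)
  show A ⟨_, Wb_mem (i.D h2 h) j hy⟩ = B ⟨_, Wb_mem (i.D h2 h) j hy⟩
  rw [e, map_smul, map_smul, hh]

theorem Ob_le {U : Submodule K V} (h : ∀ i, (Tm o n φ ^ i) x ∈ U) : Ob o n φ t x ≤ U := Wb_le fun i y hy => by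
  obtain ⟨c, rfl⟩ := mem_span_singleton.1 hy
  rw [map_smul]; exact U.smul_mem _ (h i)

theorem IsO.li (h2 : (2 : K) ≠ 0) (h : QS f φ o n) (i : IsO f φ o n ε t x) : LinearIndependent K (fun j : Fin (2 * t + 1) => (Tm o n φ ^ (j : ℕ)) x) := by
  rw [Fintype.linearIndependent_iff]
  intro g hg j
  have h3 := emb_inj _ (Psi_nd h.symm h.skew (i.D h2 h) i.X)
  have h5 : (fun j => ⟨g j • x, Submodule.smul_mem _ _ (mem_span_singleton_self x)⟩ : Fin (2 * t + 1) → (K ∙ x)) = 0 := by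
    apply h3
    rw [Psi_apply, map_zero, ← hg]
    simp
  have := congrArg Subtype.val (congrFun h5 j)
  simpa [i.x0] using this

theorem IsO.chi [Finite K] (h4 : ¬ IsSquare (-1 : K)) (h : QS f φ o n) (i : IsO f φ o n ε t x) {G : End K (Ob o n φ t x)} (hG : Iso (f.restrict (Ob o n φ t x)) G)
    (χ : ℕ → K) (hχ : ∀ j, G ⟨_, i.mem (two_ne h4) h j⟩ = χ j • ⟨_, i.mem (two_ne h4) h j⟩) (h1 : χ t * χ t = 1) {a : K} (ha : a ≠ 0) :
    chi (f.restrict (Ob o n φ t x)) a G * Biref.chi (oneB (-((-1) ^ t * f x ((Tm o n φ ^ (2 * t)) x)))) a (χ t • (1 : End K K)) = qc (∏ k : Fin (t + 1), χ (t + k)) := by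
  have h2 := two_ne h4
  obtain ⟨c, hc⟩ : ∃ c, c = (-1) ^ t * f x ((Tm o n φ ^ (2 * t)) x) := ⟨_, rfl⟩
  have hc0 : -c ≠ 0 := by rw [hc]; simp [i.ne]
  rw [← hc]
  have hs1 := h.symm.restrict (Ob o n φ t x)
  have hI : Iso (oneB (-c)) (χ t • (1 : End K K)) := fun u v => by
    simp only [oneB_apply, LinearMap.smul_apply, smul_eq_mul, End.one_apply]; linear_combination (-c * u * v) * h1
  rw [← prB_chi h2 hs1 (oneB_symm _) (i.ndW h2 h) (oneB_nd hc0) hG hI]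
  have hli : LinearIndependent K (fun k : Fin (t + 1) => (Tm o n φ ^ (t + k : ℕ)) x) :=
    (i.li h2 h).comp (fun k : Fin (t + 1) => (⟨t + k, by omega⟩ : Fin (2 * t + 1))) fun a b hab => by
      simp at hab; exact Fin.ext hab
  let ι : (Fin (t + 1) → K) →ₗ[K] Ob o n φ t x × K := LinearMap.prod (Fintype.linearCombination K fun k => ⟨_, i.mem h2 h (t + k)⟩) (LinearMap.proj 0)
  have hι1 : ∀ u, ((ι u).1 : V) = ∑ k : Fin (t + 1), u k • (Tm o n φ ^ (t + k : ℕ)) x := fun u => by simp [ι, Fintype.linearCombination_apply]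
  have hιs : ∀ k (v : K), ι (Pi.single k v) = (v • ⟨_, i.mem h2 h (t + k)⟩, if k = 0 then v else 0) := fun k v => by
    simp [ι, Fintype.linearCombination_apply_single, Pi.single_apply, eq_comm]
  have hd : det (Matrix.toLin' (Matrix.diagonal fun k : Fin (t + 1) => χ (t + k))) = ∏ k : Fin (t + 1), χ (t + k) := by
    rw [LinearMap.det_toLin', Matrix.det_diagonal]
  rw [← hd]
  refine chi_lag h4 (prB_symm hs1 (oneB_symm _)) (prB_nd hs1 (oneB_symm _) (i.ndW h2 h) (oneB_nd hc0)) ι ?_ ?_ ?_ (fun u v => ?_) ?_ ha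
  · intro u v huv
    apply hli.fintypeLinearCombination_injective
    rw [Fintype.linearCombination_apply, Fintype.linearCombination_apply, ← hι1, ← hι1, huv]
  · intro u v
    rw [prB_apply]
    show f (ι u).1 (ι v).1 + oneB (-c) (u 0) (v 0) = 0
    have e0 : ∀ j, 2 * t < j → (Tm o n φ ^ j) x = 0 := fun j hj => End.pow_map_zero_of_le (by omega) (i.T0 h2 h)
    have e1 : ∀ k l : Fin (t + 1), f ((Tm o n φ ^ (t + k : ℕ)) x) ((Tm o n φ ^ (t + l : ℕ)) x) = if k = 0 ∧ l = 0 then c else 0 := by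
      intro k l
      rw [h.skew.pow, ← mul_apply, ← pow_add]
      split_ifs with hkl
      · rw [hkl.1, hkl.2, hc]; simp [two_mul]
      · rw [e0, map_zero, mul_zero]
        have : ¬ ((k : ℕ) = 0 ∧ (l : ℕ) = 0) := fun hh => hkl ⟨Fin.ext hh.1, Fin.ext hh.2⟩
        omega
    rw [hι1, hι1, map_sum f, LinearMap.sum_apply, Finset.sum_eq_single 0, map_sum, Finset.sum_eq_single 0]
    · simp only [map_smul, LinearMap.smul_apply, e1, smul_eq_mul, oneB_apply]; simp; ring
    · intro b _ hb; simp only [map_smul, LinearMap.smul_apply, e1, smul_eq_mul]; simp [hb]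
    · simp
    · intro b _ hb
      rw [map_sum]
      apply Finset.sum_eq_zero
      intro b' _
      simp only [map_smul, LinearMap.smul_apply, e1, smul_eq_mul]; simp [hb]
    · simp
  · rw [Module.finrank_prod, i.fr h2 h, finrank_self, Module.finrank_pi, Fintype.card_fin]; omega
  · rw [prB_apply, prB_apply]
    exact congrArg₂ (· + ·) (hG _ _) (hI _ _)
  · intro u
    have : (LinearMap.prodMap G (χ t • (1 : End K K))) ∘ₗ ι = ι ∘ₗ Matrix.toLin' (Matrix.diagonal fun k : Fin (t + 1) => χ (t + k)) := by
      apply LinearMap.pi_ext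
      intro k v
      have e : Matrix.toLin' (Matrix.diagonal fun k : Fin (t + 1) => χ (t + k)) (Pi.single k v) = Pi.single k (χ (t + k) * v) := by
        ext j; rw [Matrix.toLin'_apply, Matrix.mulVec_diagonal]
        by_cases hj : j = k
        · subst hj; simp
        · simp [Pi.single_eq_of_ne hj]
      rw [LinearMap.comp_apply, LinearMap.comp_apply, e, hιs, hιs, LinearMap.prodMap_apply]
      simp only [map_smul, hχ, smul_smul, mul_comm v]
      refine Prod.ext rfl ?_
      by_cases hk : k = 0
      · subst hk; simp
      · simp [hk]
    exact LinearMap.congr_fun this u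

/-- an involution with the standard behaviour. -/
theorem IsO.chiK [Finite K] (h4 : ¬ IsSquare (-1 : K)) (h : QS f φ o n) (i : IsO f φ o n ε t x) {G : End K (Ob o n φ t x)} (hG : Iso (f.restrict (Ob o n φ t x)) G)
    (hχ : ∀ j, G ⟨_, i.mem (two_ne h4) h j⟩ = (-1 : K) ^ (t + j) • ⟨_, i.mem (two_ne h4) h j⟩) {a : K} (ha : a ≠ 0) :
    Biref.chi (f.restrict (Ob o n φ t x)) a G = kap K t := by
  have e : ∀ j, (-1 : K) ^ (t + (t + j)) = (-1) ^ j := fun j => by rw [← add_assoc, pow_add, ← two_mul, pow_mul]; simp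
  have e0 : (-1 : K) ^ (t + t) = 1 := by simpa using e 0
  have := i.chi h4 h hG (fun j => (-1) ^ (t + j)) hχ (by rw [e0, one_mul]) ha
  simp only [e, e0, one_smul, chi_one, mul_one] at this
  exact this

theorem IsO.nu [Finite K] (h4 : ¬ IsSquare (-1 : K)) (h : QS f φ o n) (i : IsO f φ o n ε t x) {a : K} (ha : a ≠ 0) :
    nu (f.restrict (Ob o n φ t x)) a = qc (-a) * qc (f x ((Tm o n φ ^ (2 * t)) x)) := by
  have h1 := i.chi h4 h (G := -1) (Iso.neg (Iso.one _)) (fun _ => -1) (fun j => by simp) (by norm_num) ha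
  have hp : ((-1 : K)) ^ t ≠ 0 := by simp
  have h3 : Biref.chi (oneB (-((-1) ^ t * f x ((Tm o n φ ^ (2 * t)) x)))) a ((-1 : K) • (1 : End K K)) = qc (-a) * qc (-((-1) ^ t * f x ((Tm o n φ ^ (2 * t)) x))) := by
    rw [show (-1 : K) • (1 : End K K) = -1 by ext; simp]; exact oneB_nu h4 (by simp [i.ne]) ha
  rw [h3, qc_neg h4 (mul_ne_zero hp i.ne), qc_mul hp i.ne, Finset.prod_const, Finset.card_univ, Fintype.card_fin, qc_neg_one_pow h4, qc_neg_one_pow h4, pow_succ] at h1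
  have key : ∀ A B E Q : ℤˣ, A * (Q * -(E * B)) = E * -1 → A = Q * B := by decide
  exact key _ _ _ _ h1

theorem IsO.hc [Finite K] (h4 : ¬ IsSquare (-1 : K)) (h : QS f φ o n) (i : IsO f φ o n ε t x) :
    HC (f.restrict (Ob o n φ t x)) (φ.restrict (i.inv (two_ne h4) h)) (kap K t) (kap K t) := by
  have h2 := two_ne h4
  have hp : ∀ i : ℕ, ((-1 : K) ^ i) * (-1) ^ i = 1 := fun i => by rw [← mul_pow]; simp
  obtain ⟨β, b1, b2, b3, b4⟩ := Wb_rev h2 h (i.D h2 h) i.X i.sg i.k (((-1 : K) ^ t) • 1) (fun y hy => Submodule.smul_mem _ _ hy)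
    (fun y hy => by simp [smul_smul, hp]) (by
      intro j y hy z hz
      obtain ⟨c, rfl⟩ := mem_span_singleton.1 hy
      obtain ⟨d, rfl⟩ := mem_span_singleton.1 hz
      simp only [map_smul, LinearMap.smul_apply, End.one_apply, smul_eq_mul]
      by_cases hj : Even j
      · rw [hj.neg_one_pow]; linear_combination c * (d * (f x) ((Tm o n φ ^ j) x)) * hp t
      · have : f x ((Tm o n φ ^ j) x) = 0 := by
          have := h.skew.pow j x x
          rw [h.symm.eq, (Nat.not_even_iff_odd.1 hj).neg_one_pow] at this
          have : 2 * f x ((Tm o n φ ^ j) x) = 0 := by linear_combination this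
          simpa [h2] using this
        simp [this]) (i.inv h2 h)
  have hχ : ∀ j, β ⟨_, i.mem h2 h j⟩ = (-1 : K) ^ (t + j) • (⟨_, i.mem h2 h j⟩ : Ob o n φ t x) := fun j => Subtype.ext (by
    refine (b4 j x (mem_span_singleton_self x)).trans ?_
    simp [smul_smul, pow_add, mul_comm])
  exact ⟨β, b1, b2, b3, i.chiK h4 h b1 hχ one_ne_zero, i.chiK h4 h b1 hχ (by simp)⟩
end ob

end

section
section ev
variable [FiniteDimensional K V] {f : BilinForm K V} {φ : End K V} {o n D : ℕ}

theorem QS.oddz (h2 : (2 : K) ≠ 0) (h : QS f φ o n) {j : ℕ} (hj : Odd j) (x : V) : f x ((Tm o n φ ^ j) x) = 0 := by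
  have := h.skew.pow j x x
  rw [h.symm.eq, hj.neg_one_pow] at this
  have : 2 * f x ((Tm o n φ ^ j) x) = 0 := by linear_combination this
  simpa [h2] using this

theorem ev_block (h2 : (2 : K) ≠ 0) (h : QS f φ o n) {ε : K} (he : ε = 1 ∨ ε = -1) {m : ℕ}
    (hk : ∀ x, aeval φ ((X - C ε) ^ m) x = 0) (h0 : (Tm o n φ) ^ (D + 1) = 0) (h1 : (Tm o n φ) ^ D ≠ 0) (hD : Odd D) :
    ∃ (W : Submodule K V) (hW : ∀ x ∈ W, φ x ∈ W), (f.restrict W).Nondegenerate ∧ W ≠ ⊥ ∧ Even (finrank K W) ∧ ∃ s t, HC (f.restrict W) (φ.restrict hW) s t := by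
  obtain ⟨T, hT⟩ : ∃ T, T = Tm o n φ := ⟨_, rfl⟩
  rw [← hT] at h0 h1
  obtain ⟨y0, hy0⟩ : ∃ y, (T ^ D) y ≠ 0 := by
    by_contra hh; push Not at hh; exact h1 (LinearMap.ext hh)
  obtain ⟨x0, hx0⟩ : ∃ x, f x ((T ^ D) y0) ≠ 0 := by
    by_contra hh; push Not at hh; exact hy0 (h.nd.2 _ hh)
  obtain ⟨x, hx⟩ : ∃ x, f x ((T ^ D) y0) = 1 := ⟨(f x0 ((T ^ D) y0))⁻¹ • x0, by simp [hx0]⟩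
  have hge : ∀ i, D < i → ∀ z, (T ^ i) z = 0 := fun i hi z => by
    rw [pow_eq_zero_of_le hi h0]; rfl
  have step : ∀ k, ∃ y, f x ((T ^ D) y) = 1 ∧ ∀ i, i ≠ D → D - k ≤ i → f x ((T ^ i) y) = 0 := by
    intro k
    induction k with
    | zero => exact ⟨y0, hx, fun i hi hi' => by rw [hge i (by omega)]; simp⟩
    | succ k ih =>
      obtain ⟨y, hy, hy'⟩ := ih
      by_cases hkD : D ≤ k
      · exact ⟨y, hy, fun i hi hi' => hy' i hi (by omega)⟩
      obtain ⟨j, hj⟩ : ∃ j, j = D - (k + 1) := ⟨_, rfl⟩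
      refine ⟨y - f x ((T ^ j) y) • (T ^ (D - j)) y, ?_, fun i hi hi' => ?_⟩
      · rw [map_sub, map_smul, ← mul_apply, ← pow_add, hge (D + (D - j)) (by omega)]; simp [hy]
      · rw [map_sub, map_smul, ← mul_apply, ← pow_add]
        rcases eq_or_ne i j with rfl | hij
        · rw [show i + (D - i) = D by omega]; simp [hy]
        · rw [hge (i + (D - j)) (by omega)]; simp [hy' i hi (by omega)]
  obtain ⟨y, hy, hy'⟩ := step D
  have hy' : ∀ i, Even i → f x ((T ^ i) y) = 0 := fun i hi => hy' i (by rintro rfl; exact (Nat.not_even_iff_odd.2 hD) hi) (by omega)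
  have hsk : ∀ i u v, f u ((T ^ i) v) = (-1) ^ i * f v ((T ^ i) u) := fun i u v => by
    rw [h.symm.eq, hT, h.skew.pow]
  have hod : ∀ i, Odd i → ∀ z, f z ((T ^ i) z) = 0 := fun i hi z => by rw [hT]; exact h.oddz h2 hi z
  have hyx : f y ((T ^ D) x) = -1 := by rw [hsk, hy, hD.neg_one_pow]; simp
  have hX : ∀ u : span K {x, y}, (∀ v : span K {x, y}, f u ((T ^ D) v) = 0) → u = 0 := by
    rintro ⟨u, hu⟩ hv
    obtain ⟨a, b, rfl⟩ := Submodule.mem_span_pair.1 hu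
    have e1 := hv ⟨x, subset_span (by simp)⟩
    have e2 := hv ⟨y, subset_span (by simp)⟩
    simp [hod D hD, hyx, hy] at e1 e2
    simp [e1, e2]
  have hs : ∀ u ∈ span K {x, y}, ∀ s : End K V, s = 1 + ((2 : K) • f.flip ((T ^ D) x)).smulRight y → ∃ a b : K, u = a • x + b • y ∧ s u = a • x - b • y := by
    rintro u hu s rfl
    obtain ⟨a, b, rfl⟩ := Submodule.mem_span_pair.1 hu
    refine ⟨a, b, rfl, ?_⟩
    simp [hod D hD, hyx]
    module
  obtain ⟨s, hse⟩ : ∃ s : End K V, s = 1 + ((2 : K) • f.flip ((T ^ D) x)).smulRight y := ⟨_, rfl⟩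
  have hmem : ∀ a b : K, a • x + b • y ∈ span K {x, y} := fun a b => Submodule.mem_span_pair.2 ⟨a, b, rfl⟩
  subst hT
  have hD0 : ∀ u ∈ span K {x, y}, (Tm o n φ ^ (D + 1)) u = 0 := fun u _ => by rw [h0]; rfl
  have hWi := Wb_phi (Y := span K {x, y}) h2 h hD0 he fun u _ => hk u
  have q1 : ∀ u ∈ span K {x, y}, s u ∈ span K {x, y} := by
    intro u hu
    obtain ⟨a, b, -, e⟩ := hs u hu s hse
    rw [e, sub_eq_add_neg, ← neg_smul]; exact hmem a (-b)
  have q2 : ∀ u ∈ span K {x, y}, s (s u) = u := by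
    intro u hu
    obtain ⟨a, b, e1, e⟩ := hs u hu s hse
    obtain ⟨a', b', e1', e'⟩ := hs (s u) (by rw [e, sub_eq_add_neg, ← neg_smul]; exact hmem a (-b)) s hse
    have hsx : s x = x := by rw [hse]; simp [hod D hD]
    have hsy : s y = -y := by rw [hse]; simp [hyx]; module
    rw [e, e1]; simp [hsx, hsy]
  have q3 : ∀ i, ∀ u ∈ span K {x, y}, ∀ v ∈ span K {x, y}, f (s u) ((Tm o n φ ^ i) (s v)) = (-1) ^ i * f u ((Tm o n φ ^ i) v) := by
    intro i u hu v hv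
    obtain ⟨a, b, e1, e⟩ := hs u hu s hse
    obtain ⟨a', b', e1', e'⟩ := hs v hv s hse
    rw [e, e', e1, e1']
    simp only [map_add, map_sub, map_smul, LinearMap.add_apply, LinearMap.sub_apply, LinearMap.smul_apply, smul_eq_mul]
    by_cases hi : Even i
    · rw [hsk i y x, hy' i hi, hi.neg_one_pow]; ring
    · have hi' := Nat.not_even_iff_odd.1 hi
      rw [hod i hi' x, hod i hi' y, hi'.neg_one_pow]; ring
  obtain ⟨β, b1, b2, b3, -⟩ := Wb_rev h2 h hD0 hX he (fun u _ => hk u) s q1 q2 q3 hWi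
  refine ⟨_, hWi, Wb_nd h hD0 hX, ?_, ?_, _, _, β, b1, b2, b3, rfl, rfl⟩
  · intro hb
    have := Wb_mem hD0 D (subset_span (by simp : y ∈ ({x, y} : Set V)))
    rw [hb, Submodule.mem_bot] at this
    rw [this, map_zero] at hy
    exact zero_ne_one hy
  · rw [Wb_fr h hD0 hX]
    exact (hD.add_one).mul_right _
end ev

end

section
theorem nil_inj {M : End K V} {r c : K[X]} (hc : IsCoprime r c) (hS : IsNilpotent (aeval M r)) {x : V} (hx : aeval M c x = 0) : x = 0 := by
  obtain ⟨N, hN⟩ := hS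
  obtain ⟨s, hs⟩ := cop_fix M (hc.pow_left (m := N)) (x := x) (by rw [map_pow, hN]; rfl)
  rw [← hs, ap, hx, map_zero]

section A
variable {f : BilinForm K V} {φ : End K V} {o n e : ℕ} {r : K[X]} {w : V}

theorem cyc_key (h : QS f φ o n) (hr : Irreducible r) (he : 0 < e) (hw : aeval (Mm o φ) (r ^ e) w = 0)
    (hw' : f w (aeval (Mm o φ) (r ^ (e - 1)) w) ≠ 0) {c : K[X]} (hc : ∀ d : K[X], f (aeval (Mm o φ) c w) (aeval (Mm o φ) d w) = 0) : r ^ e ∣ c := by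
  by_cases h0 : c = 0
  · rw [h0]; exact dvd_zero _
  obtain ⟨i, u, hu, rfl⟩ := WfDvdMonoid.max_power_factor h0 hr
  by_cases hi : e ≤ i
  · exact dvd_mul_of_dvd_left (pow_dvd_pow _ hi) _
  exfalso
  obtain ⟨s, hs⟩ := cop_fix (Mm o φ) ((hr.coprime_iff_not_dvd.2 hu).pow_left (m := e)) hw
  apply hw'
  have := hc (r ^ (e - 1 - i) * s)
  rw [h.Msa, ← ap, show r ^ i * u * (r ^ (e - 1 - i) * s) = r ^ (i + (e - 1 - i)) * (s * u) by ring, ap, hs] at this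
  rwa [show i + (e - 1 - i) = e - 1 by omega] at this

noncomputable def cyL (M : End K V) (w : V) : K[X] →ₗ[K] V := (LinearMap.applyₗ w) ∘ₗ (aeval M).toLinearMap
theorem cyL_apply (M : End K V) (w : V) (c : K[X]) : cyL M w c = aeval M c w := rfl

theorem cyc_fr [FiniteDimensional K V] (h : QS f φ o n) (hr : Irreducible r) (he : 0 < e) (hw : aeval (Mm o φ) (r ^ e) w = 0)
    (hw' : f w (aeval (Mm o φ) (r ^ (e - 1)) w) ≠ 0) : finrank K (range (cyL (Mm o φ) w)) = e * r.natDegree := by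
  have hk : ker (cyL (Mm o φ) w) = (Ideal.span {r ^ e}).restrictScalars K := by
    ext c
    rw [mem_ker, cyL_apply, Submodule.restrictScalars_mem, Ideal.mem_span_singleton]
    constructor
    · intro hc; exact cyc_key h hr he hw hw' fun d => by rw [hc]; simp
    · rintro ⟨d, rfl⟩; rw [mul_comm, ap, hw, map_zero]
  rw [← (cyL (Mm o φ) w).quotKerEquivRange.finrank_eq, hk]
  have h3 := (AdjoinRoot.powerBasis (pow_ne_zero e hr.ne_zero)).finrank
  rw [AdjoinRoot.powerBasis_dim, natDegree_pow] at h3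
  rw [← h3]
  exact (Submodule.Quotient.restrictScalarsEquiv K (Ideal.span {r ^ e})).finrank_eq

theorem exists_k [Finite K] (h2 : (2 : K) ≠ 0) (hr : Irreducible r) (hc : IsCoprime r (X ^ 2 - 4)) :
    ∃ a b : K[X], IsCoprime r (a ^ 2 - b ^ 2 * (X ^ 2 - 4)) ∧ Algebra.norm K (AdjoinRoot.mk r (a ^ 2 - b ^ 2 * (X ^ 2 - 4))) = -1 := by
  haveI : Fact (Irreducible r) := ⟨hr⟩
  haveI : FiniteDimensional K (AdjoinRoot r) := (AdjoinRoot.powerBasis hr.ne_zero).finite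
  haveI : Finite (AdjoinRoot r) := Module.finite_of_finite K
  letI := Fintype.ofFinite (AdjoinRoot r)
  obtain ⟨z, hz⟩ := FiniteField.norm_surjective K (AdjoinRoot r) (-1)
  have hz0 : z ≠ 0 := by rintro rfl; rw [Algebra.norm_zero] at hz; simp at hz
  have ht : AdjoinRoot.mk r (X ^ 2 - 4) ≠ 0 := by
    rw [Ne, AdjoinRoot.mk_eq_zero]; exact hr.coprime_iff_not_dvd.1 hc
  have hodd : Fintype.card (AdjoinRoot r) % 2 = 1 := by
    apply FiniteField.odd_card_of_char_ne_two
    intro h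
    have h3 : (2 : AdjoinRoot r) = 0 := by
      have := CharP.cast_eq_zero (AdjoinRoot r) (ringChar (AdjoinRoot r)); rw [h] at this; exact_mod_cast this
    apply h2
    apply (algebraMap K (AdjoinRoot r)).injective
    rw [map_ofNat, map_zero]; exact h3
  obtain ⟨a, b, hab⟩ := FiniteField.exists_root_sum_quadratic (f := (X ^ 2 : (AdjoinRoot r)[X])) (g := C (-AdjoinRoot.mk r (X ^ 2 - 4)) * X ^ 2 + C 0 * X + C (-z))
    (by simp) (degree_quadratic (neg_ne_zero.2 ht)) hodd
  obtain ⟨a, rfl⟩ := AdjoinRoot.mk_surjective a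
  obtain ⟨b, rfl⟩ := AdjoinRoot.mk_surjective b
  have e : AdjoinRoot.mk r (a ^ 2 - b ^ 2 * (X ^ 2 - 4)) = z := by
    simp only [eval_add, eval_mul, eval_C, eval_pow, eval_X] at hab
    rw [map_sub, map_mul, map_pow, map_pow]; linear_combination hab
  refine ⟨a, b, ?_, by rw [e, hz]⟩
  rw [hr.coprime_iff_not_dvd, ← AdjoinRoot.mk_eq_zero, e]; exact hz0

theorem nu_scale [Finite K] [FiniteDimensional K V] (h4 : ¬ IsSquare (-1 : K)) (hs : f.IsSymm) (hf : f.Nondegenerate) {k : End K V} {g : BilinForm K V}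
    (hg : ∀ x y, g x y = f (k x) y) (hs' : g.IsSymm) (hf' : g.Nondegenerate) {a : K} (ha : a ≠ 0) : nu g a = qc (det k) * nu f a := by
  have b := finBasis K V
  have e1 : ∀ g : BilinForm K V, (Matrix.of fun i j => g (b i) (b j)) = LinearMap.BilinForm.toMatrix b g := fun g => by
    ext i j; simp [LinearMap.BilinForm.toMatrix_apply]
  have e2 : g = f.compLeft k := by ext x y; exact hg x y
  have hne : (LinearMap.BilinForm.toMatrix b f).det ≠ 0 := (LinearMap.BilinForm.nondegenerate_iff_det_ne_zero b).1 hf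
  have hne' : (LinearMap.BilinForm.toMatrix b g).det ≠ 0 := (LinearMap.BilinForm.nondegenerate_iff_det_ne_zero b).1 hf'
  have e3 : (LinearMap.BilinForm.toMatrix b g).det = det k * (LinearMap.BilinForm.toMatrix b f).det := by
    rw [e2, LinearMap.BilinForm.toMatrix_compLeft, Matrix.det_mul, Matrix.det_transpose, LinearMap.det_toMatrix]
  have hk : det k ≠ 0 := by intro h; rw [h, zero_mul] at e3; exact hne' e3
  rw [nu_gram h4 hs hf ha b, nu_gram h4 hs' hf' ha b, e1, e1, e3, qc_mul hk hne]
  exact mul_left_comm _ _ _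
end A

end

section
section A
variable [Finite K] [FiniteDimensional K V] {f : BilinForm K V} {φ : End K V} {o n e : ℕ} {r : K[X]} {w : V}

theorem A_sp (h2 : (2 : K) ≠ 0) (h : QS f φ o n) (hr : Irreducible r) (hc4 : IsCoprime r (X ^ 2 - 4)) (hS : IsNilpotent (aeval (Mm o φ) r)) (he : 0 < e) (hw : aeval (Mm o φ) (r ^ e) w = 0)
    (hw' : f w (aeval (Mm o φ) (r ^ (e - 1)) w) ≠ 0)
    (hind : ∀ W : Submodule K V, (∀ x ∈ W, φ x ∈ W) → (f.restrict W).Nondegenerate → W ≠ ⊥ → W = ⊤) :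
    Sp f (range (cyL (Mm o φ) w)) ((range (cyL (Mm o φ) w)).map (Nm o φ)) := by
  obtain ⟨A, hA⟩ : ∃ A, A = range (cyL (Mm o φ) w) := ⟨_, rfl⟩
  have hAm : ∀ c : K[X], aeval (Mm o φ) c w ∈ A := fun c => by rw [hA]; exact ⟨c, rfl⟩
  have hAe : ∀ x ∈ A, ∃ c : K[X], x = aeval (Mm o φ) c w := by rw [hA]; rintro _ ⟨c, rfl⟩; exact ⟨c, rfl⟩
  rw [← hA]
  have key : ∀ x ∈ A, (∀ y ∈ A, f x y = 0) → x = 0 := by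
    intro x hx hxy
    obtain ⟨c, rfl⟩ := hAe x hx
    obtain ⟨d, rfl⟩ := cyc_key h hr he hw hw' fun d => hxy _ (hAm d)
    rw [mul_comm, ap, hw, map_zero]
  have hMA : ∀ c : K[X], ∀ x ∈ A, aeval (Mm o φ) c x ∈ A := by
    intro c x hx
    obtain ⟨d, rfl⟩ := hAe x hx
    rw [← ap]; exact hAm _
  have hNN : ∀ x, Nm o φ (Nm o φ x) = aeval (Mm o φ) (X ^ 2 - 4 : K[X]) x := fun x => by rw [← h.NN]; rfl
  have horth : ∀ x ∈ A, ∀ y ∈ A, f x (Nm o φ y) = 0 := by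
    intro x hx y hy
    obtain ⟨c, rfl⟩ := hAe x hx
    obtain ⟨d, rfl⟩ := hAe y hy
    have e1 : ∀ b : K[X], f w (Nm o φ (aeval (Mm o φ) b w)) = 0 := fun b => by
      have e0 : f w (Nm o φ (aeval (Mm o φ) b w)) = - f w (Nm o φ (aeval (Mm o φ) b w)) := by
        conv_lhs => rw [h.symm.eq, h.Nsk, h.Msa, ← mul_apply, ← (h.NM b).eq, mul_apply]
      have : 2 * f w (Nm o φ (aeval (Mm o φ) b w)) = 0 := by linear_combination e0
      simpa [h2] using this
    rw [h.Msa, ← mul_apply, ← (h.NM c).eq, mul_apply, ← ap, e1]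
  have hdis : ∀ x ∈ A, ∀ y ∈ A, (∀ u ∈ A, f (x + Nm o φ y) u = 0) → (∀ u ∈ A, f (x + Nm o φ y) (Nm o φ u) = 0) → x = 0 ∧ y = 0 := by
    intro x hx y hy h1 h3
    constructor
    · apply key x hx
      intro u hu
      have := h1 u hu
      rwa [map_add, LinearMap.add_apply, h.symm.eq (Nm o φ y), horth u hu y hy, add_zero] at this
    · have : aeval (Mm o φ) (X ^ 2 - 4 : K[X]) y = 0 := by
        apply key _ (hMA _ y hy)
        intro u hu
        have := h3 u hu
        rw [map_add, LinearMap.add_apply, horth x hx u hu, zero_add, ← neg_neg (f _ _), ← h.Nsk, hNN] at this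
        exact neg_eq_zero.1 this
      exact nil_inj hc4 hS this
  have hsup : A ⊔ A.map (Nm o φ) = ⊤ := by
    have hn : ∀ x ∈ A ⊔ A.map (Nm o φ), Nm o φ x ∈ A ⊔ A.map (Nm o φ) := by
      intro x hx
      obtain ⟨u, hu, _, ⟨v, hv, rfl⟩, rfl⟩ := mem_sup.1 hx
      rw [map_add, hNN, add_comm]
      exact Submodule.add_mem_sup (hMA _ v hv) (Submodule.mem_map_of_mem hu)
    have hm : ∀ x ∈ A ⊔ A.map (Nm o φ), Mm o φ x ∈ A ⊔ A.map (Nm o φ) := by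
      intro x hx
      obtain ⟨u, hu, _, ⟨v, hv, rfl⟩, rfl⟩ := mem_sup.1 hx
      have hX : aeval (Mm o φ) (X : K[X]) = Mm o φ := aeval_X _
      have := h.NM X
      rw [hX] at this
      rw [map_add, ← mul_apply (Mm o φ) (Nm o φ), ← this.eq]
      have m1 := hMA X; rw [hX] at m1
      exact Submodule.add_mem_sup (m1 u hu) (Submodule.mem_map_of_mem (m1 v hv))
    apply hind
    · intro x hx
      have : φ x = (2 : K)⁻¹ • (Mm o φ x + Nm o φ x) := by
        simp only [Mm, Nm, LinearMap.add_apply, LinearMap.sub_apply]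
        rw [add_add_sub_cancel, ← two_smul K, smul_smul, inv_mul_cancel₀ h2, one_smul]
      rw [this]
      exact Submodule.smul_mem _ _ (Submodule.add_mem _ (hm x hx) (hn x hx))
    · apply nd_of_sep (h.symm.restrict _)
      rintro ⟨x, hx⟩ hxy
      obtain ⟨u, hu, _, ⟨v, hv, rfl⟩, rfl⟩ := mem_sup.1 hx
      obtain ⟨rfl, rfl⟩ := hdis u hu v hv (fun z hz => hxy ⟨z, Submodule.mem_sup_left hz⟩) fun z hz => hxy ⟨Nm o φ z, Submodule.mem_sup_right (Submodule.mem_map_of_mem hz)⟩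
      apply Subtype.ext; simp
    · intro hb
      have : w = 0 := by
        rw [← Submodule.mem_bot K, ← hb]
        have := hAm 1
        rw [map_one] at this
        exact Submodule.mem_sup_left this
      apply hw'; rw [this]; simp
  refine ⟨⟨Submodule.disjoint_def.2 ?_, codisjoint_iff.2 hsup⟩, ?_⟩
  · rintro _ hx ⟨y, hy, rfl⟩
    exact key _ hx fun u hu => by rw [h.symm.eq]; exact horth u hu y hy
  · rintro x hx _ ⟨y, hy, rfl⟩
    exact horth x hx y hy

theorem A_block (h4 : ¬ IsSquare (-1 : K)) (h : QS f φ o n) (hr : Irreducible r) (hc4 : IsCoprime r (X ^ 2 - 4)) (hS : IsNilpotent (aeval (Mm o φ) r)) (he : 0 < e) (hw : aeval (Mm o φ) (r ^ e) w = 0)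
    (hw' : f w (aeval (Mm o φ) (r ^ (e - 1)) w) ≠ 0)
    (hind : ∀ W : Submodule K V, (∀ x ∈ W, φ x ∈ W) → (f.restrict W).Nondegenerate → W ≠ ⊥ → W = ⊤) :
    Even (finrank K V) ∧ ∃ s t, HC f φ s t ∧ (Odd e → HC f φ (-s) (-t)) := by
  have h2 := two_ne h4
  have sp := A_sp h2 h hr hc4 hS he hw hw' hind
  have hfrA := cyc_fr h hr he hw hw'
  obtain ⟨A, hA⟩ : ∃ A, A = range (cyL (Mm o φ) w) := ⟨_, rfl⟩
  rw [← hA] at sp hfrA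
  have hMA : ∀ c : K[X], ∀ x ∈ A, aeval (Mm o φ) c x ∈ A := by
    rw [hA]; rintro c _ ⟨d, rfl⟩; exact ⟨c * d, by rw [cyL_apply, ap]; rfl⟩
  have hMB : ∀ c : K[X], ∀ x ∈ A.map (Nm o φ), aeval (Mm o φ) c x ∈ A.map (Nm o φ) := by
    rintro c _ ⟨y, hy, rfl⟩
    exact ⟨aeval (Mm o φ) c y, hMA c y hy, LinearMap.congr_fun (h.NM c).eq y⟩
  have hNN : ∀ x, Nm o φ (Nm o φ x) = aeval (Mm o φ) (X ^ 2 - 4 : K[X]) x := fun x => by rw [← h.NN]; rfl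
  have hNi : Function.Injective (Nm o φ) := by
    rw [← ker_eq_bot, LinearMap.ker_eq_bot']
    intro x hx
    exact nil_inj hc4 hS (by rw [← hNN, hx, map_zero])
  have hfrB : finrank K (A.map (Nm o φ)) = e * r.natDegree := by
    rw [← hfrA]; exact (Submodule.equivMapOfInjective _ hNi A).finrank_eq.symm
  obtain ⟨B, hB⟩ : ∃ B, B = A.map (Nm o φ) := ⟨_, rfl⟩
  have hNA : ∀ x ∈ A, Nm o φ x ∈ B := fun x hx => by rw [hB]; exact Submodule.mem_map_of_mem hx
  have hNB : ∀ x ∈ B, Nm o φ x ∈ A := by rw [hB]; rintro _ ⟨y, hy, rfl⟩; rw [hNN]; exact hMA _ y hy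
  rw [← hB] at sp hMB hfrB
  clear hA hB hw hw'
  refine ⟨by rw [sp.finrank, hfrA, hfrB]; exact ⟨_, rfl⟩, ?_⟩
  have hAB : ∀ x, ∃ u ∈ A, ∃ v ∈ B, x = u + v := fun x => by
    obtain ⟨u, v, e⟩ := sp.exi x; exact ⟨u, u.2, v, v.2, e⟩
  obtain ⟨ρ, hρ⟩ : ∃ ρ, ρ = sp.glue 1 (-1) := ⟨_, rfl⟩
  have rA : ∀ x ∈ A, ρ x = x := fun x hx => by rw [hρ]; exact sp.glue_l _ _ ⟨x, hx⟩
  have rB : ∀ x ∈ B, ρ x = -x := fun x hx => by rw [hρ]; exact sp.glue_r _ _ ⟨x, hx⟩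
  have rM : ∀ c : K[X], ∀ x, ρ (aeval (Mm o φ) c x) = aeval (Mm o φ) c (ρ x) := by
    intro c x
    obtain ⟨u, hu, v, hv, rfl⟩ := hAB x
    simp only [map_add, rA u hu, rB v hv, rA _ (hMA c u hu), rB _ (hMB c v hv), map_neg]
  have rN : ∀ x, ρ (Nm o φ x) = - Nm o φ (ρ x) := by
    intro x
    obtain ⟨u, hu, v, hv, rfl⟩ := hAB x
    simp only [map_add, rA u hu, rB v hv, rB _ (hNA u hu), rA _ (hNB v hv), map_neg, neg_add, neg_neg]
  have rr : ∀ x, ρ (ρ x) = x := by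
    intro x
    obtain ⟨u, hu, v, hv, rfl⟩ := hAB x
    simp only [map_add, rA u hu, rB v hv, map_neg, neg_neg]
  have riso : Iso f ρ := by
    rw [hρ]; exact sp.glue_iso h.symm (Iso.one _) (Iso.one _).neg
  have main : ∀ a b : K[X], IsCoprime r (a ^ 2 - b ^ 2 * (X ^ 2 - 4)) →
      HC f φ (qc (det ((aeval (Mm o φ) (a ^ 2 - b ^ 2 * (X ^ 2 - 4))).restrict (hMB _))) * nu (f.restrict B) 1)
        (qc (det ((aeval (Mm o φ) (a ^ 2 - b ^ 2 * (X ^ 2 - 4))).restrict (hMB _))) * nu (f.restrict B) (-1)) := by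
    intro a b hk
    obtain ⟨k, hke⟩ : ∃ k, k = a ^ 2 - b ^ 2 * (X ^ 2 - 4) := ⟨_, rfl⟩
    rw [← hke] at hk
    obtain ⟨E, hE⟩ : ∃ E, E = aeval (Mm o φ) a + aeval (Mm o φ) b * Nm o φ := ⟨_, rfl⟩
    have hadj : ∀ x y, f (E x) (E y) = f (aeval (Mm o φ) k x) y := by
      have c1 := (aeval_comm (Mm o φ) a b).eq
      have hk' : (aeval (Mm o φ) a - aeval (Mm o φ) b * Nm o φ) * E = aeval (Mm o φ) k := by
        rw [hE, hke, map_sub, map_mul _ (b ^ 2), ← h.NN, map_pow, map_pow, pow_two, pow_two, sub_mul, mul_add, mul_add,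
          ← mul_assoc (aeval (Mm o φ) a), c1, mul_assoc (aeval (Mm o φ) b) _ (Nm o φ), ← (h.NM a).eq]
        rw [← mul_assoc (_ * Nm o φ) (aeval (Mm o φ) b), mul_assoc (aeval (Mm o φ) b) (Nm o φ) (aeval (Mm o φ) b), (h.NM b).eq]
        simp only [mul_assoc]; abel
      intro x y
      rw [← hk', mul_apply]
      generalize E x = z
      simp only [hE, LinearMap.add_apply, LinearMap.sub_apply, mul_apply, map_add, map_sub]
      rw [h.Msa a, h.Msa b, h.Nsk, sub_neg_eq_add, ← mul_apply (Nm o φ), (h.NM b).eq]; rfl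
    have hkinj : ∀ x, aeval (Mm o φ) k x = 0 → x = 0 := fun x hx => nil_inj hk hS hx
    have hEinj : Function.Injective E := by
      rw [← ker_eq_bot, LinearMap.ker_eq_bot']
      intro x hx
      apply hkinj
      apply h.nd.1
      intro y
      rw [← hadj, hx]; simp
    have g_symm : (f.compLeft (aeval (Mm o φ) k)).IsSymm := ⟨fun x y => by
      rw [LinearMap.BilinForm.compLeft_apply, LinearMap.BilinForm.compLeft_apply, h.Msa, h.symm.eq]⟩
    have g_nd : (f.compLeft (aeval (Mm o φ) k)).Nondegenerate := nd_of_sep g_symm fun x hx => hkinj x (h.nd.1 _ hx)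
    have g_sp : Sp (f.compLeft (aeval (Mm o φ) k)) A B := ⟨sp.compl, fun x hx y hy => sp.orth _ (hMA k x hx) y hy⟩
    have g_iso : Iso (f.compLeft (aeval (Mm o φ) k)) ρ := fun x y => by
      rw [LinearMap.BilinForm.compLeft_apply, LinearMap.BilinForm.compLeft_apply, ← rM, riso]
    obtain ⟨Ee, hEe⟩ : ∃ Ee : V ≃ₗ[K] V, ∀ x, Ee x = E x := ⟨LinearEquiv.ofInjectiveEndo E hEinj, fun x => rfl⟩
    have sE : ∀ x, E (Ee.symm x) = x := fun x => by rw [← hEe, Ee.apply_symm_apply]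
    have sE' : ∀ x, Ee.symm (E x) = x := fun x => by rw [← hEe, Ee.symm_apply_apply]
    have cE1 : ∀ c : K[X], ∀ x, E (aeval (Mm o φ) c x) = aeval (Mm o φ) c (E x) := by
      intro c x
      rw [hE]
      simp only [LinearMap.add_apply, mul_apply, map_add]
      rw [← ap, mul_comm, ap, ← ap _ c b, mul_comm c b, ap _ b c, ← mul_apply (Nm o φ), (h.NM c).eq]; rfl
    have cE2 : ∀ x, E (Nm o φ x) = Nm o φ (E x) := by
      intro x
      rw [hE]
      simp only [LinearMap.add_apply, mul_apply, map_add]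
      rw [← mul_apply _ (Nm o φ) x, ← (h.NM a).eq, ← mul_apply (Nm o φ) (aeval _ b), (h.NM b).eq]; rfl
    obtain ⟨β, hβ⟩ : ∃ β : End K V, ∀ x, β (E x) = E (ρ x) := ⟨E ∘ₗ ρ ∘ₗ Ee.symm.toLinearMap, fun x => by
      show E (ρ (Ee.symm (E x))) = _
      rw [sE']⟩
    have ex : ∀ x, ∃ y, x = E y := fun x => ⟨_, (sE x).symm⟩
    have bM : ∀ x, β (Mm o φ x) = Mm o φ (β x) := by
      intro x
      obtain ⟨y, rfl⟩ := ex x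
      have c1 := cE1 X; have c2 := rM X
      rw [aeval_X] at c1 c2
      rw [← c1, hβ, hβ, c2, c1]
    have bN : ∀ x, β (Nm o φ x) = - Nm o φ (β x) := by
      intro x
      obtain ⟨y, rfl⟩ := ex x
      rw [← cE2, hβ, hβ, rN, map_neg, cE2]
    have bi : Iso f β := by
      intro x y
      obtain ⟨x, rfl⟩ := ex x
      obtain ⟨y, rfl⟩ := ex y
      rw [hβ, hβ, hadj, hadj, ← rM, riso]
    have hchi : ∀ c : K, c ≠ 0 → chi f c β = qc (det ((aeval (Mm o φ) k).restrict (hMB k))) * nu (f.restrict B) c := by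
      intro c hc
      rw [chi_conj_eq (f := f.compLeft (aeval (Mm o φ) k)) (g := ρ) Ee (fun x y => by rw [hEe, hEe, hadj]; rfl) g_nd g_iso (fun x => by rw [hEe, hEe, hβ]) c]
      have e1 : ρ = g_sp.glue 1 (-1) := by
        apply g_sp.ext
        · intro x hx; rw [rA x hx]; exact (g_sp.glue_l 1 (-1) ⟨x, hx⟩).symm
        · intro x hx; rw [rB x hx]; exact (g_sp.glue_r 1 (-1) ⟨x, hx⟩).symm
      rw [e1, chi_glue h2 g_symm g_nd g_sp (Iso.one _) (Iso.one _).neg, chi_one, one_mul]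
      exact nu_scale h4 (h.symm.restrict B) (sp.nd' h.symm h.nd) (fun x y => rfl) (g_symm.restrict B) (g_sp.nd' g_symm g_nd) hc
    rw [← hke]
    refine ⟨β, bi, ?_, ?_, hchi 1 one_ne_zero, hchi (-1) (by simp)⟩
    · ext x
      obtain ⟨y, rfl⟩ := ex x
      rw [mul_apply, hβ, hβ, rr]; rfl
    · have e1 : ∀ x, β (φ x) = (φ ^ (o - 1)) (β x) := by
        intro x
        have p1 := bM x
        have p2 := bN x
        simp only [Mm, Nm, LinearMap.add_apply, LinearMap.sub_apply, map_add, map_sub] at p1 p2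
        apply smul_right_injective V h2
        show (2 : K) • _ = (2 : K) • _
        have := congrArg₂ (· + ·) p1 p2
        rw [two_smul, two_smul]
        refine Eq.trans ?_ (this.trans ?_) <;> abel
      ext x
      rw [mul_apply, mul_apply, e1, ← mul_apply, h.mp]; rfl
  have m1 := main 1 0 (by simp [isCoprime_one_right])
  refine ⟨_, _, m1, fun ho => ?_⟩
  obtain ⟨a, b, hab, hno⟩ := exists_k h2 hr hc4
  have m2 := main a b hab
  have hres : ∀ c : K[X], (aeval (Mm o φ) c).restrict (hMB c) = aeval ((Mm o φ).restrict (by have := hMB X; rwa [aeval_X] at this)) c := by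
    intro c; ext x; rw [raeval]; rfl
  obtain ⟨j, hj, hj'⟩ := norm_lemma hr _ B rfl ((Mm o φ).restrict (by have := hMB X; rwa [aeval_X] at this)) (by rw [← hres]; exact nil_restrict hS _)
  have hje : j = e := Nat.eq_of_mul_eq_mul_right hr.natDegree_pos (hj.symm.trans hfrB)
  simp only [hres, hj', hno] at m1 m2 ⊢
  rw [hje, ho.neg_one_pow, qc_neg_one h4] at m2
  have e1 : qc (Algebra.norm K ((AdjoinRoot.mk r) (1 ^ 2 - 0 ^ 2 * (X ^ 2 - 4))) ^ j) = 1 := by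
    simp [qc_one]
  rw [e1, one_mul, one_mul]
  simpa using m2
end A

end

section
variable {f : BilinForm K V} {φ : End K V} {o n : ℕ}

theorem polar (h2 : (2 : K) ≠ 0) {U : Submodule K V} {A : End K V} (hA : ∀ x y, f x (A y) = f y (A x)) {x y : V}
    (hx : x ∈ U) (hy : y ∈ U) (h : f x (A y) ≠ 0) : ∃ w ∈ U, f w (A w) ≠ 0 := by
  by_contra hc
  push Not at hc
  have h1 := hc (x + y) (U.add_mem hx hy)
  simp only [map_add, LinearMap.add_apply, hc x hx, hc y hy, hA y x] at h1
  apply h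
  have : (2 : K) * f x (A y) = 0 := by linear_combination h1
  simpa [h2] using this

theorem Skew.ev (hs : f.IsSymm) {T : End K V} (hT : Skew f T) (t : ℕ) (x y : V) : f x ((T ^ (2 * t)) y) = f y ((T ^ (2 * t)) x) := by
  rw [hs.eq, hT.pow, pow_mul]; simp

theorem nonHZ (h2 : (2 : K) ≠ 0) (hs : f.IsSymm) {T : End K V} (hT : Skew f T) (h : ¬ HZ f T) :
    ∃ t x, (T ^ (2 * t + 1)) x = 0 ∧ f x ((T ^ (2 * t)) x) ≠ 0 := by
  unfold HZ at h
  push Not at h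
  obtain ⟨d, ⟨t, rfl⟩, x, y, hx, hy, hne⟩ := h
  obtain ⟨w, hw, hw'⟩ := polar h2 (U := ker (T ^ (2 * t + 1))) (hT.ev hs t) hx hy hne
  exact ⟨t, w, hw, hw'⟩

theorem P_of_T (h2 : (2 : K) ≠ 0) (h : QS f φ o n) {ε : K} (he : ε = 1 ∨ ε = -1) {m j : ℕ} {x : V}
    (hm : aeval φ ((X - C ε) ^ m) x = 0) (hj : (Tm o n φ ^ j) x = 0) : aeval φ ((X - C ε) ^ j) x = 0 := by
  obtain ⟨G, hG, hG'⟩ := pT_fac h2 o h.nK he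
  have hc : IsCoprime (X - C ε) G := by
    rw [(irreducible_X_sub_C ε).coprime_iff_not_dvd, dvd_iff_isRoot]; exact hG'
  have hc' : IsCoprime ((X - C ε) ^ m) (G ^ j) := hc.pow
  have hx : aeval φ ((X - C ε) ^ m) (aeval φ ((X - C ε) ^ j) x) = 0 := by
    rw [← ap, mul_comm, ap, hm, map_zero]
  obtain ⟨s, hs⟩ := cop_fix φ hc' hx
  rw [← hs, ap, ← ap φ (G ^ j), mul_comm (G ^ j), ← mul_pow, ← hG, map_pow]
  have : (aeval φ (pT K o n)) = Tm o n φ := rfl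
  rw [this, hj, map_zero]

theorem HC.of_top [Finite K] [FiniteDimensional K V] (h2 : (2 : K) ≠ 0) (h : QS f φ o n) {W : Submodule K V} (hW : ∀ x ∈ W, φ x ∈ W)
    (hn : (f.restrict W).Nondegenerate) (ht : W = ⊤) {s t : ℤˣ} (hc : HC (f.restrict W) (φ.restrict hW) s t) : HC f φ s t := by
  have sp := Sp.of_nd h.symm hn
  have h0 : f.orthogonal W = ⊥ := by
    have := sp.compl.inf_eq_bot
    rwa [ht, top_inf_eq, ← ht] at this
  haveI : Subsingleton (f.orthogonal W) := by rw [h0]; infer_instance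
  have := HC.glue h2 h.symm h.nd sp hW (orth_inv h.nd h.iso hW) hc (HC.triv _ _)
  simpa using this

def Tog (f : BilinForm K V) (φ : End K V) : Prop := ∃ s t, HC f φ s t ∧ HC f φ (-s) (-t)

theorem M_inv {W : Submodule K V} (o : ℕ) (hW : ∀ x ∈ W, φ x ∈ W) : ∀ x ∈ W, Mm o φ x ∈ W := fun x hx => by
  have := inv_aeval hW (X + X ^ (o - 1)) x hx
  simpa [Mm] using this

theorem exists_r [FiniteDimensional K V] [Nontrivial V] (h : QS f φ o n)
    (hind : ∀ W : Submodule K V, (∀ x ∈ W, φ x ∈ W) → (f.restrict W).Nondegenerate → W ≠ ⊥ → W = ⊤) :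
    ∃ r : K[X], Irreducible r ∧ IsNilpotent (aeval (Mm o φ) r) := by
  have hm : ¬ IsUnit (minpoly K (Mm o φ)) := minpoly.not_isUnit _ _
  obtain ⟨r, hr, c, hc⟩ := WfDvdMonoid.exists_irreducible_factor hm (minpoly.ne_zero (LinearMap.isIntegral _))
  refine ⟨r, hr, ?_⟩
  obtain ⟨S, hS⟩ : ∃ S, S = aeval (Mm o φ) r := ⟨_, rfl⟩
  rw [← hS]
  have hcS : ∀ N, Commute φ (S ^ N) := fun N => by
    have := aeval_comm φ X ((r ^ N).comp (X + X ^ (o - 1)))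
    rw [aeval_comp] at this
    simpa [Mm, hS] using this
  obtain ⟨N, hN, hN1⟩ := ((LinearMap.eventually_isCompl_ker_pow_range_pow S).and (Filter.eventually_ge_atTop 1)).exists
  have hsa : ∀ x y, f ((S ^ N) x) y = f x ((S ^ N) y) := fun x y => by
    rw [hS, ← map_pow]; exact h.Msa _ _ _
  have sp : Sp f (ker (S ^ N)) (range (S ^ N)) := ⟨hN, by
    rintro x hx _ ⟨y, rfl⟩
    rw [← hsa, mem_ker.1 hx]; simp⟩
  have hne : ker (S ^ N) ≠ ⊥ := by
    intro h0
    have hinj : Function.Injective (S ^ N) := ker_eq_bot.1 h0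
    have hinj1 : Function.Injective S := by
      obtain ⟨k, rfl⟩ : ∃ k, N = k + 1 := ⟨N - 1, by omega⟩
      rw [pow_succ] at hinj
      exact fun a b hab => hinj (by simp [mul_apply, hab])
    have hca : aeval (Mm o φ) c = 0 := by
      ext x
      apply hinj1
      rw [hS, ← ap, ← hc, minpoly.aeval]; simp
    have hd := minpoly.dvd K _ hca
    have hc0 : c ≠ 0 := by rintro rfl; exact minpoly.ne_zero (LinearMap.isIntegral (Mm o φ)) (by rw [hc, mul_zero])
    have h1 : r * c ∣ 1 * c := by rw [← hc, one_mul]; exact hd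
    exact hr.not_isUnit (isUnit_of_dvd_one ((mul_dvd_mul_iff_right hc0).1 h1))
  have ht := hind _ (ker_inv (hcS N)) (sp.nd h.symm h.nd) hne
  exact ⟨N, LinearMap.ker_eq_top.1 ht⟩

def MainC (f : BilinForm K V) (φ : End K V) (o n : ℕ) : Prop :=
  (∃ s t, HC f φ s t) ∧ (Odd (finrank K V) → OT f φ o n) ∧ (¬ HZ f (Tm o n φ) → OT f φ o n ∨ Tog f φ)

theorem QS.T2 (h2 : (2 : K) ≠ 0) (h : QS f φ o n) (j : ℕ) : Tm o n φ ^ (2 * j) = aeval (Mm o φ) ((X ^ 2 - 4) ^ j * (tq K n).2 ^ (2 * j)) := by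
  obtain ⟨q, hq⟩ : ∃ q, q = (tq K n).2 := ⟨_, rfl⟩
  rw [pow_mul, sq, h.TNq h2, ← hq, mul_assoc, ← mul_assoc (aeval _ q), ← (h.NM q).eq, mul_assoc, ← mul_assoc, h.NN]
  rw [← map_mul, ← map_mul, ← map_pow, mul_pow, ← sq, ← pow_mul]

theorem QS.T3 (h2 : (2 : K) ≠ 0) (h : QS f φ o n) (t : ℕ) :
    aeval (Mm o φ) ((X ^ 2 - 4) ^ (t + 1) * (tq K n).2 ^ (2 * t + 1)) = Nm o φ * Tm o n φ ^ (2 * t + 1) := by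
  rw [pow_succ (Tm o n φ), h.T2 h2, h.TNq h2]
  obtain ⟨q, hq⟩ : ∃ q, q = (tq K n).2 := ⟨_, rfl⟩
  rw [← hq, ← mul_assoc, ← mul_assoc, (h.NM _).eq, mul_assoc (aeval _ _), h.NN, ← map_mul, ← map_mul]
  refine congrArg _ ?_
  rw [pow_succ, pow_succ q]; ac_rfl

theorem Main_ind [Finite K] [FiniteDimensional K V] [Nontrivial V] (h4 : ¬ IsSquare (-1 : K)) (h : QS f φ o n)
    (hind : ∀ W : Submodule K V, (∀ x ∈ W, φ x ∈ W) → (f.restrict W).Nondegenerate → W ≠ ⊥ → W = ⊤) : MainC f φ o n := by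
  have h2 := two_ne h4
  obtain ⟨r, hr, hS⟩ := exists_r h hind
  by_cases hc4 : r ∣ X ^ 2 - 4
  · -- unipotent case
    have hM : ∃ ε : K, (ε = 1 ∨ ε = -1) ∧ r ∣ X - C (2 * ε) := by
      have : (X ^ 2 - 4 : K[X]) = (X - C (2 * 1)) * (X - C (2 * (-1))) := by
        rw [show (4 : K[X]) = C 4 from rfl, sub_mul, mul_sub, mul_sub, ← C_mul, show (2 * 1 : K) * (2 * (-1)) = - 4 by ring]
        rw [show (2 * (-1) : K) = - (2 * 1) by ring, C_neg, C_neg]; ring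
      rw [this] at hc4
      rcases hr.prime.dvd_or_dvd hc4 with h1 | h1
      · exact ⟨1, Or.inl rfl, h1⟩
      · exact ⟨-1, Or.inr rfl, h1⟩
    obtain ⟨ε, he, c, hc⟩ := hM
    have hn : IsNilpotent (aeval (Mm o φ) (X - C (2 * ε))) := by
      rw [hc, map_mul]; exact (aeval_comm _ _ _).isNilpotent_mul_right hS
    have hee : ε * ε = 1 := by rcases he with rfl | rfl <;> ring
    have hsq : aeval φ ((X - C ε) ^ 2) = φ * aeval (Mm o φ) (X - C (2 * ε)) := by
      have h1 := h.mp
      simp only [Mm, map_sub, map_add, map_pow, aeval_X, aeval_C, mul_sub, mul_add, h1]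
      rw [Algebra.algebraMap_eq_smul_one, Algebra.algebraMap_eq_smul_one, sq, sub_mul, mul_sub, mul_sub]
      simp only [mul_smul_comm, smul_mul_assoc, mul_one, one_mul, smul_smul, hee]
      module
    have hP : IsNilpotent (aeval φ (X - C ε)) := by
      have hcm : Commute φ (aeval (Mm o φ) (X - C (2 * ε))) := by
        have := aeval_comm φ X (X + X ^ (o - 1) - C (2 * ε))
        simpa [Mm] using this
      have : IsNilpotent (aeval φ (X - C ε) ^ 2) := by
        rw [← map_pow, hsq]; exact hcm.isNilpotent_mul_left hn
      obtain ⟨N, hN⟩ := this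
      exact ⟨2 * N, by rw [pow_mul, hN]⟩
    obtain ⟨m, hm⟩ := hP
    have hk : ∀ x, aeval φ ((X - C ε) ^ m) x = 0 := fun x => by rw [map_pow, hm]; rfl
    by_cases hz : HZ f (Tm o n φ)
    · obtain ⟨D, h0, h1⟩ := top_index h.nil
      have hD : Odd D := by
        by_contra hc
        rw [Nat.not_odd_iff_even] at hc
        apply h1
        ext x
        have : (Tm o n φ ^ D) x = 0 := (LinearMap.BilinForm.Nondegenerate.ker_eq_bot h.nd |> ker_eq_bot.1) (by
          ext y
          have := hz (D + 1) hc.add_one y x (by rw [h0]; rfl) (by rw [h0]; rfl)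
          rw [Nat.add_sub_cancel, h.symm.eq] at this
          simpa using this)
        simpa using this
      obtain ⟨W, hW, hnd, hb, hev, s, t, hcc⟩ := ev_block h2 h he hk h0 h1 hD
      have ht := hind W hW hnd hb
      refine ⟨⟨s, t, HC.of_top h2 h hW hnd ht hcc⟩, fun ho => ?_, fun hh => absurd hz hh⟩
      rw [ht, finrank_top] at hev
      exact absurd hev (Nat.not_even_iff_odd.2 ho)
    · obtain ⟨t, x, hx, hx'⟩ := nonHZ h2 h.symm h.skew hz
      have i : IsO f φ o n ε t x := ⟨he, P_of_T h2 h he (hk x) hx, hx'⟩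
      have hne : Ob o n φ t x ≠ ⊥ := by
        intro hb
        have := i.mem h2 h 0
        rw [hb, Submodule.mem_bot] at this
        exact i.x0 (by simpa using this)
      have ht := hind _ (i.inv h2 h) (i.ndW h2 h) hne
      exact ⟨⟨_, _, HC.of_top h2 h (i.inv h2 h) (i.ndW h2 h) ht (i.hc h4 h)⟩, fun _ => ⟨ε, t, x, i⟩, fun _ => Or.inl ⟨ε, t, x, i⟩⟩
  · have hcop : IsCoprime r (X ^ 2 - 4) := (hr.coprime_iff_not_dvd).2 hc4
    obtain ⟨e, h0, h1⟩ := top_index hS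
    have hsa : ∀ (c : K[X]) x y, f x (aeval (Mm o φ) c y) = f y (aeval (Mm o φ) c x) := fun c x y => by
      rw [h.symm.eq, h.Msa]
    have hex : ∃ w, f w (aeval (Mm o φ) (r ^ e) w) ≠ 0 := by
      by_contra hc
      push Not at hc
      apply h1
      ext y
      have : (aeval (Mm o φ) r ^ e) y = 0 := (LinearMap.BilinForm.Nondegenerate.ker_eq_bot h.nd |> ker_eq_bot.1) (by
        ext x
        by_contra hxy
        obtain ⟨w, -, hw⟩ := polar (U := ⊤) h2 (hsa (r ^ e)) (x := x) (y := y) trivial trivial (by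
          rw [h.symm.eq, map_pow]; simpa using hxy)
        exact hw (hc w))
      simpa using this
    obtain ⟨w, hw⟩ := hex
    obtain ⟨hev, s, t, hcc, -⟩ := A_block h4 h hr hcop hS (Nat.succ_pos e) (w := w) (by rw [map_pow, h0]; rfl) hw hind
    refine ⟨⟨s, t, hcc⟩, fun ho => absurd hev (Nat.not_even_iff_odd.2 ho), fun hz => Or.inr ?_⟩
    obtain ⟨t, x, hx, hx'⟩ := nonHZ h2 h.symm h.skew hz
    obtain ⟨q, hq⟩ : ∃ q, q = (tq K n).2 := ⟨_, rfl⟩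
    have hT := h.T2 h2
    rw [← hq] at hT
    have hT2 : aeval (Mm o φ) ((X ^ 2 - 4) ^ (t + 1) * q ^ (2 * t + 1)) x = 0 := by
      have e1 := h.T3 h2 t
      rw [← hq] at e1
      rw [e1, mul_apply, hx, map_zero]
    by_cases hrq : r ∣ q
    · obtain ⟨c, hc⟩ := hrq
      have hcc : IsCoprime r c := by
        have hsep := tq_sep h2 h.nK
        rw [← hq, hc] at hsep
        exact hsep.isCoprime
      have hu : IsCoprime r ((X ^ 2 - 4) ^ (t + 1) * c ^ (2 * t + 1)) := hcop.pow_right.mul_right hcc.pow_right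
      have hx1 : aeval (Mm o φ) (r ^ (2 * t + 1)) x = 0 := by
        apply nil_inj hu hS
        rw [← ap, ← hT2, hc]; refine congrArg (fun z => aeval (Mm o φ) z x) ?_; rw [mul_pow]; ac_rfl
      obtain ⟨w, hw, hw'⟩ := polar (U := ker (aeval (Mm o φ) (r ^ (2 * t + 1)))) h2 (hsa (r ^ (2 * t)))
        (x := x) (y := aeval (Mm o φ) ((X ^ 2 - 4) ^ t * c ^ (2 * t)) x) hx1
        (by rw [mem_ker, ← ap, mul_comm, ap, hx1, map_zero]) (by
          rw [← ap]; rw [hT, hc, mul_pow] at hx'; convert hx' using 4; ac_rfl)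
      obtain ⟨-, s, t, h5, h6⟩ := A_block h4 h hr hcop hS (Nat.succ_pos (2 * t)) (w := w) hw hw' hind
      exact ⟨s, t, h5, h6 ⟨_, rfl⟩⟩
    · exfalso
      have hqc := (hr.coprime_iff_not_dvd).2 hrq
      have hx0 := nil_inj (hcop.pow_right.mul_right hqc.pow_right) hS hT2
      rw [hx0] at hx'; simp at hx'

theorem Main [Finite K] (h4 : ¬ IsSquare (-1 : K)) : ∀ (m : ℕ) (V : Type*) [AddCommGroup V] [Module K V] [FiniteDimensional K V]
    (f : BilinForm K V) (φ : End K V) (o n : ℕ) (_ : QS f φ o n) (_ : finrank K V = m), MainC f φ o n := by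
  intro m
  induction m using Nat.strong_induction_on with
  | _ m ih =>
  intro V _ _ _ f φ o n h hm
  have h2 := two_ne h4
  rcases subsingleton_or_nontrivial V with hsub | hnt
  · refine ⟨⟨1, 1, HC.triv f φ⟩, fun ho => ?_, fun hz => absurd ?_ hz⟩
    · rw [finrank_zero_of_subsingleton] at ho; exact absurd ho (by decide)
    · intro d _ x y _ _; rw [Subsingleton.elim x 0]; simp
  by_cases hind : ∀ W : Submodule K V, (∀ x ∈ W, φ x ∈ W) → (f.restrict W).Nondegenerate → W ≠ ⊥ → W = ⊤
  · exact Main_ind h4 h hind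
  push Not at hind
  obtain ⟨W, hW, hnd, hb, ht⟩ := hind
  have sp := Sp.of_nd h.symm hnd
  have hW' := orth_inv h.nd h.iso hW
  have hnd' := sp.nd' h.symm h.nd
  have hfr := sp.finrank
  have hlt : finrank K W < m := hm ▸ Submodule.finrank_lt ht
  have hpos : finrank K W ≠ 0 := fun h0 => hb (Submodule.finrank_eq_zero.1 h0)
  obtain ⟨⟨s, t, hc⟩, ho, hz⟩ := ih _ hlt W _ _ o n (h.restrict hW hnd) rfl
  obtain ⟨⟨s', t', hc'⟩, ho', hz'⟩ := ih (finrank K (f.orthogonal W)) (by omega) _ _ _ o n (h.restrict hW' hnd') rfl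
  refine ⟨⟨_, _, HC.glue h2 h.symm h.nd sp hW hW' hc hc'⟩, fun hodd => ?_, fun hnz => ?_⟩
  · rw [hfr, Nat.odd_add] at hodd
    by_cases h1 : Odd (finrank K W)
    · obtain ⟨ε, t, x, i⟩ := ho h1
      exact ⟨ε, t, x, i.lift⟩
    · obtain ⟨ε, t, x, i⟩ := ho' (by rw [← Nat.not_even_iff_odd, ← hodd]; exact h1)
      exact ⟨ε, t, x, i.lift⟩
  · have hg : ¬ HZ (f.restrict W) (Tm o n (φ.restrict hW)) ∨ ¬ HZ (f.restrict (f.orthogonal W)) (Tm o n (φ.restrict hW')) := by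
      by_contra hcon
      push Not at hcon
      rw [Tm_res, Tm_res] at hcon
      exact hnz (HZ.glue h.symm sp _ _ hcon.1 hcon.2)
    rcases hg with hg | hg
    · rcases hz hg with ⟨ε, t, x, i⟩ | ⟨a, b, h5, h6⟩
      · exact Or.inl ⟨ε, t, x, i.lift⟩
      · refine Or.inr ⟨a * s', b * t', HC.glue h2 h.symm h.nd sp hW hW' h5 hc', ?_⟩
        rw [← neg_mul, ← neg_mul]
        exact HC.glue h2 h.symm h.nd sp hW hW' h6 hc'
    · rcases hz' hg with ⟨ε, t, x, i⟩ | ⟨a, b, h5, h6⟩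
      · exact Or.inl ⟨ε, t, x, i.lift⟩
      · refine Or.inr ⟨s * a, t * b, HC.glue h2 h.symm h.nd sp hW hW' hc h5, ?_⟩
        rw [← mul_neg, ← mul_neg]
        exact HC.glue h2 h.symm h.nd sp hW hW' hc h6

end

section
variable {f : BilinForm K V} {φ : End K V} {o n : ℕ} {ε : K} {t : ℕ} {x y : V}

theorem eq_zero_of_sp {W W' : Submodule K V} (sp : Sp f W W') {u v : V} (hu : u ∈ W) (hv : v ∈ W') (h : u + v = 0) : u = 0 ∧ v = 0 := by
  have h1 : u = 0 := by
    have : u ∈ W ⊓ W' := ⟨hu, by rw [eq_neg_of_add_eq_zero_left h]; exact W'.neg_mem hv⟩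
    rwa [sp.compl.inf_eq_bot, Submodule.mem_bot] at this
  exact ⟨h1, by rwa [h1, zero_add] at h⟩

/-- project `y` off the O-block of `x`. -/
theorem proj [FiniteDimensional K V] (h2 : (2 : K) ≠ 0) (h : QS f φ o n) (i : IsO f φ o n ε t x) (j : IsO f φ o n ε t y)
    (h0 : f x ((Tm o n φ ^ (2 * t)) y) = 0) :
    ∃ u, IsO f φ o n ε t u ∧ u ∈ f.orthogonal (Ob o n φ t x) ∧ ∃ w ∈ Ob o n φ t x, y = w + u := by
  have sp := Sp.of_nd h.symm (i.ndW h2 h)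
  have hW := i.inv h2 h
  have hW' := orth_inv h.nd h.iso hW
  obtain ⟨w, u, hy⟩ := sp.exi y
  have hk := j.kil
  rw [hy, map_add] at hk
  have hk2 := (eq_zero_of_sp sp (inv_aeval hW _ _ w.2) (inv_aeval hW' _ _ u.2) hk).2
  have hT := h.skew
  have hle : Ob o n φ t x ≤ ker ((LinearMap.flip f) ((Tm o n φ ^ (2 * t)) y)) := Ob_le fun k => by
    rw [mem_ker, LinearMap.flip_apply]
    rcases k with _ | k
    · simpa using h0
    · rw [hT.pow, ← mul_apply, ← pow_add, show k + 1 + 2 * t = k + (2 * t + 1) by ring, pow_add (Tm o n φ), mul_apply, j.T0 h2 h]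
      simp
  have e1 := hle w.2
  rw [mem_ker, LinearMap.flip_apply] at e1
  have e2 : f u ((Tm o n φ ^ (2 * t)) w) = 0 := by
    have := inv_aeval hW (pT K o n ^ (2 * t)) w w.2
    rw [map_pow] at this
    exact (sp.symm h.symm).orth _ u.2 _ this
  have e3 : f u ((Tm o n φ ^ (2 * t)) u) ≠ 0 := by
    have := j.ne
    nth_rewrite 1 [hy] at this
    rw [map_add, LinearMap.add_apply, e1, zero_add, hy, map_add, map_add, e2, zero_add] at this
    exact this
  exact ⟨u, ⟨i.sg, hk2, e3⟩, u.2, w, w.2, hy⟩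

theorem Ob_orth (h2 : (2 : K) ≠ 0) [FiniteDimensional K V] (h : QS f φ o n) (i : IsO f φ o n ε t x) {s : ℕ} (hy : y ∈ f.orthogonal (Ob o n φ t x)) :
    Ob o n φ s y ≤ f.orthogonal (Ob o n φ t x) := Ob_le fun k => by
  have := inv_aeval (orth_inv h.nd h.iso (i.inv h2 h)) (pT K o n ^ k) y hy
  rwa [map_pow] at this

/-- `V` is the orthogonal sum of the two O-blocks. -/
theorem TB_sp [FiniteDimensional K V] (h2 : (2 : K) ≠ 0) (h : QS f φ o n) (i : IsO f φ o n ε t x) (j : IsO f φ o n ε t y)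
    (hy : y ∈ f.orthogonal (Ob o n φ t x)) (hd : finrank K V = 2 * (2 * t + 1)) : Sp f (Ob o n φ t x) (Ob o n φ t y) := by
  have sp := Sp.of_nd h.symm (i.ndW h2 h)
  have hfr := sp.finrank
  have : Ob o n φ t y = f.orthogonal (Ob o n φ t x) := by
    apply Submodule.eq_of_le_of_finrank_eq (Ob_orth h2 h i hy)
    rw [i.fr h2 h] at hfr
    rw [j.fr h2 h]; omega
  rw [this]; exact sp

theorem TB0 [Finite K] [FiniteDimensional K V] (h4 : ¬ IsSquare (-1 : K)) (h : QS f φ o n) (i : IsO f φ o n ε t x) (j : IsO f φ o n ε t y)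
    (hy : y ∈ f.orthogonal (Ob o n φ t x)) (hd : finrank K V = 2 * (2 * t + 1)) :
    HC f φ 1 1 ∧ HC f φ (- qc (f x ((Tm o n φ ^ (2 * t)) x))) (qc (f x ((Tm o n φ ^ (2 * t)) x))) ∧
    HC f φ (- qc (f y ((Tm o n φ ^ (2 * t)) y))) (qc (f y ((Tm o n φ ^ (2 * t)) y))) := by
  have h2 := two_ne h4
  have sp := TB_sp h2 h i j hy hd
  have hn := fun {x} (i : IsO f φ o n ε t x) => (i.hc h4 h).neg (i.ndW h2 h)
  have e1 : ∀ {x} (i : IsO f φ o n ε t x), nu (f.restrict (Ob o n φ t x)) 1 = - qc (f x ((Tm o n φ ^ (2 * t)) x)) := fun i => by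
    rw [i.nu h4 h one_ne_zero, qc_neg_one h4]; simp
  have e2 : ∀ {x} (i : IsO f φ o n ε t x), nu (f.restrict (Ob o n φ t x)) (-1) = qc (f x ((Tm o n φ ^ (2 * t)) x)) := fun i => by
    rw [i.nu h4 h (by simp), neg_neg, qc_one]; simp
  have k1 : ∀ A B : ℤˣ, A * B * B = A := by decide
  have k2 : ∀ A B : ℤˣ, B * (A * B) = A := by decide
  refine ⟨?_, ?_, ?_⟩
  · have := HC.glue h2 h.symm h.nd sp _ _ (i.hc h4 h) (j.hc h4 h)
    rwa [Int.units_mul_self] at this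
  · have := HC.glue h2 h.symm h.nd sp _ _ (hn i) (j.hc h4 h)
    rwa [e1 i, e2 i, k1, k1] at this
  · have := HC.glue h2 h.symm h.nd sp _ _ (i.hc h4 h) (hn j)
    rwa [e1 j, e2 j, k2, k2] at this

theorem TB2 [Finite K] [FiniteDimensional K V] (h4 : ¬ IsSquare (-1 : K)) (h : QS f φ o n) (i : IsO f φ o n ε t x) (j : IsO f φ o n ε t y)
    (hy : y ∈ f.orthogonal (Ob o n φ t x)) (hd : finrank K V = 2 * (2 * t + 1)) :
    HC f φ 1 (-1) ∧ HC f φ (-1) 1 := by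
  have h2 := two_ne h4
  obtain ⟨-, a1, a2⟩ := TB0 h4 h i j hy hd
  obtain ⟨A, hA⟩ : ∃ A, A = qc (f x ((Tm o n φ ^ (2 * t)) x)) := ⟨_, rfl⟩
  suffices hs : HC f φ A (-A) by
    rw [← hA] at a1
    rcases Int.units_eq_one_or A with rfl | rfl
    · exact ⟨hs, a1⟩
    · exact ⟨by simpa using a1, by simpa using hs⟩
  by_cases hAB : qc (f y ((Tm o n φ ^ (2 * t)) y)) = - A
  · rw [hAB] at a2; simpa using a2
  obtain ⟨c1, hc1⟩ : ∃ c, c = f x ((Tm o n φ ^ (2 * t)) x) := ⟨_, rfl⟩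
  obtain ⟨c2, hc2⟩ : ∃ c, c = f y ((Tm o n φ ^ (2 * t)) y) := ⟨_, rfl⟩
  have n1 : c1 ≠ 0 := hc1 ▸ i.ne
  have n2 : c2 ≠ 0 := hc2 ▸ j.ne
  have hsq : IsSquare (c1 * c2) := by
    rw [← qc_eq_one, qc_mul n1 n2, hc1, ← hA, hc2]
    have key : ∀ A B : ℤˣ, B ≠ - A → A * B = 1 := by decide
    exact key _ _ hAB
  obtain ⟨s, hs⟩ := hsq
  have hs0 : s ≠ 0 := by rintro rfl; simp [n1, n2] at hs
  obtain ⟨p, hp⟩ := CharP.exists K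
  haveI : NeZero p := ⟨by rintro rfl; haveI := CharP.charP_to_charZero K; exact not_finite K⟩
  obtain ⟨a, b, hab⟩ := CharP.sq_add_sq K p (-1)
  push_cast at hab
  have hxy : f x ((Tm o n φ ^ (2 * t)) y) = 0 := by
    have := inv_aeval (orth_inv h.nd h.iso (i.inv h2 h)) (pT K o n ^ (2 * t)) y hy
    rw [map_pow] at this
    exact this x (by simpa using i.mem h2 h 0)
  have hyx : f y ((Tm o n φ ^ (2 * t)) x) = 0 := by rw [h.skew.ev h.symm, hxy]
  have hval : ∀ u v u' v' : K, f (u • x + v • y) ((Tm o n φ ^ (2 * t)) (u' • x + v' • y)) = u * u' * c1 + v * v' * c2 := fun u v u' v' => by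
    simp only [map_add, map_smul, LinearMap.add_apply, LinearMap.smul_apply, hxy, hyx, ← hc1, ← hc2, smul_eq_mul]; ring
  have hkil : ∀ u v : K, aeval φ ((X - C ε) ^ (2 * t + 1)) (u • x + v • y) = 0 := fun u v => by
    rw [map_add, map_smul, map_smul, i.kil, j.kil]; simp
  obtain ⟨b', hb'⟩ : ∃ b' : K, b' * b' * c2 = b * b * c1 := ⟨b * (c1 / s), by
    field_simp; linear_combination ((b:K) ^ 2) * hs⟩
  have hv1 : f ((a : K) • x + b' • y) ((Tm o n φ ^ (2 * t)) ((a : K) • x + b' • y)) = - c1 := by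
    rw [hval]; linear_combination hb' + c1 * hab
  have i' : IsO f φ o n ε t ((a : K) • x + b' • y) := ⟨i.sg, hkil _ _, by rw [hv1]; simpa using n1⟩
  have j' : IsO f φ o n ε t ((-(b' * c2)) • x + (a * c1) • y) := ⟨i.sg, hkil _ _, by
    rw [hval]
    have : -(b' * c2) * -(b' * c2) * c1 + a * c1 * (a * c1) * c2 = - (c1 * c1 * c2) := by
      linear_combination (c2 * c1) * hb' + (c1 ^ 2 * c2) * hab
    rw [this]; simp [n1, n2]⟩
  obtain ⟨u, iu, hu, -⟩ := proj h2 h i' j' (by rw [hval]; ring)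
  obtain ⟨-, b1, -⟩ := TB0 h4 h i' iu hu hd
  rw [hv1, qc_neg h4 n1, hc1, ← hA] at b1
  simpa using b1

theorem TB3 [Finite K] [FiniteDimensional K V] (h4 : ¬ IsSquare (-1 : K)) (h : QS f φ o n) (i : IsO f φ o n ε t x) (j : IsO f φ o n ε t y)
    (hy : y ∈ f.orthogonal (Ob o n φ t x)) (hd : finrank K V = 2 * (2 * t + 1)) (hn : nu f (-1) ≠ 1) : HC f φ (-1) (-1) := by
  have h1 := (TB0 h4 h i j hy hd).1.neg h.nd
  have h3 := nu_dim h4 h.symm h.nd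
  rw [hd, pow_mul] at h3
  have key : ∀ A B : ℤˣ, B ≠ 1 → A * B = ((-1) ^ 2) ^ (2 * t + 1) → A * 1 = -1 ∧ B * 1 = -1 := by
    rw [show ((-1 : ℤˣ) ^ 2) = 1 by decide, one_pow]; decide
  obtain ⟨e1, e2⟩ := key _ _ hn h3
  rwa [e1, e2] at h1

end

section
variable {f : BilinForm K V} {φ : End K V} {o n : ℕ} {ε : K} {t : ℕ} {x y : V}

theorem Iso.ford [Finite K] [FiniteDimensional K V] (hf : f.Nondegenerate) {u : End K V} (hu : Iso f u) : ∃ N, 0 < N ∧ u ^ N = 1 := by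
  haveI : Finite V := Module.finite_of_finite K
  haveI : Finite (V →ₗ[K] V) := DFunLike.finite _
  obtain ⟨a, b, hab, he⟩ := Finite.exists_ne_map_eq_of_infinite (fun i : ℕ => (u ^ i : End K V))
  have key : ∀ a b, a < b → u ^ a = u ^ b → ∃ N, 0 < N ∧ u ^ N = 1 := fun a b hlt he => by
    refine ⟨b - a, by omega, ?_⟩
    ext x
    apply (hu.pow a).inj hf
    rw [← mul_apply, ← pow_add, Nat.add_sub_cancel' hlt.le, ← he]; rfl
  rcases lt_or_gt_of_ne hab with h | h
  · exact key a b h he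
  · exact key b a h he.symm

theorem two_part [Finite K] [FiniteDimensional K V] (hf : f.Nondegenerate) {u : End K V} (hu : Iso f u) :
    ∃ l k, Odd l ∧ (u ^ l) ^ 2 ^ k = 1 := by
  obtain ⟨N, hN, h⟩ := hu.ford hf
  obtain ⟨k, l, hl, rfl⟩ := Nat.exists_eq_two_pow_mul_odd hN.ne'
  exact ⟨l, k, hl, by rw [← pow_mul, mul_comm, h]⟩

theorem odd_pow {s : ℤˣ} {l : ℕ} (hl : Odd l) : s ^ l = s := by
  rcases Int.units_eq_one_or s with rfl | rfl
  · simp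
  · exact hl.neg_one_pow

theorem Z_rev (h : QS f φ o n) {α : End K V} (hb : φ * α * φ = α) (he : ε = 1 ∨ ε = -1) {d : ℕ}
    (hx : aeval φ ((X - C ε) ^ d) x = 0) : aeval φ ((X - C ε) ^ d) (α x) = 0 := by
  have hee : ε * ε = 1 := by rcases he with rfl | rfl <;> ring
  have h1 : aeval φ (X - C ε) * α = (α * φ ^ (o - 1)) * (-ε • aeval φ (X - C ε)) := by
    have e1 : φ * α = α * φ ^ (o - 1) := ((h.rev hb).2).symm
    rw [map_sub, aeval_X, aeval_C, Algebra.algebraMap_eq_smul_one, sub_mul, e1, mul_assoc α, smul_sub, mul_sub, mul_smul_comm, h.pm, smul_smul]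
    simp only [smul_mul_assoc, one_mul, mul_smul_comm, mul_one, mul_sub, neg_mul, hee]
    module
  have hcm : Commute (φ ^ (o - 1)) (aeval φ (X - C ε)) := by
    have := aeval_comm φ (X ^ (o - 1)) (X - C ε)
    rwa [map_pow, aeval_X] at this
  have key : ∀ d, ∃ q : K[X], aeval φ (X - C ε) ^ d * α = α * aeval φ q * aeval φ (X - C ε) ^ d := by
    intro d
    induction d with
    | zero => exact ⟨1, by simp⟩
    | succ d ih =>
      obtain ⟨q, hq⟩ := ih
      refine ⟨C (-ε) * X ^ (o - 1) * q, ?_⟩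
      rw [pow_succ', mul_assoc, hq, ← mul_assoc, ← mul_assoc, h1]
      have : aeval φ (C (-ε) * X ^ (o - 1) * q) = -ε • (φ ^ (o - 1) * aeval φ q) := by
        rw [map_mul, map_mul, aeval_C, Algebra.algebraMap_eq_smul_one]; simp
      rw [this]
      simp only [mul_smul_comm, smul_mul_assoc, mul_assoc]
      rw [← mul_assoc (aeval φ (X - C ε)), (aeval_comm φ (X - C ε) q).eq, mul_assoc]
  obtain ⟨q, hq⟩ := key d
  rw [map_pow, ← mul_apply, hq, mul_apply, ← map_pow, hx, map_zero]

theorem h_rev [FiniteDimensional K V] (h : QS f φ o n) {α : End K V} (hα : Iso f α) (hb : φ * α * φ = α) (t : ℕ) (x y : V) :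
    f (α x) ((Tm o n φ ^ (2 * t)) (α y)) = f x ((Tm o n φ ^ (2 * t)) y) := by
  have := Tg (by ring) (h.revT hb) (2 * t) y
  rw [pow_mul (-1 : K), neg_one_sq, one_pow, one_smul] at this
  rw [← this, hα]

/-- eigenvector with nonzero value for a 2-power isometry of a form of rank one. -/
theorem eig (h2 : (2 : K) ≠ 0) {B : BilinForm K V} (hs : ∀ x y, B x y = B y x) {g : End K V} (hg : Iso B g) {k : ℕ} (hk : g ^ 2 ^ k = 1)
    (hx : B x x ≠ 0) (hr : ∀ y, B x y = 0 → B y y = 0) : ∃ (z : V) (l : K), B z z ≠ 0 ∧ g z = l • z ∧ (l = 1 ∨ l = -1) := by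
  have hr2 : ∀ y, B x y = 0 → ∀ z, B z y = 0 := fun y hy z => by
    have e1 : B x (z - (B x z / B x x) • x) = 0 := by simp [hx]
    have e2 := hr _ (by rw [map_add, e1, hy, add_zero] : B x (z - (B x z / B x x) • x + y) = 0)
    have e3 : (2 : K) * B (z - (B x z / B x x) • x) y = 0 := by
      obtain ⟨w, hw⟩ : ∃ w, w = z - (B x z / B x x) • x := ⟨_, rfl⟩
      rw [← hw] at e1 e2 ⊢
      simp only [map_add, LinearMap.add_apply, hr _ e1, hr _ hy, hs y w] at e2
      linear_combination e2
    simpa [h2, hy] using e3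
  obtain ⟨l, hl⟩ : ∃ l, l = B x (g x) / B x x := ⟨_, rfl⟩
  have e1 : B x (g x - l • x) = 0 := by simp [hl, hx]
  have e2 := hr2 _ e1
  have hl2 : l * l = 1 := by
    have h1 := e2 (g x)
    have h3 := e2 x
    simp only [map_sub, map_smul, smul_eq_mul, hg x x, hs (g x) x] at h1 h3
    have : (l * l - 1) * B x x = 0 := by linear_combination l * (-h3) - h1
    rcases mul_eq_zero.1 this with h | h
    · linear_combination h
    · exact absurd h hx
  obtain ⟨G, hG⟩ : ∃ G, G = l • g := ⟨_, rfl⟩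
  have hGk : G ^ (2 ^ (k + 1)) = 1 := by
    rw [hG, _root_.smul_pow, pow_succ, pow_mul g, hk, mul_comm, pow_mul, sq, hl2]; simp
  have hGi : Iso B G := fun u v => by
    rw [hG]; simp only [LinearMap.smul_apply, map_smul, smul_eq_mul, hg u v]; linear_combination B u v * hl2
  obtain ⟨N, hN⟩ : ∃ N, 2 ^ (k + 1) = N + 1 := ⟨2 ^ (k + 1) - 1, by have := Nat.one_le_two_pow (n := k + 1); omega⟩
  have e3 : ∀ j z, B z ((G ^ j) x) = B z x := by
    intro j
    induction j with
    | zero => simp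
    | succ j ih =>
      intro z
      have hz : z = G ((G ^ N) z) := by
        rw [← mul_apply, ← pow_succ', ← hN, hGk]; rfl
      have e4 := e2 z
      rw [hz, pow_succ', mul_apply, hGi, ih, ← hGi, ← hz, hG, LinearMap.smul_apply]
      simp only [map_sub, map_smul, smul_eq_mul] at e4 ⊢
      linear_combination l * e4 + B z x * hl2
  obtain ⟨z, hz⟩ : ∃ z, z = ∑ j ∈ Finset.range (2 ^ (k + 1)), (G ^ j) x := ⟨_, rfl⟩
  have e5 : ∀ w, B w z = 2 ^ (k + 1) * B w x := fun w => by
    rw [hz, map_sum]; simp [e3]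
  refine ⟨z, l, ?_, ?_, ?_⟩
  · rw [e5, hs, e5]; simp [h2, hx]
  · have : G z = z := by
      have h1 := Finset.sum_range_succ (fun j => (G ^ j) x) (2 ^ (k + 1))
      rw [Finset.sum_range_succ', hGk] at h1
      simp only [pow_zero, End.one_apply] at h1
      have h3 := add_right_cancel h1
      rw [← hz] at h3
      rw [hz, map_sum]
      simpa [pow_succ', hz] using h3
    rw [hG, LinearMap.smul_apply] at this
    nth_rewrite 2 [← this]
    rw [smul_smul, hl2, one_smul]
  · have : (l - 1) * (l + 1) = 0 := by linear_combination hl2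
    rcases mul_eq_zero.1 this with h | h
    · exact Or.inl (by linear_combination h)
    · exact Or.inr (by linear_combination h)

end

section
variable {f : BilinForm K V} {φ : End K V} {o n : ℕ} {ε : K} {t : ℕ} {x y : V}

theorem OT.lift {W : Submodule K V} {hW : ∀ x ∈ W, φ x ∈ W} (h : OT (f.restrict W) (φ.restrict hW) o n) : OT f φ o n := by
  obtain ⟨ε, t, x, i⟩ := h
  exact ⟨ε, t, x, i.lift⟩

theorem compare [Finite K] [FiniteDimensional K V] (h4 : ¬ IsSquare (-1 : K)) (h : QS f φ o n) (hO : ¬ OT f φ o n) {α β : End K V}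
    (hα : Iso f α) (ha : φ * α * φ = α) (hβ : Iso f β) (hb : φ * β * φ = β) :
    ∃ η : ℤˣ, chi f 1 α = η * chi f 1 β ∧ chi f (-1) α = η * chi f (-1) β ∧ (HZ f (Tm o n φ) → η = 1) := by
  have h2 := two_ne h4
  have hu : Iso f (α * β) := hα.mul hβ
  obtain ⟨l, k, hl, hk⟩ := two_part h.nd hu
  have hc0 : Commute (α * β) φ := by
    show α * β * φ = φ * (α * β)
    rw [mul_assoc, (h.rev hb).1, ← mul_assoc, (h.rev ha).2, mul_assoc]
  have hc : Commute ((α * β) ^ l) φ := hc0.pow_left l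
  have hchi : ∀ a, chi f a ((α * β) ^ l) = chi f a α * chi f a β := fun a => by
    rw [chi_pow h.nd hu, odd_pow hl, chi_mul h.nd hα hβ]
  obtain ⟨g, hg⟩ : ∃ g, g = (α * β) ^ l := ⟨_, rfl⟩
  have hgi : Iso f g := hg ▸ hu.pow l
  rw [← hg] at hk hc hchi
  have hcT : g * Tm o n φ = (1 : K) • (Tm o n φ * g) := by
    rw [one_smul]
    unfold Tm
    induction (pT K o n) using Polynomial.induction_on' with
    | add p q hp hq => rw [map_add, mul_add, add_mul, hp, hq]
    | monomial m a => 
      rw [aeval_monomial, Algebra.algebraMap_eq_smul_one]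
      simp only [smul_mul_assoc, one_mul, mul_smul_comm]
      rw [(hc.pow_right m).eq]
  have hev : Even (finrank K (ker (g + 1))) := by
    by_contra hodd
    rw [Nat.not_even_iff_odd] at hodd
    obtain ⟨c1, c2⟩ := g1_compl h2 h.nd hgi hk
    have sp : Sp f (ker (g + 1)) (range (g + 1)) := ⟨c1, fun x hx y hy => (c2 x hx y hy).1⟩
    have hW : ∀ x ∈ ker (g + 1), φ x ∈ ker (g + 1) :=
      ker_inv (hc.symm.add_right (Commute.one_right _))
    obtain ⟨-, ho, -⟩ := Main h4 _ _ _ _ o n (h.restrict hW (sp.nd h.symm h.nd)) rfl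
    exact hO (ho hodd).lift
  have hd := chi_det_eq h4 h.symm h.nd hgi (n := 0) (by rw [det_iso2 h2 h.nd hgi hk hev]; simp)
  rw [pow_zero] at hd
  have k1 : ∀ A B : ℤˣ, A = A * B * B := by decide
  have k2 : ∀ A B E : ℤˣ, E * (A * B) = 1 → A = E * B := by decide
  refine ⟨chi f 1 g, ?_, ?_, fun hz => ?_⟩
  · rw [hchi]; exact k1 _ _
  · rw [hchi (-1)] at hd; exact k2 _ _ _ hd
  · exact (G0 h4 one_ne_zero (by ring) _ V f h.symm h.nd rfl _ h.skew h.nil hz g hgi k hk hcT).1 rfl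

def OO (f : BilinForm K V) (φ : End K V) (o n : ℕ) : Prop :=
  ∃ ε t x y, IsO f φ o n ε t x ∧ IsO f φ o n ε t y ∧ ∀ j, f ((Tm o n φ ^ j) x) y = 0

/-- α acts on the O-block of an eigenvector. -/
theorem Ob_rev [FiniteDimensional K V] (h : QS f φ o n) {α : End K V} (ha : φ * α * φ = α) {l : K} (hl : α x = l • x) (j : ℕ) :
    α ((Tm o n φ ^ j) x) = ((-1 : K) ^ j * l) • (Tm o n φ ^ j) x := by
  rw [Tg (by ring) (h.revT ha), hl, map_smul, smul_smul]

theorem Ob_rinv [FiniteDimensional K V] (h2 : (2 : K) ≠ 0) (h : QS f φ o n) (i : IsO f φ o n ε t x) {α : End K V} (ha : φ * α * φ = α) {l : K} (hl : α x = l • x) :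
    ∀ y ∈ Ob o n φ t x, α y ∈ Ob o n φ t x := fun y hy => by
  have : Ob o n φ t x ≤ (Ob o n φ t x).comap α := Ob_le fun j => by
    rw [Submodule.mem_comap, Ob_rev h ha hl]
    exact Submodule.smul_mem _ _ (i.mem h2 h j)
  exact this hy

theorem rev_res {W : Submodule K V} {α : End K V} (ha : φ * α * φ = α) (hW : ∀ x ∈ W, φ x ∈ W) (hW' : ∀ x ∈ W, α x ∈ W) :
    φ.restrict hW * α.restrict hW' * φ.restrict hW = α.restrict hW' := by
  ext x; simpa using congrArg (fun g : End K V => g x) ha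

theorem pow_res {W : Submodule K V} {α : End K V} {k : ℕ} (ha : α ^ k = 1) (hW' : ∀ x ∈ W, α x ∈ W) :
    (α.restrict hW') ^ k = 1 := by
  ext x; rw [rpow, ha]; rfl

theorem GF [Finite K] (h4 : ¬ IsSquare (-1 : K)) : ∀ (m : ℕ) (V : Type*) [AddCommGroup V] [Module K V] [FiniteDimensional K V]
    (f : BilinForm K V) (φ : End K V) (o n : ℕ) (_ : QS f φ o n) (_ : finrank K V = m)
    (α : End K V) (_ : Iso f α) (_ : φ * α * φ = α) (k : ℕ) (_ : α ^ 2 ^ k = 1),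
    HC f φ (chi f 1 α) (chi f (-1) α) ∨ OO f φ o n := by
  intro m
  induction m using Nat.strong_induction_on with
  | _ m ih =>
  intro V _ _ _ f φ o n h hm α hα ha k hk
  have h2 := two_ne h4
  by_cases hO : OT f φ o n
  · obtain ⟨ε, t, x, i⟩ := hO
    by_cases hy : ∃ y, IsO f φ o n ε t y ∧ f x ((Tm o n φ ^ (2 * t)) y) = 0
    · obtain ⟨y, j, h0⟩ := hy
      obtain ⟨u, iu, hu, -⟩ := proj h2 h i j h0
      exact Or.inr ⟨ε, t, x, u, i, iu, fun j => hu _ (i.mem h2 h j)⟩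
    push Not at hy
    obtain ⟨Z, hZ⟩ : ∃ Z, Z = ker (aeval φ ((X - C ε) ^ (2 * t + 1))) := ⟨_, rfl⟩
    have hZα : ∀ z ∈ Z, α z ∈ Z := fun z hz => by
      rw [hZ] at hz ⊢
      exact Z_rev h ha i.sg hz
    have hBv : ∀ u v : Z, ((f.compRight (Tm o n φ ^ (2 * t))).restrict Z) u v = f u ((Tm o n φ ^ (2 * t)) v) := fun u v => rfl
    obtain ⟨z, l, hz, hl, hl1⟩ := eig (x := (⟨x, by rw [hZ]; exact i.kil⟩ : Z)) h2 (B := (f.compRight (Tm o n φ ^ (2 * t))).restrict Z)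
      (fun u v => by rw [hBv, hBv]; exact h.skew.ev h.symm t _ _) (g := α.restrict hZα)
      (fun u v => by rw [hBv, hBv]; exact h_rev h hα ha t _ _) (pow_res hk hZα) (by rw [hBv]; exact i.ne) (fun v hv => by
        rw [hBv] at hv ⊢
        by_contra hne
        have hv2 := hZ.le v.2
        exact hy v ⟨i.sg, hv2, hne⟩ hv)
    rw [hBv] at hz
    have hz2 := hZ.le z.2
    have iz : IsO f φ o n ε t z := ⟨i.sg, hz2, hz⟩
    have hlz : α z = l • (z : V) := by simpa using congrArg Subtype.val hl
    have hll : l * l = 1 := by rcases hl1 with rfl | rfl <;> ring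
    have hWα := Ob_rinv h2 h iz ha hlz
    have hW := iz.inv h2 h
    have sp := Sp.of_nd h.symm (iz.ndW h2 h)
    have hW' := orth_inv h.nd h.iso hW
    have hWα' := orth_inv h.nd hα hWα
    have hfr := sp.finrank
    rw [iz.fr h2 h] at hfr
    have hinv : α.restrict hWα * α.restrict hWα = 1 := iz.ext h2 h fun j => by
      apply Subtype.ext
      show α (α ((Tm o n φ ^ j) (z : V))) = (Tm o n φ ^ j) (z : V)
      rw [Ob_rev h ha hlz, map_smul, Ob_rev h ha hlz, smul_smul]
      have : (-1 : K) ^ j * l * ((-1) ^ j * l) = 1 := by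
        have h1 : ((-1 : K) ^ j) * (-1) ^ j = 1 := by rw [← mul_pow]; simp
        linear_combination (l * l) * h1 + hll
      rw [this, one_smul]
    rcases ih (finrank K (f.orthogonal (Ob o n φ t z))) (by omega) _ _ _ o n (h.restrict hW' (sp.nd' h.symm h.nd)) rfl (α.restrict hWα') (hα.restrict hWα')
      (rev_res ha hW' hWα') k (pow_res hk hWα') with hc | ⟨ε', t', u, v, iu, iv, huv⟩
    · left
      have := HC.glue h2 h.symm h.nd sp hW hW' ⟨α.restrict hWα, hα.restrict hWα, hinv, rev_res ha hW hWα, rfl, rfl⟩ hc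
      rwa [← chi_split h2 h.symm h.nd sp hα hWα hWα', ← chi_split h2 h.symm h.nd sp hα hWα hWα'] at this
    · right
      refine ⟨ε', t', u, v, iu.lift, iv.lift, fun j => ?_⟩
      have := huv j
      rw [← Tm_resp hW']; exact this
  · left
    obtain ⟨⟨s, t, β, hβ, hbb, hb, e1, e2⟩, -, hz⟩ := Main h4 _ V f φ o n h rfl
    by_cases hZ : HZ f (Tm o n φ)
    · obtain ⟨η, c1, c2, c3⟩ := compare h4 h hO hα ha hβ hb
      rw [c3 hZ, one_mul] at c1 c2
      exact ⟨β, hβ, hbb, hb, c1.symm, c2.symm⟩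
    · rcases hz hZ with hO' | ⟨s, t, ⟨β, hβ, hbb, hb, e1, e2⟩, h6⟩
      · exact absurd hO' hO
      · obtain ⟨η, c1, c2, c3⟩ := compare h4 h hO hα ha hβ hb
        rcases Int.units_eq_one_or η with rfl | rfl
        · rw [one_mul] at c1 c2
          exact ⟨β, hβ, hbb, hb, c1.symm, c2.symm⟩
        · rw [c1, c2, e1, e2]; simpa using h6

end

section
variable {f : BilinForm K V} {φ : End K V} {o n : ℕ} {ε : K} {t : ℕ} {x y : V}

structure TB (f : BilinForm K V) (φ : End K V) (o n : ℕ) (ε : K) (t : ℕ) (x y : V) : Prop where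
  i : IsO f φ o n ε t x
  j : IsO f φ o n ε t y
  ort : ∀ k, f ((Tm o n φ ^ k) x) y = 0

theorem TB.hy [FiniteDimensional K V] (b : TB f φ o n ε t x y) : y ∈ f.orthogonal (Ob o n φ t x) := by
  have : Ob o n φ t x ≤ ker ((LinearMap.flip f) y) := Ob_le fun k => by
    rw [mem_ker, LinearMap.flip_apply]; exact b.ort k
  intro z hz
  have := this hz
  rwa [mem_ker, LinearMap.flip_apply] at this

theorem TB.of_hy [FiniteDimensional K V] (h2 : (2 : K) ≠ 0) (h : QS f φ o n) (i : IsO f φ o n ε t x) (j : IsO f φ o n ε t y)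
    (hy : y ∈ f.orthogonal (Ob o n φ t x)) : TB f φ o n ε t x y := ⟨i, j, fun k => hy _ (i.mem h2 h k)⟩

theorem TB.h0 (h : QS f φ o n) (b : TB f φ o n ε t x y) : f x ((Tm o n φ ^ (2 * t)) y) = 0 := by
  have := b.ort (2 * t)
  rwa [h.skew.pow, pow_mul, neg_one_sq, one_pow, one_mul] at this

theorem TB.down {W : Submodule K V} (hW : ∀ x ∈ W, φ x ∈ W) (b : TB f φ o n ε t x y) (hx : x ∈ W) (hy : y ∈ W) :
    TB (f.restrict W) (φ.restrict hW) o n ε t ⟨x, hx⟩ ⟨y, hy⟩ :=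
  ⟨IsO.down hW (x := ⟨x, hx⟩) b.i, IsO.down hW (x := ⟨y, hy⟩) b.j, fun k => by
    have := b.ort k
    rw [← Tm_resp hW o n k ⟨x, hx⟩] at this; exact this⟩

theorem TB.sub [FiniteDimensional K V] (h2 : (2 : K) ≠ 0) (h : QS f φ o n) (b : TB f φ o n ε t x y) :
    ∃ U : Submodule K V, (∀ z ∈ U, φ z ∈ U) ∧ (f.restrict U).Nondegenerate ∧ finrank K U = 2 * (2 * t + 1) ∧ U = Ob o n φ t x ⊔ Ob o n φ t y ∧ x ∈ U ∧ y ∈ U := by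
  have ho := Ob_orth h2 h b.i (s := t) b.hy
  have iW := b.i.inv h2 h
  have jW := b.j.inv h2 h
  have sp := Sp.of_nd h.symm (b.i.ndW h2 h)
  have dj : Disjoint (Ob o n φ t x) (Ob o n φ t y) := sp.compl.disjoint.mono_right ho
  refine ⟨_, fun z hz => ?_, nd_of_sep (h.symm.restrict _) fun z hz => ?_, ?_, rfl, Submodule.mem_sup_left (by simpa using b.i.mem h2 h 0), Submodule.mem_sup_right (by simpa using b.j.mem h2 h 0)⟩
  · obtain ⟨u, hu, v, hv, rfl⟩ := mem_sup.1 hz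
    rw [map_add]
    exact Submodule.add_mem_sup (iW u hu) (jW v hv)
  · obtain ⟨z, hz'⟩ := z
    obtain ⟨u, hu, v, hv, rfl⟩ := mem_sup.1 hz'
    have e1 : (⟨u, hu⟩ : Ob o n φ t x) = 0 := (b.i.ndW h2 h).1 _ fun w => by
      have := hz ⟨w, Submodule.mem_sup_left w.2⟩
      have e3 : f v w = 0 := by rw [h.symm.eq v w]; exact ho hv _ w.2
      simpa [e3] using this
    have e2 : (⟨v, hv⟩ : Ob o n φ t y) = 0 := (b.j.ndW h2 h).1 _ fun w => by
      have := hz ⟨w, Submodule.mem_sup_right w.2⟩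
      have e3 : f u w = 0 := ho w.2 _ hu
      simpa [e3] using this
    have e3 : u = 0 := by simpa using e1
    have e4 : v = 0 := by simpa using e2
    apply Subtype.ext; simp [e3, e4]
  · have := Submodule.finrank_sup_add_finrank_inf_eq (Ob o n φ t x) (Ob o n φ t y)
    rw [dj.eq_bot, finrank_bot, b.i.fr h2 h, b.j.fr h2 h] at this
    omega

/-- the two coordinates modulo the radical of `h`. -/
noncomputable def L2 (f : BilinForm K V) (A : End K V) (x y : V) : V →ₗ[K] K × K :=
  (f x ∘ₗ A).prod (f y ∘ₗ A)

theorem TB.L2fr [FiniteDimensional K V] (h : QS f φ o n) (b : TB f φ o n ε t x y) :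
    2 + finrank K (ker (L2 f (Tm o n φ ^ (2 * t)) x y)) = finrank K V := by
  have h0 := b.h0 h
  have h1 : f y ((Tm o n φ ^ (2 * t)) x) = 0 := by rw [h.skew.ev h.symm]; exact h0
  have hs : range (L2 f (Tm o n φ ^ (2 * t)) x y) = ⊤ := LinearMap.range_eq_top.2 fun ⟨a, c⟩ =>
    ⟨(a / f x ((Tm o n φ ^ (2 * t)) x)) • x + (c / f y ((Tm o n φ ^ (2 * t)) y)) • y, by
      have := b.i.ne
      have := b.j.ne
      simp [L2, h0, h1]; constructor <;> field_simp⟩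
  have := LinearMap.finrank_range_add_finrank_ker (L2 f (Tm o n φ ^ (2 * t)) x y)
  rw [hs, finrank_top] at this
  simpa using this

theorem TB.dec [FiniteDimensional K V] (h2 : (2 : K) ≠ 0) (h : QS f φ o n) (b : TB f φ o n ε t x y) (hd : finrank K V = 2 * (2 * t + 1)) (u : V) :
    (∃ (a c : K) (w : V), u = a • x + c • y + Tm o n φ w) ∧ (Tm o n φ ^ (2 * t + 1)) u = 0 ∧ aeval φ ((X - C ε) ^ (2 * t + 1)) u = 0 := by
  have sp := TB_sp h2 h b.i b.j b.hy hd
  have hO : ∀ z, IsO f φ o n ε t z → ∀ u ∈ Ob o n φ t z, (∃ (a : K) (w : V), u = a • z + Tm o n φ w) ∧ (Tm o n φ ^ (2 * t + 1)) u = 0 ∧ aeval φ ((X - C ε) ^ (2 * t + 1)) u = 0 := by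
    intro z i u hu
    have l1 : Ob o n φ t z ≤ (K ∙ z) ⊔ range (Tm o n φ) := Ob_le fun k => by
      rcases k with _ | k
      · exact Submodule.mem_sup_left (by simpa using mem_span_singleton_self z)
      · exact Submodule.mem_sup_right ⟨(Tm o n φ ^ k) z, by rw [pow_succ']; rfl⟩
    have l2 : Ob o n φ t z ≤ ker (Tm o n φ ^ (2 * t + 1)) := Ob_le fun k => by
      rw [mem_ker, ← mul_apply, ← pow_add, add_comm, pow_add (Tm o n φ), mul_apply, i.T0 h2 h, map_zero]
    have l3 : Ob o n φ t z ≤ ker (aeval φ ((X - C ε) ^ (2 * t + 1))) := Ob_le fun k => by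
      rw [mem_ker, Tm, ← map_pow, ← ap, mul_comm, ap, i.kil, map_zero]
    obtain ⟨_, hv, _, ⟨w, rfl⟩, rfl⟩ := mem_sup.1 (l1 hu)
    obtain ⟨a, rfl⟩ := mem_span_singleton.1 hv
    exact ⟨⟨a, w, rfl⟩, l2 hu, l3 hu⟩
  obtain ⟨⟨u, hu⟩, ⟨v, hv⟩, rfl⟩ := sp.exi u
  obtain ⟨⟨a, w, e1⟩, e2, e3⟩ := hO x b.i u hu
  obtain ⟨⟨c, w', e4⟩, e5, e6⟩ := hO y b.j v hv
  refine ⟨⟨a, c, w + w', ?_⟩, by simp [e2, e5], by rw [map_add, e3, e6, add_zero]⟩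
  show u + v = _
  rw [e1, e4, map_add]; abel

theorem TB.rad [FiniteDimensional K V] (h2 : (2 : K) ≠ 0) (h : QS f φ o n) (b : TB f φ o n ε t x y) (hd : finrank K V = 2 * (2 * t + 1)) {u : V}
    (hu : L2 f (Tm o n φ ^ (2 * t)) x y u = 0) : ∃ w, u = Tm o n φ w := by
  obtain ⟨⟨a, c, w, rfl⟩, -, -⟩ := b.dec h2 h hd u
  have h0 := b.h0 h
  have h1 : f y ((Tm o n φ ^ (2 * t)) x) = 0 := by rw [h.skew.ev h.symm]; exact h0
  have hw : (Tm o n φ ^ (2 * t)) (Tm o n φ w) = 0 := by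
    rw [← mul_apply, ← pow_succ]; exact (b.dec h2 h hd w).2.1
  simp [L2, h0, h1, hw, b.i.ne, b.j.ne] at hu
  exact ⟨w, by simp [hu.1, hu.2]⟩

theorem TB.jz [FiniteDimensional K V] (h2 : (2 : K) ≠ 0) (h : QS f φ o n) (b : TB f φ o n ε t x y) (hd : finrank K V = 2 * (2 * t + 1)) {j : ℕ}
    (j0 : j ≠ 0) (jd : j ≠ 2 * t + 1) : Jz (Tm o n φ) j := by
  rw [Jz_link h.symm h.nd h.skew]
  intro u v hu hv
  rcases lt_or_gt_of_ne jd with hj | hj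
  · have hu2 : (Tm o n φ ^ (2 * t)) u = 0 := by
      rw [show 2 * t = (2 * t - j) + j by omega, pow_add (Tm o n φ), mul_apply, hu, map_zero]
    obtain ⟨w, rfl⟩ := b.rad h2 h hd (u := u) (by simp [L2, hu2])
    rw [h.skew, ← mul_apply, ← pow_succ', show j - 1 + 1 = j by omega, hv]; simp
  · rw [show j - 1 = (j - 1 - (2 * t + 1)) + (2 * t + 1) by omega, pow_add (Tm o n φ), mul_apply, (b.dec h2 h hd v).2.1]; simp

theorem T_of_P (h2 : (2 : K) ≠ 0) (h : QS f φ o n) (he : ε = 1 ∨ ε = -1) {j : ℕ} {u : V} (hu : aeval φ ((X - C ε) ^ j) u = 0) : (Tm o n φ ^ j) u = 0 := by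
  obtain ⟨G, hG, -⟩ := pT_fac h2 o h.nK he
  rw [Tm, ← map_pow, hG, mul_pow, mul_comm, ap, hu, map_zero]

theorem TB.edm [FiniteDimensional K V] (h2 : (2 : K) ≠ 0) (h : QS f φ o n) (b : TB f φ o n ε t x y) (hd : finrank K V = 2 * (2 * t + 1)) :
    edMult φ (X - C ε) (2 * t + 1) = 2 := by
  have hP : aeval φ (X - C ε) ^ (2 * t + 1) = 0 := by
    rw [← map_pow]; exact LinearMap.ext fun u => (b.dec h2 h hd u).2.2
  have hk : ker (aeval φ (X - C ε) ^ (2 * t)) = ker (L2 f (Tm o n φ ^ (2 * t)) x y) := by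
    ext u
    rw [mem_ker, mem_ker, ← map_pow]
    constructor
    · intro hu
      simp [L2, T_of_P h2 h b.i.sg hu]
    · intro hu
      obtain ⟨w, rfl⟩ := b.rad h2 h hd hu
      refine P_of_T h2 h b.i.sg (b.dec h2 h hd _).2.2 ?_
      rw [← mul_apply, ← pow_succ]; exact (b.dec h2 h hd w).2.1
  have := b.L2fr h
  rw [edMult, show 2 * t + 1 - 1 = 2 * t by omega, hk, pow_succ _ (2 * t + 1), hP, zero_mul, LinearMap.ker_zero, finrank_top, natDegree_X_sub_C]
  omega

theorem TB.edm0 [FiniteDimensional K V] (h2 : (2 : K) ≠ 0) (h : QS f φ o n) (b : TB f φ o n ε t x y) (hd : finrank K V = 2 * (2 * t + 1))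
    {r : K[X]} {d : ℕ} (hr : r.Monic) (hi : Irreducible r) (d0 : d ≠ 0) (hne : ¬ (r = X - C ε ∧ d = 2 * t + 1)) : edMult φ r d = 0 := by
  apply edMult_of_Jz d0
  by_cases hdd : d = 2 * t + 1
  · refine Jz_inj (fun u hu => ?_) d
    have hc : IsCoprime r ((X - C ε) ^ (2 * t + 1)) := by
      refine IsCoprime.pow_right ((dvd_or_isCoprime _ _ hi).resolve_left fun hdv => hne ⟨?_, hdd⟩)
      exact eq_of_monic_of_associated hr (monic_X_sub_C ε) (hi.associated_of_dvd (irreducible_X_sub_C ε) hdv)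
    obtain ⟨s, hs⟩ := cop_fix φ hc hu
    rw [← hs, ap, (b.dec h2 h hd u).2.2, map_zero]
  · exact h.Jz_p h2 hi d0 (b.jz h2 h hd d0 hdd)

theorem cyc_inv (x : V) : ∀ z ∈ cycSub φ x, φ z ∈ cycSub φ x := fun z hz => by
  have : cycSub φ x ≤ (cycSub φ x).comap φ := Submodule.span_le.2 (by
    rintro _ ⟨k, rfl⟩
    exact subset_span ⟨k + 1, by simp [pow_succ']⟩)
  exact this hz

theorem IsO.cyc [FiniteDimensional K V] (h2 : (2 : K) ≠ 0) (h : QS f φ o n) (i : IsO f φ o n ε t x) : cycSub φ x = Ob o n φ t x := by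
  apply le_antisymm
  · refine Submodule.span_le.2 ?_
    rintro _ ⟨k, rfl⟩
    have := inv_aeval (i.inv h2 h) (Polynomial.X ^ k) x (by simpa using i.mem h2 h 0)
    simpa using this
  · refine Ob_le fun k => ?_
    have := inv_aeval (cyc_inv (φ := φ) x) (pT K o n ^ k) x (subset_span ⟨0, by simp⟩)
    rwa [map_pow] at this

theorem TB.bic [FiniteDimensional K V] (h2 : (2 : K) ≠ 0) (h : QS f φ o n) (b : TB f φ o n ε t x y) (hd : finrank K V = 2 * (2 * t + 1)) : IsBicyclicEnd φ := by
  have sp := TB_sp h2 h b.i b.j b.hy hd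
  refine ⟨x, y, ?_⟩
  rw [b.i.cyc h2 h, b.j.cyc h2 h]
  exact ⟨sp.compl.inf_eq_bot, sp.compl.sup_eq_top⟩

end

section
variable {f : BilinForm K V} {φ : End K V} {o n : ℕ} {ε : K} {t : ℕ} {x y : V}

theorem Jz_all [FiniteDimensional K V] {A : End K V} (h : ∀ j, j ≠ 0 → Jz A j) (x : V) (hx : A x = 0) : x = 0 := by
  have key : ∀ j, ∃ y, x = (A ^ j) y := by
    intro j
    induction j with
    | zero => exact ⟨x, by simp⟩
    | succ j ih =>
      obtain ⟨y, rfl⟩ := ih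
      exact h (j + 1) (by omega) y (by rw [pow_succ']; exact hx)
  obtain ⟨N, hN⟩ := (LinearMap.eventually_isCompl_ker_pow_range_pow A).exists_forall_of_atTop
  have hc := hN (N + 1) (by omega)
  obtain ⟨y, hy⟩ := key (N + 1)
  have : x ∈ ker (A ^ (N + 1)) ⊓ range (A ^ (N + 1)) :=
    ⟨by show (A ^ (N + 1)) x = 0; rw [pow_succ, mul_apply, hx, map_zero], ⟨y, hy.symm⟩⟩
  rwa [hc.inf_eq_bot] at this

theorem inj_prod (hi : ∀ r : K[X], r.Monic → Irreducible r → r ≠ X - C ε → ∀ x, aeval φ r x = 0 → x = 0) (c : K[X]) (c0 : c ≠ 0)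
    (hc : ¬ (X - C ε) ∣ c) : ∀ x, aeval φ c x = 0 → x = 0 := by
  induction c using WfDvdMonoid.induction_on_irreducible with
  | zero => exact absurd rfl c0
  | unit u hu =>
    intro x hx
    obtain ⟨v, hv⟩ := hu.exists_left_inv
    have : aeval φ (v * u) x = 0 := by rw [ap, hx, map_zero]
    simpa [hv] using this
  | mul a r ha hr ih =>
    intro x hx
    have hda : ¬ (X - C ε) ∣ a := fun hd => hc (hd.mul_left r)
    rw [ap] at hx
    have hl : IsUnit (C (r.leadingCoeff)⁻¹) := isUnit_C.2 (isUnit_iff_ne_zero.2 (inv_ne_zero (leadingCoeff_ne_zero.2 hr.ne_zero)))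
    refine ih ha hda x (hi (r * C (r.leadingCoeff)⁻¹) (monic_mul_leadingCoeff_inv hr.ne_zero) ((irreducible_mul_isUnit hl).2 hr) (fun he => hc ?_) _ ?_)
    · rw [← he]; exact (hl.mul_right_dvd.2 dvd_rfl).mul_right a
    · rw [mul_comm, ap, hx, map_zero]

theorem TB_of_ed [FiniteDimensional K V] (h2 : (2 : K) ≠ 0) (h : QS f φ o n) (he : ε = 1 ∨ ε = -1) (e2 : edMult φ (X - C ε) (2 * t + 1) = 2)
    (e0 : ∀ (r : K[X]) (d : ℕ), r.Monic → Irreducible r → d ≠ 0 → ¬(r = X - C ε ∧ d = 2 * t + 1) → edMult φ r d = 0) :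
    ∃ x y, TB f φ o n ε t x y ∧ finrank K V = 2 * (2 * t + 1) := by
  have hJ : ∀ j, j ≠ 0 → j ≠ 2 * t + 1 → Jz (Tm o n φ) j := fun j j0 jd =>
    h.Jz_T h2 j0 fun r hr hi => Jz_of_edMult hi j0 (e0 r j hr hi j0 fun hh => jd hh.2)
  have hnt : Nontrivial V := by
    by_contra hc
    rw [not_nontrivial_iff_subsingleton] at hc
    rw [edMult_of_Jz (by omega) (Jz_inj (fun u _ => Subsingleton.elim _ _) _)] at e2
    omega
  have hT : Tm o n φ ^ (2 * t + 1) = 0 := by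
    obtain ⟨D, hD, hD0⟩ := top_index h.nil
    by_cases hDt : D = 2 * t
    · rw [← hDt]; exact hD
    · exfalso; apply hD0
      ext u
      obtain ⟨w, hw⟩ := hJ (D + 1) (by omega) (by omega) u (by rw [hD]; rfl)
      rw [Nat.add_sub_cancel, hD] at hw
      exact hw
  have hP : ∀ u, aeval φ ((X - C ε) ^ (2 * t + 1)) u = 0 := by
    intro u
    obtain ⟨G, hG, hGe⟩ := pT_fac h2 o h.nK he
    have hdv : ¬ (X - C ε) ∣ G := by rw [dvd_iff_isRoot]; exact hGe
    have hpr : Prime (X - C ε) := prime_X_sub_C ε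
    refine inj_prod (ε := ε) (φ := φ) (fun r hr hi hne => Jz_all fun j j0 => Jz_of_edMult hi j0 (e0 r j hr hi j0 fun hh => hne hh.1)) (G ^ (2 * t + 1))
      (fun h0 => hdv (by rw [pow_eq_zero_iff (by omega)] at h0; rw [h0]; exact dvd_zero _)) (fun hh => hdv (hpr.dvd_of_dvd_pow hh)) _ ?_
    rw [← ap, mul_comm, ← mul_pow, ← hG, map_pow]
    show (Tm o n φ ^ (2 * t + 1)) u = 0
    rw [hT]; rfl
  have hP' : aeval φ (X - C ε) ^ (2 * t + 1) = 0 := by rw [← map_pow]; exact LinearMap.ext hP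
  have hk : ker (aeval φ (X - C ε) ^ (2 * t)) = ker (Tm o n φ ^ (2 * t)) := by
    ext u
    rw [mem_ker, mem_ker, ← map_pow]
    exact ⟨T_of_P h2 h he, P_of_T h2 h he (hP u)⟩
  have hfr : 2 + finrank K (ker (Tm o n φ ^ (2 * t))) = finrank K V := by
    have := e2
    rw [edMult, show 2 * t + 1 - 1 = 2 * t by omega, hk, pow_succ _ (2 * t + 1), hP', zero_mul, LinearMap.ker_zero, finrank_top, natDegree_X_sub_C] at this
    omega
  have hsep : ∀ v, (Tm o n φ ^ (2 * t)) v ≠ 0 → ∃ u, f u ((Tm o n φ ^ (2 * t)) v) ≠ 0 := by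
    intro v hv
    by_contra! hc
    exact hv (h.nd.2 _ hc)
  have ev := h.skew.ev h.symm t
  obtain ⟨x, hx⟩ : ∃ x, f x ((Tm o n φ ^ (2 * t)) x) ≠ 0 := by
    obtain ⟨v, hv⟩ : ∃ v, (Tm o n φ ^ (2 * t)) v ≠ 0 := by
      by_contra! hc
      rw [show Tm o n φ ^ (2 * t) = 0 from LinearMap.ext hc, LinearMap.ker_zero, finrank_top] at hfr
      omega
    obtain ⟨u, hu⟩ := hsep v hv
    obtain ⟨x, -, hx⟩ := polar h2 ev (Submodule.mem_top (x := u)) (Submodule.mem_top (x := v)) hu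
    exact ⟨x, hx⟩
  have i : IsO f φ o n ε t x := ⟨he, hP x, hx⟩
  obtain ⟨y, b⟩ : ∃ y, TB f φ o n ε t x y := by
    obtain ⟨l, hl⟩ : ∃ l, l = f x ∘ₗ (Tm o n φ ^ (2 * t)) := ⟨_, rfl⟩
    have hlv : ∀ v, l v = f x ((Tm o n φ ^ (2 * t)) v) := fun v => by rw [hl]; rfl
    obtain ⟨v, hv, hv0⟩ : ∃ v ∈ ker l, (Tm o n φ ^ (2 * t)) v ≠ 0 := by
      by_contra! hc
      have h1 : ker l ≤ ker (Tm o n φ ^ (2 * t)) := hc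
      have h3 := Submodule.finrank_mono h1
      have h5 := LinearMap.finrank_range_add_finrank_ker l
      have h6 := Submodule.finrank_le (range l)
      rw [finrank_self] at h6
      omega
    obtain ⟨u, hu⟩ := hsep v hv0
    rw [mem_ker, hlv] at hv
    obtain ⟨w, hw, hww⟩ := polar h2 ev (U := ker l) (x := u - (f x ((Tm o n φ ^ (2 * t)) u) / f x ((Tm o n φ ^ (2 * t)) x)) • x) (y := v)
      (by rw [mem_ker, map_sub, map_smul, hlv, hlv, smul_eq_mul, div_mul_cancel₀ _ hx, sub_self]) (by rw [mem_ker, hlv, hv])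
      (by rw [map_sub, map_smul]; simpa [hv] using hu)
    rw [mem_ker, hlv] at hw
    obtain ⟨y, j, hy, -⟩ := proj h2 h i ⟨he, hP w, hww⟩ hw
    exact ⟨y, TB.of_hy h2 h i j hy⟩
  refine ⟨x, y, b, ?_⟩
  obtain ⟨U, hU, hn, hfU, -, xU, yU⟩ := b.sub h2 h
  have sp := Sp.of_nd h.symm hn
  have hU' := orth_inv h.nd h.iso hU
  have hL : ker (Tm o n φ ^ (2 * t)) = ker (L2 f (Tm o n φ ^ (2 * t)) x y) := by
    apply Submodule.eq_of_le_of_finrank_eq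
    · intro u hu
      rw [mem_ker] at hu
      simp [L2, hu]
    · have := b.L2fr h
      omega
  have hR : ∀ u ∈ f.orthogonal U, (Tm o n φ ^ (2 * t)) u = 0 := fun u hu => by
    have : u ∈ ker (L2 f (Tm o n φ ^ (2 * t)) x y) := by
      have h1 := inv_aeval hU' (pT K o n ^ (2 * t)) u hu
      rw [map_pow] at h1
      have a1 : f x ((Tm o n φ ^ (2 * t)) u) = 0 := h1 x xU
      have a2 : f y ((Tm o n φ ^ (2 * t)) u) = 0 := h1 y yU
      simp [L2, a1, a2]
    rwa [← hL] at this
  have qs := h.restrict hU' (sp.nd' h.symm h.nd)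
  have hRj : ∀ j, j ≠ 0 → Jz (Tm o n (φ.restrict hU')) j := by
    intro j j0
    rw [Jz_link qs.symm qs.nd qs.skew]
    intro u v hu hv
    have hu' : (Tm o n φ ^ j) (u : V) = 0 := by rw [← Tm_resp hU', hu]; rfl
    have hv' : (Tm o n φ ^ j) (v : V) = 0 := by rw [← Tm_resp hU', hv]; rfl
    show f u _ = 0
    rw [Submodule.subtype_apply, Tm_resp hU']
    by_cases hj : j = 2 * t + 1
    · rw [hj, Nat.add_sub_cancel, hR v v.2, map_zero]
    · exact (Jz_link h.symm h.nd h.skew).1 (hJ j j0 hj) u v hu' hv'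
  have hsub : f.orthogonal U = ⊥ := by
    obtain ⟨N, hN⟩ := qs.nil
    have : ∀ (k : ℕ) (z : f.orthogonal U), (Tm o n (φ.restrict hU') ^ k) z = 0 → z = 0 := by
      intro k
      induction k with
      | zero => intro z hz; simpa using hz
      | succ k ih => intro z hz; exact ih z (Jz_all hRj _ (by rw [← mul_apply, ← pow_succ']; exact hz))
    rw [Submodule.eq_bot_iff]
    intro z hz
    simpa using this N ⟨z, hz⟩ (by rw [hN]; rfl)
  have := sp.finrank
  rw [hsub, finrank_bot, hfU] at this
  exact this

end

section
variable {f : BilinForm K V} {φ : End K V} {o n : ℕ} {ε : K} {t : ℕ} {x y : V}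

theorem EZ0 [Finite K] [FiniteDimensional K V] (h4 : ¬ IsSquare (-1 : K)) (h : QS f φ o n) (hz : HZ f (Tm o n φ)) :
    ∃ r, finrank K V = 4 * r ∧ ∀ a : K, a ≠ 0 → ∀ σ, Iso f σ → σ * σ = 1 → φ * σ * φ = σ → chi f a σ = (-1) ^ r := by
  have key : ∀ a : K, a ≠ 0 → ∀ σ, Iso f σ → σ * σ = 1 → φ * σ * φ = σ → ∃ r, finrank K V = 4 * r ∧ chi f a σ = (-1) ^ r := fun a ha σ h1 h2 h3 =>
    (G0 h4 ha (η := -1) (by ring) _ V f h.symm h.nd rfl (Tm o n φ) h.skew h.nil hz σ h1 1 (by rw [pow_one, pow_two, h2]) (h.revT h3)).2 rfl h2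
  obtain ⟨⟨s, t, β, hβ, hbb, hb, -, -⟩, -, -⟩ := Main h4 _ V f φ o n h rfl
  obtain ⟨r, hr, -⟩ := key 1 one_ne_zero β hβ hbb hb
  refine ⟨r, hr, fun a ha σ h1 h2 h3 => ?_⟩
  obtain ⟨r', hr', e⟩ := key a ha σ h1 h2 h3
  rw [e, show r' = r by omega]

theorem EZ [Finite K] [FiniteDimensional K V] (h4 : ¬ IsSquare (-1 : K)) (h : QS f φ o n) (hz : HZ f (Tm o n φ)) (hd : finrank K V % 8 = 4) :
    (∀ a : K, a ≠ 0 → ∀ σ, Iso f σ → σ * σ = 1 → φ * σ * φ = σ → chi f a σ = -1) ∧ nu f (-1) = 1 ∧ HC f φ (-1) (-1) := by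
  obtain ⟨r, hr, key⟩ := EZ0 h4 h hz
  rw [Odd.neg_one_pow (by rw [Nat.odd_iff]; omega)] at key
  obtain ⟨⟨s, t, β, hβ, hbb, hb, -, -⟩, -, -⟩ := Main h4 _ V f φ o n h rfl
  refine ⟨key, ?_, β, hβ, hbb, hb, key 1 one_ne_zero β hβ hbb hb, key (-1) (by simp) β hβ hbb hb⟩
  have e1 := key (-1) (by simp) β hβ hbb hb
  have e2 := key (-1) (by simp) (-β) hβ.neg (by rw [neg_mul_neg, hbb]) (by rw [mul_neg, neg_mul, hb])
  rw [← neg_one_mul β, chi_mul h.nd (Iso.one f).neg hβ, e1] at e2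
  have k : ∀ A : ℤˣ, A * -1 = -1 → A = 1 := by decide
  exact k _ e2

theorem OT_two [Finite K] [FiniteDimensional K V] (h4 : ¬ IsSquare (-1 : K)) (h : QS f φ o n) (hO : OT f φ o n) :
    ∃ s t a b : ℤˣ, HC f φ s t ∧ HC f φ (a * s) (b * t) ∧ a * b = -1 := by
  have h2 := two_ne h4
  obtain ⟨ε, t, z, i⟩ := hO
  have hW := i.inv h2 h
  have sp := Sp.of_nd h.symm (i.ndW h2 h)
  have hW' := orth_inv h.nd h.iso hW
  obtain ⟨⟨s, s', hc⟩, -, -⟩ := Main h4 _ _ _ _ o n (h.restrict hW' (sp.nd' h.symm h.nd)) rfl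
  have g1 := HC.glue h2 h.symm h.nd sp hW hW' (i.hc h4 h) hc
  have g2 := HC.glue h2 h.symm h.nd sp hW hW' ((i.hc h4 h).neg (i.ndW h2 h)) hc
  rw [mul_assoc, mul_assoc] at g2
  refine ⟨_, _, _, _, g1, g2, ?_⟩
  rw [nu_dim h4 (h.symm.restrict _) (i.ndW h2 h), i.fr h2 h, pow_succ, pow_mul]; simp

theorem rev_odd [FiniteDimensional K V] (h : QS f φ o n) {α : End K V} (ha : φ * α * φ = α) {l : ℕ} (hl : Odd l) : φ * α ^ l * φ = α ^ l := by
  obtain ⟨m, rfl⟩ := hl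
  obtain ⟨h1, h3⟩ := h.rev ha
  have hc : Commute φ (α * α) := by
    show φ * (α * α) = α * α * φ
    rw [mul_assoc, h1, ← mul_assoc, ← mul_assoc, h3]
  have := (hc.pow_right m).eq
  rw [pow_succ, pow_mul, pow_two, ← mul_assoc, this, mul_assoc, mul_assoc, ← mul_assoc φ, ha]

theorem fwd [Finite K] [FiniteDimensional K V] (h4 : ¬ IsSquare (-1 : K)) (h : QS f φ o n) {α : End K V} (hα : Iso f α) (ha : φ * α * φ = α)
    (c1 : chi f 1 α = 1) (c2 : chi f (-1) α = 1) (hn : ¬ HC f φ 1 1) :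
    ∃ (ε : K) (t : ℕ) (x y : V) (U : Submodule K V) (hU : ∀ z ∈ U, φ z ∈ U) (hU' : ∀ z ∈ f.orthogonal U, φ z ∈ f.orthogonal U),
      TB f φ o n ε t x y ∧ (f.restrict U).Nondegenerate ∧ finrank K U = 2 * (2 * t + 1) ∧ x ∈ U ∧ y ∈ U ∧ nu (f.restrict U) (-1) = 1 ∧
      finrank K (f.orthogonal U) % 8 = 4 ∧ HZ (f.restrict (f.orthogonal U)) (Tm o n (φ.restrict hU')) := by
  have h2 := two_ne h4
  obtain ⟨l, k, hl, hk⟩ := two_part h.nd hα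
  rcases GF h4 _ V f φ o n h rfl (α ^ l) (hα.pow l) (rev_odd h ha hl) k hk with hc | ⟨ε, t, x, y, i, j, ort⟩
  · rw [chi_pow h.nd hα, chi_pow h.nd hα, c1, c2, one_pow] at hc
    exact absurd hc hn
  have b : TB f φ o n ε t x y := ⟨i, j, ort⟩
  obtain ⟨U, hU, nU, hfU, -, xU, yU⟩ := b.sub h2 h
  have sp := Sp.of_nd h.symm nU
  have hU' := orth_inv h.nd h.iso hU
  have q := h.restrict hU nU
  have q' := h.restrict hU' (sp.nd' h.symm h.nd)
  have bU := b.down hU xU yU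
  have B0 := (TB0 h4 q bU.i bU.j bU.hy hfU).1
  obtain ⟨B1, B2⟩ := TB2 h4 q bU.i bU.j bU.hy hfU
  have gl := fun {s t s' t' : ℤˣ} => HC.glue (s := s) (t := t) (s' := s') (t' := t') h2 h.symm h.nd sp hU hU'
  have key : ∀ s t, HC (f.restrict (f.orthogonal U)) (φ.restrict hU') s t → s = -1 ∧ t = -1 := by
    intro s t hc
    rcases Int.units_eq_one_or s with rfl | rfl <;> rcases Int.units_eq_one_or t with rfl | rfl
    · exact absurd (gl B0 hc) hn
    · exact absurd (gl B1 hc) hn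
    · exact absurd (gl B2 hc) hn
    · exact ⟨rfl, rfl⟩
  have hz : HZ (f.restrict (f.orthogonal U)) (Tm o n (φ.restrict hU')) := by
    by_contra hz
    rcases (Main h4 _ _ _ _ o n q' rfl).2.2 hz with hO | ⟨s, t, h5, h6⟩
    · obtain ⟨s, t, a, b, h5, h6, h7⟩ := OT_two h4 q' hO
      obtain ⟨rfl, rfl⟩ := key _ _ h5
      obtain ⟨h8, h9⟩ := key _ _ h6
      have : ∀ a b : ℤˣ, a * -1 = -1 → b * -1 = -1 → a * b ≠ -1 := by decide
      exact this a b h8 h9 h7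
    · obtain ⟨rfl, rfl⟩ := key _ _ h5
      exact absurd (key _ _ h6).1 (by decide)
  obtain ⟨⟨s, t', h5⟩, -, -⟩ := Main h4 _ _ _ _ o n q' rfl
  obtain ⟨rfl, rfl⟩ := key _ _ h5
  refine ⟨ε, t, x, y, U, hU, hU', b, nU, hfU, xU, yU, ?_, ?_, hz⟩
  · by_contra hnu
    exact hn (gl (TB3 h4 q bU.i bU.j bU.hy hfU hnu) h5)
  · obtain ⟨r, hr, hr2⟩ := EZ0 h4 q' hz
    obtain ⟨β, e1, e2, e3, e4, -⟩ := h5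
    have := hr2 1 one_ne_zero β e1 e2 e3
    rw [e4] at this
    have : Odd r := by
      by_contra hne
      rw [Nat.not_odd_iff_even] at hne
      rw [hne.neg_one_pow] at this
      exact absurd this (by decide)
    rw [Nat.odd_iff] at this
    omega

/-- reversing isometries: existence with given signs -/
def RC (f : BilinForm K V) (φ : End K V) (s t : ℤˣ) : Prop :=
  ∃ α, Iso f α ∧ φ * α * φ = α ∧ chi f 1 α = s ∧ chi f (-1) α = t

theorem bwd1 [Finite K] [FiniteDimensional K V] (h4 : ¬ IsSquare (-1 : K)) (h : QS f φ o n) {U U' : Submodule K V} (sp : Sp f U U')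
    (hU : ∀ z ∈ U, φ z ∈ U) (hU' : ∀ z ∈ U', φ z ∈ U') {x y : U} (b : TB (f.restrict U) (φ.restrict hU) o n ε t x y) (hd : finrank K U = 2 * (2 * t + 1))
    (hc : HC (f.restrict U') (φ.restrict hU') (-1) (-1)) : RC f φ 1 1 := by
  have h2 := two_ne h4
  have nU := sp.nd h.symm h.nd
  have q := h.restrict hU nU
  obtain ⟨γ, g1, g2, g3, g4, g5⟩ := hc
  obtain ⟨b0, p1, p2, p3, p4, p5⟩ := (TB0 h4 q b.i b.j b.hy hd).1
  obtain ⟨⟨b1, q1, q2, q3, q4, q5⟩, ⟨b2, r1, r2, r3, r4, r5⟩⟩ := TB2 h4 q b.i b.j b.hy hd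
  have hrev : φ.restrict hU * (b1 * b0 * b2) * φ.restrict hU = b1 * b0 * b2 := by
    have u0 := q.rev p3
    have u2 := q.rev r3
    rw [mul_assoc, mul_assoc (b1 * b0), u2.1, ← mul_assoc (b1 * b0), mul_assoc b1, u0.2, ← mul_assoc, ← mul_assoc, ← mul_assoc, q3]
  refine ⟨sp.glue (b1 * b0 * b2) γ, sp.glue_iso h.symm ((q1.mul p1).mul r1) g1, ?_, ?_, ?_⟩
  · have gl : ∀ x (hx : x ∈ U), sp.glue (b1 * b0 * b2) γ x = (b1 * b0 * b2) ⟨x, hx⟩ := fun x hx => sp.glue_l _ γ ⟨x, hx⟩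
    have gr : ∀ x (hx : x ∈ U'), sp.glue (b1 * b0 * b2) γ x = γ ⟨x, hx⟩ := fun x hx => sp.glue_r _ γ ⟨x, hx⟩
    refine sp.ext (fun x hx => ?_) fun x hx => ?_
    · rw [mul_apply, mul_apply, gl _ (hU x hx), gl x hx]
      exact congrArg Subtype.val (LinearMap.congr_fun hrev ⟨x, hx⟩)
    · rw [mul_apply, mul_apply, gr _ (hU' x hx), gr x hx]
      exact congrArg Subtype.val (LinearMap.congr_fun g3 ⟨x, hx⟩)
  all_goals
    rw [chi_glue h2 h.symm h.nd sp ((q1.mul p1).mul r1) g1, chi_mul nU (q1.mul p1) r1, chi_mul nU q1 p1]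
    simp only [g4, g5, p4, p5, q4, q5, r4, r5]
    decide

end

section
variable {f : BilinForm K V} {φ : End K V} {o n : ℕ} {ε : K} {t : ℕ} {x y : V}

theorem blk [Finite K] [FiniteDimensional K V] (h4 : ¬ IsSquare (-1 : K)) (h : QS f φ o n) (i : IsO f φ o n ε t x) {σ : End K V}
    (hσ : Iso f σ) (hr : φ * σ * φ = σ) {l : K} (hl : σ x = l • x) (hl1 : l = 1 ∨ l = -1) (hW : ∀ y ∈ Ob o n φ t x, σ y ∈ Ob o n φ t x) :
    (∀ a : K, a ≠ 0 → chi (f.restrict (Ob o n φ t x)) a (σ.restrict hW) = kap K t) ∨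
    (∀ a : K, a ≠ 0 → chi (f.restrict (Ob o n φ t x)) a (σ.restrict hW) = nu (f.restrict (Ob o n φ t x)) a * kap K t) := by
  have h2 := two_ne h4
  have hG := hσ.restrict hW
  have hv : ∀ j, (σ.restrict hW) ⟨_, i.mem h2 h j⟩ = ((-1 : K) ^ j * l) • ⟨_, i.mem h2 h j⟩ := fun j =>
    Subtype.ext (Ob_rev h hr hl j)
  have hlt : l = (-1) ^ t ∨ l = - (-1) ^ t := by
    rcases hl1 with rfl | rfl <;> rcases neg_one_pow_eq_or K t with e | e <;> simp [e]
  rcases hlt with e | e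
  · left
    intro a ha
    exact i.chiK h4 h hG (fun j => by rw [hv j, e, pow_add (-1 : K), mul_comm]) ha
  · right
    intro a ha
    have := i.chiK h4 h hG.neg (fun j => by
      show - (σ.restrict hW) _ = _
      rw [hv j, e, pow_add (-1 : K), ← neg_smul]; congr 1; ring) ha
    rw [← neg_one_mul (σ.restrict hW), chi_mul (i.ndW h2 h) (Iso.one _).neg hG] at this
    rw [← this, nu, ← mul_assoc, Int.units_mul_self, one_mul]

theorem TBchi [Finite K] [FiniteDimensional K V] (h4 : ¬ IsSquare (-1 : K)) (h : QS f φ o n) (b : TB f φ o n ε t x y) (hd : finrank K V = 2 * (2 * t + 1))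
    {σ : End K V} (hσ : Iso f σ) (hr : φ * σ * φ = σ) {l m : K} (hl : σ x = l • x) (hl1 : l = 1 ∨ l = -1) (hm : σ y = m • y) (hm1 : m = 1 ∨ m = -1)
    (hnu : nu f (-1) = 1) (c1 : chi f 1 σ = -1) (c2 : chi f (-1) σ = -1) : False := by
  have h2 := two_ne h4
  have sp := TB_sp h2 h b.i b.j b.hy hd
  have hW := Ob_rinv h2 h b.i hr hl
  have hW' := Ob_rinv h2 h b.j hr hm
  have n1 : (1 : K) ≠ 0 := one_ne_zero
  have n2 : (-1 : K) ≠ 0 := by simp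
  rw [chi_split h2 h.symm h.nd sp hσ hW hW'] at c1 c2
  rw [nu_split h2 h.symm h.nd sp, b.i.nu h4 h n2, b.j.nu h4 h n2, neg_neg, qc_one, one_mul, one_mul] at hnu
  have e1 := b.i.nu h4 h n1
  have e2 := b.i.nu h4 h n2
  have e3 := b.j.nu h4 h n1
  have e4 := b.j.nu h4 h n2
  rw [qc_neg_one h4] at e1 e3
  rw [neg_neg, qc_one] at e2 e4
  generalize qc (f x ((Tm o n φ ^ (2 * t)) x)) = A at *
  generalize qc (f y ((Tm o n φ ^ (2 * t)) y)) = B at *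
  have key : ∀ A B k : ℤˣ, A * B = 1 → (k * k = -1 → False) ∧ (k * ((-1 * B) * k) = -1 → k * ((1 * B) * k) = -1 → False) ∧
    ((-1 * A) * k * k = -1 → (1 * A) * k * k = -1 → False) ∧ ((-1 * A) * k * ((-1 * B) * k) = -1 → False) := by decide
  obtain ⟨k1, k2, k3, k4⟩ := key A B (kap K t) hnu
  rcases blk h4 h b.i hσ hr hl hl1 hW with g | g <;> rcases blk h4 h b.j hσ hr hm hm1 hW' with g' | g' <;>
    rw [g 1 n1, g' 1 n1] at c1 <;> rw [g (-1) n2, g' (-1) n2] at c2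
  · exact k1 c1
  · rw [e3] at c1; rw [e4] at c2; exact k2 c1 c2
  · rw [e1] at c1; rw [e2] at c2; exact k3 c1 c2
  · rw [e1, e3] at c1; exact k4 c1

theorem eigv [FiniteDimensional K V] (h2 : (2 : K) ≠ 0) (h : QS f φ o n) (i : IsO f φ o n ε t x) {σ : End K V}
    (hσ : Iso f σ) (hr : φ * σ * φ = σ) (hss : σ * σ = 1) : ∃ l : K, (l = 1 ∨ l = -1) ∧ IsO f φ o n ε t (x + l • σ x) ∧ σ (x + l • σ x) = l • (x + l • σ x) := by
  have hσσ : σ (σ x) = x := by rw [← mul_apply, hss]; rfl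
  have e1 := h_rev h hσ hr t x x
  have e2 := h_rev h hσ hr t x (σ x)
  rw [hσσ] at e2
  have ev := h.skew.ev h.symm t (σ x) x
  have hk : ∀ l : K, aeval φ ((X - C ε) ^ (2 * t + 1)) (x + l • σ x) = 0 := fun l => by
    rw [map_add, map_smul, i.kil, Z_rev h hr i.sg i.kil]; simp
  have hl : ∀ l : K, l * l = 1 → σ (x + l • σ x) = l • (x + l • σ x) := fun l hl => by
    rw [map_add, map_smul, hσσ, smul_add, smul_smul, hl, one_smul, add_comm]
  by_cases hc : f (x + (1 : K) • σ x) ((Tm o n φ ^ (2 * t)) (x + (1 : K) • σ x)) = 0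
  · refine ⟨-1, Or.inr rfl, ⟨i.sg, hk _, fun hc' => ?_⟩, hl _ (by ring)⟩
    simp only [map_add, map_smul, LinearMap.add_apply, LinearMap.smul_apply, smul_eq_mul] at hc hc'
    have : 2 * (2 * f x ((Tm o n φ ^ (2 * t)) x)) = 0 := by linear_combination hc + hc' - 2 * e1
    simp [h2, i.ne] at this
  · exact ⟨1, Or.inl rfl, ⟨i.sg, hk _, hc⟩, hl _ (by ring)⟩

theorem bwd2 [Finite K] [FiniteDimensional K V] (h4 : ¬ IsSquare (-1 : K)) (h : QS f φ o n) {U U' : Submodule K V} (sp : Sp f U U')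
    (hU : ∀ z ∈ U, φ z ∈ U) (hU' : ∀ z ∈ U', φ z ∈ U') {x y : U} (b : TB (f.restrict U) (φ.restrict hU) o n ε t x y) (hd : finrank K U = 2 * (2 * t + 1))
    (hnu : nu (f.restrict U) (-1) = 1) (hz : HZ (f.restrict U') (Tm o n (φ.restrict hU'))) (h8 : finrank K U' % 8 = 4) : ¬ HC f φ 1 1 := by
  rintro ⟨σ, hσ, hss, hr, s1, s2⟩
  have h2 := two_ne h4
  have q := h.restrict hU (sp.nd h.symm h.nd)
  have q' := h.restrict hU' (sp.nd' h.symm h.nd)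
  have iU := fun k u hu => by have := inv_aeval hU (pT K o n ^ k) u hu; rwa [map_pow] at this
  have iU' := fun k u hu => by have := inv_aeval hU' (pT K o n ^ k) u hu; rwa [map_pow] at this
  change ∀ k, ∀ u ∈ U, (Tm o n φ ^ k) u ∈ U at iU
  change ∀ k, ∀ u ∈ U', (Tm o n φ ^ k) u ∈ U' at iU'
  have spl : ∀ k (u : U) (v : U'), (Tm o n φ ^ k) (u + v : V) = 0 → (Tm o n (φ.restrict hU) ^ k) u = 0 ∧ (Tm o n (φ.restrict hU') ^ k) v = 0 := by
    intro k u v huv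
    rw [map_add] at huv
    obtain ⟨e1, e2⟩ := eq_zero_of_sp sp (iU k u u.2) (iU' k v v.2) huv
    exact ⟨Subtype.ext (by rw [Tm_resp hU, e1]; rfl), Subtype.ext (by rw [Tm_resp hU', e2]; rfl)⟩
  have fsp : ∀ k (u u' : U) (v v' : U'), f (u + v : V) ((Tm o n φ ^ k) (u' + v' : V)) =
      f.restrict U u ((Tm o n (φ.restrict hU) ^ k) u') + f.restrict U' v ((Tm o n (φ.restrict hU') ^ k) v') := by
    intro k u u' v v'
    have e1 : f (u : V) ((Tm o n φ ^ k) (v' : V)) = 0 := sp.orth _ u.2 _ (iU' k v' v'.2)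
    have e2 : f (v : V) ((Tm o n φ ^ k) (u' : V)) = 0 := (sp.symm h.symm).orth _ v.2 _ (iU k u' u'.2)
    have e3 : f.restrict U u ((Tm o n (φ.restrict hU) ^ k) u') = f (u : V) ((Tm o n φ ^ k) (u' : V)) := by rw [← Tm_resp hU]; rfl
    have e4 : f.restrict U' v ((Tm o n (φ.restrict hU') ^ k) v') = f (v : V) ((Tm o n φ ^ k) (v' : V)) := by rw [← Tm_resp hU']; rfl
    rw [e3, e4]; simp [e1, e2]
  have oth : ∀ j, Odd j → j ≠ 2 * t + 1 → ∀ u v, (Tm o n φ ^ j) u = 0 → (Tm o n φ ^ j) v = 0 → f u ((Tm o n φ ^ (j - 1)) v) = 0 := by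
    intro j jo jd u v hu hv
    obtain ⟨u, u', rfl⟩ := sp.exi u
    obtain ⟨v, v', rfl⟩ := sp.exi v
    obtain ⟨a1, a2⟩ := spl _ _ _ hu
    obtain ⟨a3, a4⟩ := spl _ _ _ hv
    rw [fsp, (Jz_link q.symm q.nd q.skew).1 (b.jz h2 q hd jo.pos.ne' jd) u v a1 a3, hz j jo u' v' a2 a4, add_zero]
  have ix : IsO f φ o n ε t x := b.i.lift
  have iy : IsO f φ o n ε t y := b.j.lift
  have h0 : f x ((Tm o n φ ^ (2 * t)) (y : V)) = 0 := by
    have := b.h0 q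
    rw [← Tm_resp hU]; exact this
  have ev := h.skew.ev h.symm t
  have h0' : f y ((Tm o n φ ^ (2 * t)) (x : V)) = 0 := by rw [ev]; exact h0
  obtain ⟨c1, hc1⟩ : ∃ c, c = f x ((Tm o n φ ^ (2 * t)) (x : V)) := ⟨_, rfl⟩
  obtain ⟨c2, hc2⟩ : ∃ c, c = f y ((Tm o n φ ^ (2 * t)) (y : V)) := ⟨_, rfl⟩
  have c1n : c1 ≠ 0 := by rw [hc1]; exact ix.ne
  have c2n : c2 ≠ 0 := by rw [hc2]; exact iy.ne
  have rad : ∀ u v, (Tm o n φ ^ (2 * t + 1)) u = 0 → (Tm o n φ ^ (2 * t + 1)) v = 0 → f x ((Tm o n φ ^ (2 * t)) u) = 0 → f y ((Tm o n φ ^ (2 * t)) u) = 0 →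
      f u ((Tm o n φ ^ (2 * t)) v) = 0 := by
    intro u v hu hv hx hy
    obtain ⟨u, u', rfl⟩ := sp.exi u
    obtain ⟨v, v', rfl⟩ := sp.exi v
    obtain ⟨a1, a2⟩ := spl _ _ _ hu
    obtain ⟨a3, a4⟩ := spl _ _ _ hv
    have hx' := fsp (2 * t) x u 0 u'
    have hy' := fsp (2 * t) y u 0 u'
    simp only [ZeroMemClass.coe_zero, add_zero, map_zero, LinearMap.zero_apply] at hx' hy'
    rw [hx] at hx'; rw [hy] at hy'
    obtain ⟨w, rfl⟩ := b.rad h2 q hd (u := u) (Prod.ext hx'.symm hy'.symm)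
    have := hz (2 * t + 1) ⟨t, rfl⟩ u' v' a2 a4
    rw [Nat.add_sub_cancel] at this
    rw [fsp, this, q.skew, ← mul_apply, ← pow_succ', a3]; simp
  have fA : ∀ u v, (Tm o n φ ^ (2 * t + 1)) u = 0 → (Tm o n φ ^ (2 * t + 1)) v = 0 → c1 * c2 * f u ((Tm o n φ ^ (2 * t)) v) =
      c2 * (f x ((Tm o n φ ^ (2 * t)) u) * f x ((Tm o n φ ^ (2 * t)) v)) + c1 * (f y ((Tm o n φ ^ (2 * t)) u) * f y ((Tm o n φ ^ (2 * t)) v)) := by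
    intro u v hu hv
    have e := rad ((c1 * c2) • u - (c2 * f x ((Tm o n φ ^ (2 * t)) u)) • (x : V) - (c1 * f y ((Tm o n φ ^ (2 * t)) u)) • (y : V)) v
      (by simp [hu, ix.T0 h2 h, iy.T0 h2 h]) hv (by simp [h0, ← hc1]; ring) (by simp [h0', ← hc2]; ring)
    simp only [map_sub, map_smul, LinearMap.sub_apply, LinearMap.smul_apply, smul_eq_mul] at e
    linear_combination e
  obtain ⟨l, hl, i1, hl1⟩ := eigv h2 h ix hσ hr hss
  generalize (x : V) + l • σ x = y1 at i1 hl1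
  have t1 := i1.T0 h2 h
  obtain ⟨X1, hX1⟩ : ∃ c, c = f x ((Tm o n φ ^ (2 * t)) y1) := ⟨_, rfl⟩
  obtain ⟨Y1, hY1⟩ : ∃ c, c = f y ((Tm o n φ ^ (2 * t)) y1) := ⟨_, rfl⟩
  have f11 := fA y1 y1 t1 t1
  rw [← hX1, ← hY1] at f11
  have zt : aeval φ ((X - C ε) ^ (2 * t + 1)) (X1 • (y : V) - Y1 • (x : V)) = 0 := by
    rw [map_sub, map_smul, map_smul, ix.kil, iy.kil]; simp
  have iz : IsO f φ o n ε t (X1 • (y : V) - Y1 • (x : V)) := by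
    refine ⟨ix.sg, zt, fun hc => ?_⟩
    simp only [map_sub, map_smul, LinearMap.sub_apply, LinearMap.smul_apply, smul_eq_mul, h0, h0', ← hc1, ← hc2] at hc
    have : c1 * c2 * f y1 ((Tm o n φ ^ (2 * t)) y1) = 0 := by rw [f11]; linear_combination hc
    simp [c1n, c2n, i1.ne] at this
  have hz0 : f y1 ((Tm o n φ ^ (2 * t)) (X1 • (y : V) - Y1 • (x : V))) = 0 := by
    rw [map_sub, map_smul, map_smul, map_sub, map_smul, map_smul, ev y1 x, ev y1 y, ← hX1, ← hY1]; simp only [smul_eq_mul]; ring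
  obtain ⟨u, iu, hu, -⟩ := proj h2 h i1 iz hz0
  have hW1 := Ob_rinv h2 h i1 hr hl1
  have hW1' := orth_inv h.nd hσ hW1
  obtain ⟨m, hm, i2, hm1⟩ := eigv h2 h iu hσ hr hss
  have hy2 : u + m • σ u ∈ f.orthogonal (Ob o n φ t y1) := Submodule.add_mem _ hu (Submodule.smul_mem _ _ (hW1' u hu))
  generalize u + m • σ u = y2 at i2 hm1 hy2
  have B := TB.of_hy h2 h i1 i2 hy2
  obtain ⟨W, hW, nW, hfW, hWe, m1, m2⟩ := B.sub h2 h
  have spW := Sp.of_nd h.symm nW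
  have hW' := orth_inv h.nd h.iso hW
  have sW : ∀ z ∈ W, σ z ∈ W := by
    intro z hz
    rw [hWe] at hz ⊢
    obtain ⟨u, hu, v, hv, rfl⟩ := mem_sup.1 hz
    rw [map_add]
    exact Submodule.add_mem_sup (hW1 u hu) (Ob_rinv h2 h i2 hr hm1 v hv)
  have sW' := orth_inv h.nd hσ sW
  have qW := h.restrict hW nW
  have qW' := h.restrict hW' (spW.nd' h.symm h.nd)
  have iW' := fun k u hu => by have := inv_aeval hW' (pT K o n ^ k) u hu; rwa [map_pow] at this
  change ∀ k, ∀ u ∈ f.orthogonal W, (Tm o n φ ^ k) u ∈ f.orthogonal W at iW'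
  have t2 := i2.T0 h2 h
  have hzW : HZ (f.restrict (f.orthogonal W)) (Tm o n (φ.restrict hW')) := by
    intro j jo u v hu hv
    have hu' : (Tm o n φ ^ j) (u : V) = 0 := by rw [← Tm_resp hW', hu]; rfl
    have hv' : (Tm o n φ ^ j) (v : V) = 0 := by rw [← Tm_resp hW', hv]; rfl
    show f u _ = 0
    rw [Submodule.subtype_apply, Tm_resp hW']
    by_cases jd : j = 2 * t + 1
    · rw [jd] at hu' hv' ⊢
      rw [Nat.add_sub_cancel]
      have g1 := fA y1 u t1 hu'
      have g2 := fA y2 u t2 hu'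
      have f22 := fA y2 y2 t2 t2
      have f12 := fA y1 y2 t1 t2
      rw [show f y1 ((Tm o n φ ^ (2 * t)) (u : V)) = 0 from iW' _ u u.2 y1 m1] at g1
      rw [show f y2 ((Tm o n φ ^ (2 * t)) (u : V)) = 0 from iW' _ u u.2 y2 m2] at g2
      rw [B.h0 h, ← hX1, ← hY1] at f12
      rw [← hX1, ← hY1] at g1
      have n1 := i1.ne
      have n2 := i2.ne
      generalize f y1 ((Tm o n φ ^ (2 * t)) y1) = p at *
      generalize f y2 ((Tm o n φ ^ (2 * t)) y2) = p' at *
      generalize f x ((Tm o n φ ^ (2 * t)) y2) = X2 at *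
      generalize f y ((Tm o n φ ^ (2 * t)) y2) = Y2 at *
      have hD : X1 * Y2 - X2 * Y1 ≠ 0 := by
        intro hD
        have : (c1 * c2 * p) * (c1 * c2 * p') = 0 := by
          rw [f11, f22]
          linear_combination (c1 * c2 * (X1 * Y2 - X2 * Y1)) * hD - (c2 * (X1 * X2) + c1 * (Y1 * Y2)) * f12
        simp [c1n, c2n, n1, n2] at this
      refine rad u v hu' hv' ?_ ?_
      · have : (X1 * Y2 - X2 * Y1) * (c2 * f x ((Tm o n φ ^ (2 * t)) (u : V))) = 0 := by linear_combination Y1 * g2 - Y2 * g1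
        simpa [hD, c2n] using this
      · have : (X1 * Y2 - X2 * Y1) * (c1 * f y ((Tm o n φ ^ (2 * t)) (u : V))) = 0 := by linear_combination X2 * g1 - X1 * g2
        simpa [hD, c1n] using this
    · exact oth j jo jd u v hu' hv'
  have fr1 := sp.finrank
  have fr2 := spW.finrank
  obtain ⟨E1, E2, -⟩ := EZ h4 qW' hzW (by omega)
  obtain ⟨-, E3, -⟩ := EZ h4 q' hz h8
  have rW := rev_res hr hW' sW'
  have iW := hσ.restrict sW'
  have ssW : σ.restrict sW' * σ.restrict sW' = 1 := by
    ext z; exact LinearMap.congr_fun hss (z : V)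
  rw [chi_split h2 h.symm h.nd spW hσ sW sW', E1 _ (by simp) _ iW ssW rW] at s1 s2
  have n1 := nu_split h2 h.symm h.nd sp (-1)
  have n2 := nu_split h2 h.symm h.nd spW (-1)
  rw [n1, hnu, E3, E2, mul_one, mul_one] at n2
  have k : ∀ A : ℤˣ, A * -1 = 1 → A = -1 := by decide
  refine TBchi h4 qW (B.down hW m1 m2) hfW (hσ.restrict sW) (rev_res hr hW sW) (l := l) (m := m) (Subtype.ext ?_) hl (Subtype.ext ?_) hm n2.symm (k _ s1) (k _ s2)
  · exact hl1
  · exact hm1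

end

section
variable {f : BilinForm K V} {φ : End K V} {o n : ℕ} {ε : K} {t : ℕ} {x y : V}

theorem QS_exists [Finite K] [FiniteDimensional K V] (hs : f.IsSymm) (hf : f.Nondegenerate) (hi : Iso f φ) :
    ∃ o n, QS f φ o n := by
  obtain ⟨o, ho, h1⟩ := hi.ford hf
  obtain ⟨p, hc⟩ := CharP.exists K
  haveI := hc
  have hp : p.Prime := (CharP.char_is_prime_or_zero K p).resolve_right (CharP.char_ne_zero_of_finite K p)
  haveI : Fact p.Prime := ⟨hp⟩
  obtain ⟨a, n, hn, e⟩ := Nat.exists_eq_pow_mul_and_not_dvd ho.ne' p hp.ne_one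
  refine ⟨o, n, hs, hf, hi, ho, h1, fun h0 => hn ((CharP.cast_eq_zero_iff K p n).1 h0), p ^ a, ?_⟩
  have e1 : (pT K o n) ^ (p ^ a) = X ^ ((o - 1) * n * p ^ a) * (X ^ (o * 2) - 1) := by
    unfold pT
    rw [mul_pow, sub_pow_char_pow, one_pow, ← pow_mul, ← pow_mul]
    congr 3
    rw [e]; ring
  rw [Tm, ← map_pow, e1, map_mul, map_sub, map_pow (aeval φ) X (o * 2), aeval_X, pow_mul φ o 2, h1, one_pow, map_one, sub_self, mul_zero]

theorem biref_iff [Finite K] [FiniteDimensional K V] (h4 : ¬ IsSquare (-1 : K)) (hs : f.IsSymm) (hf : f.Nondegenerate)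
    {φ : V ≃ₗ[K] V} (hφ : φ ∈ omegaGroup f) :
    IsBireflectionalIn (omegaGroup f) φ ↔ HC f (φ : V →ₗ[K] V) 1 1 := by
  constructor
  · rintro ⟨σ, τ, hσ, hτ, s1, t1, e⟩
    obtain ⟨i, c1, c2⟩ := (omega_iff h4 hs hf σ).1 hσ
    refine ⟨σ, i, ?_, ?_, c1, c2⟩
    · rw [← LinearEquiv.coe_toLinearMap_mul, ← sq, s1]; rfl
    · rw [← LinearEquiv.coe_toLinearMap_mul, ← LinearEquiv.coe_toLinearMap_mul]
      congr 1
      rw [e]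
      rw [sq] at s1 t1
      calc σ * τ * σ * (σ * τ) = σ * τ * (σ * σ) * τ := by group
        _ = σ * (τ * τ) := by rw [s1]; group
        _ = σ := by rw [t1, mul_one]
  · rintro ⟨β, i, h1, h2, c1, c2⟩
    have e := i.equiv_coe hf
    generalize i.equiv hf = s at e
    subst e
    have hm : s ∈ omegaGroup f := (omega_iff h4 hs hf s).2 ⟨i, c1, c2⟩
    rw [← LinearEquiv.coe_toLinearMap_mul] at h1
    rw [← LinearEquiv.coe_toLinearMap_mul, ← LinearEquiv.coe_toLinearMap_mul] at h2
    have h2 := LinearEquiv.toLinearMap_injective h2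
    have h1 : s * s = 1 := LinearEquiv.toLinearMap_injective h1
    refine ⟨s, s * φ, hm, mul_mem hm hφ, by rw [sq, h1], ?_, by rw [← mul_assoc, h1, one_mul]⟩
    calc (s * φ) ^ 2 = s * (φ * s * φ) := by rw [sq]; group
      _ = 1 := by rw [h2, h1]

theorem rev_iff [Finite K] [FiniteDimensional K V] (h4 : ¬ IsSquare (-1 : K)) (hs : f.IsSymm) (hf : f.Nondegenerate)
    {φ : V ≃ₗ[K] V} : IsReversibleIn (omegaGroup f) φ ↔ RC f (φ : V →ₗ[K] V) 1 1 := by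
  constructor
  · rintro ⟨a, ha, e⟩
    obtain ⟨i, c1, c2⟩ := (omega_iff h4 hs hf a).1 ha
    refine ⟨a, i, ?_, c1, c2⟩
    rw [← LinearEquiv.coe_toLinearMap_mul, ← LinearEquiv.coe_toLinearMap_mul]
    congr 1
    rw [mul_inv_eq_iff_eq_mul] at e
    rw [mul_assoc, e]; group
  · rintro ⟨β, i, h2, c1, c2⟩
    have e := i.equiv_coe hf
    generalize i.equiv hf = s at e
    subst e
    rw [← LinearEquiv.coe_toLinearMap_mul, ← LinearEquiv.coe_toLinearMap_mul] at h2
    have h2 := LinearEquiv.toLinearMap_injective h2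
    refine ⟨s, (omega_iff h4 hs hf s).2 ⟨i, c1, c2⟩, ?_⟩
    rw [mul_inv_eq_iff_eq_mul, eq_inv_mul_iff_mul_eq, ← mul_assoc, h2]

theorem main [Finite K] [FiniteDimensional K V] (h4 : ¬ IsSquare (-1 : K))
    (f : BilinForm K V) (hs : f.IsSymm) (hf : f.Nondegenerate) (φ : End K V) (hφ : Iso f φ) :
    (RC f φ 1 1 ∧ ¬ HC f φ 1 1) ↔
      ∃ (UO UE : Submodule K V) (hO : Invt φ UO) (hE : Invt φ UE),
        (∀ x ∈ UO, ∀ y ∈ UE, f x y = 0) ∧ UO ⊓ UE = ⊥ ∧ UO ⊔ UE = ⊤ ∧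
        (f.restrict UO).Nondegenerate ∧ (f.restrict UE).Nondegenerate ∧
        (∃ (t : ℕ) (p : K[X]), (p = X - 1 ∨ p = X + 1) ∧
          IsBicyclicEnd (φ.restrict hO) ∧
          edMult (φ.restrict hO) p (2 * t + 1) = 2 ∧
          (∀ (r : K[X]) (d : ℕ), r.Monic → Irreducible r → d ≠ 0 →
            ¬(r = p ∧ d = 2 * t + 1) → edMult (φ.restrict hO) r d = 0)) ∧
        HasDisc (f.restrict UO) 1 ∧ finrank K UE % 8 = 4 ∧
        (∀ (r : K[X]) (d : ℕ), r.Monic → Irreducible r → Odd d →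
          edMult (φ.restrict hE) r d = 0) := by
  have h2 := two_ne h4
  obtain ⟨o, n, h⟩ := QS_exists hs hf hφ
  constructor
  · rintro ⟨⟨α, hα, ha, c1, c2⟩, hn⟩
    obtain ⟨ε, t, x, y, U, hU, hU', b, nU, d, hx, hy, hnu, d8, hz⟩ := fwd h4 h hα ha c1 c2 hn
    have sp := Sp.of_nd hs nU
    have nU' := sp.nd' hs hf
    have hQ := h.restrict hU nU
    have hQ' := h.restrict hU' nU'
    have b' := b.down hU hx hy
    refine ⟨U, f.orthogonal U, hU, hU', sp.orth, sp.compl.inf_eq_bot, sp.compl.sup_eq_top, nU, nU', ⟨t, X - C ε, ?_, ?_, ?_, ?_⟩, ?_, d8, ?_⟩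
    · rcases b.i.sg with e | e <;> rw [e] <;> simp
    · exact b'.bic h2 hQ d
    · exact b'.edm h2 hQ d
    · intro r e hr hi d0 hne
      exact b'.edm0 h2 hQ d hr hi d0 hne
    · exact (hasDisc_iff h4 hQ.symm nU).2 hnu
    · intro r e hr hi ho
      exact hQ'.ed_of_HZ h2 hz hi ho
  · rintro ⟨U, U', hU, hU', ort, inf, sup, nU, nU', ⟨t, p, hp, -, e2, e0⟩, hD, d8, hE⟩
    have sp : Sp f U U' := ⟨⟨disjoint_iff.2 inf, codisjoint_iff.2 sup⟩, ort⟩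
    have hQ := h.restrict hU nU
    have hQ' := h.restrict hU' nU'
    obtain ⟨ε, he, rfl⟩ : ∃ ε : K, (ε = 1 ∨ ε = -1) ∧ p = X - C ε := by
      rcases hp with rfl | rfl
      · exact ⟨1, Or.inl rfl, by simp⟩
      · exact ⟨-1, Or.inr rfl, by simp⟩
    obtain ⟨x, y, b, d⟩ := TB_of_ed h2 hQ he e2 e0
    have hz := hQ'.HZ_of_ed h2 hE
    exact ⟨bwd1 h4 h sp hU hU' b d (EZ h4 hQ' hz d8).2.2, bwd2 h4 h sp hU hU' b d ((hasDisc_iff h4 hQ.symm nU).1 hD) hz d8⟩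

end

end

/-- For `K = GF(q)`, `q ≡ 3 (mod 4)`, and `φ ∈ Ω(V)`: `φ` is reversible but
not bireflectional in `Ω(V)` iff `φ = φ_O ⊥ φ_E` where `φ_O` is bicyclic with elementary
divisors `e₁ = e₂ = (x ∓ 1)^{2t+1}`, `disc V_O = 1`, `dim V_E ≡ 4 (mod 8)`, and `φ_E` has no
elementary divisor `p^d` with `d` odd. -/
theorem stmt6 [Fintype K] {q : ℕ} (hq : Fintype.card K = q) (h3 : q % 4 = 3)
    [FiniteDimensional K V]
    (f : LinearMap.BilinForm K V) (hsymm : f.IsSymm) (hnd : f.Nondegenerate)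
    (φ : V ≃ₗ[K] V) (hφ : φ ∈ omegaGroup f) :
    (IsReversibleIn (omegaGroup f) φ ∧ ¬IsBireflectionalIn (omegaGroup f) φ) ↔
      ∃ (UO UE : Submodule K V) (hO : Invt (φ : V →ₗ[K] V) UO)
        (hE : Invt (φ : V →ₗ[K] V) UE),
        (∀ x ∈ UO, ∀ y ∈ UE, f x y = 0) ∧ UO ⊓ UE = ⊥ ∧ UO ⊔ UE = ⊤ ∧
        (f.restrict UO).Nondegenerate ∧ (f.restrict UE).Nondegenerate ∧
        (∃ (t : ℕ) (p : K[X]), (p = X - 1 ∨ p = X + 1) ∧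
          IsBicyclicEnd ((φ : V →ₗ[K] V).restrict hO) ∧
          edMult ((φ : V →ₗ[K] V).restrict hO) p (2 * t + 1) = 2 ∧
          (∀ (r : K[X]) (d : ℕ), r.Monic → Irreducible r → d ≠ 0 →
            ¬(r = p ∧ d = 2 * t + 1) → edMult ((φ : V →ₗ[K] V).restrict hO) r d = 0)) ∧
        HasDisc (f.restrict UO) 1 ∧ Module.finrank K UE % 8 = 4 ∧
        (∀ (r : K[X]) (d : ℕ), r.Monic → Irreducible r → Odd d →
          edMult ((φ : V →ₗ[K] V).restrict hE) r d = 0) := by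
  have h4 : ¬ IsSquare (-1 : K) := by
    rw [FiniteField.isSquare_neg_one_iff, hq, h3]; simp
  rw [rev_iff h4 hsymm hnd, biref_iff h4 hsymm hnd hφ]
  exact main h4 f hsymm hnd _ ((omega_iff h4 hsymm hnd φ).1 hφ).1

end Biref
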